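/- arXiv:1804.06671 — 2 statements merged into one kernel-verified Lean document; each statement's English description precedes it below -/
import Mathlib

section
/- Let φ be a conformal mapping from the unit disk Δ onto a simply connected domain Ω ⊊ ℂ, and assume that ∂Ω is an Ahlfors-regular curve. Then the push-forward operator (φ⁻¹)* is well-defined from CM₀(Δ) to CM₀(Ω): for every vanishing Carleson measure ν on Δ, the measure μ(A) = ∫_{φ⁻¹(A)} |φ′| dν is a vanishing Carleson measure on Ω. -/
open MeasureTheory Metric Set
open scoped ENNReal NNReal

/-- The open unit disk `Δ` in the complex plane. -/
def unitDisk : Set ℂ := Metric.ball (0 : ℂ) 1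

/-- The Carleson "norm" `‖μ‖_* = sup { μ(Ω ∩ D(z,r))/r : z ∈ ∂Ω, 0 < r < diam ∂Ω }`
of a positive Borel measure relative to a domain `Ω`. -/
noncomputable def carlesonNorm (Ω : Set ℂ) (μ : Measure ℂ) : ℝ≥0∞ :=
  ⨆ z ∈ frontier Ω, ⨆ r : ℝ,
    ⨆ (_ : 0 < r ∧ ENNReal.ofReal r < EMetric.diam (frontier Ω)),
      μ (Ω ∩ Metric.ball z r) / ENNReal.ofReal r

/-- `μ` is a Carleson measure on `Ω`. -/
def IsCarleson (Ω : Set ℂ) (μ : Measure ℂ) : Prop :=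
  carlesonNorm Ω μ < ⊤

/-- The push-forward `(φ⁻¹)* ν` of a measure `ν` on `D` under a conformal map `φ` of `D`:
the measure `A ↦ ∫_{φ⁻¹(A)} |φ′| dν`. -/
noncomputable def pushForward (D : Set ℂ) (φ : ℂ → ℂ) (ν : Measure ℂ) : Measure ℂ :=
  Measure.map φ ((ν.restrict D).withDensity fun z => (‖deriv φ z‖₊ : ℝ≥0∞))

/-- `μ` is a vanishing Carleson measure on `Ω`: a Carleson measure with
`μ(Ω ∩ D(z,r))/r → 0` as `r → 0`, uniformly in `z ∈ ∂Ω`. -/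
def IsVanishingCarleson (Ω : Set ℂ) (μ : Measure ℂ) : Prop :=
  IsCarleson Ω μ ∧
    ∀ ε : ℝ, 0 < ε → ∃ δ : ℝ, 0 < δ ∧ ∀ z ∈ frontier Ω, ∀ r : ℝ, 0 < r → r < δ →
      μ (Ω ∩ Metric.ball z r) ≤ ENNReal.ofReal (ε * r)

section

set_option maxSynthPendingDepth 3

open Filter Topology Convolution

/-- An injective holomorphic function maps neighbourhoods to neighbourhoods. -/
lemma nhds_le_map_nhds_of_injOn {U : Set ℂ} (hU : IsOpen U) {f : ℂ → ℂ}
    (hf : DifferentiableOn ℂ f U) (hinj : InjOn f U) {z : ℂ} (hz : z ∈ U) :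
    𝓝 (f z) ≤ map f (𝓝 z) := by
  have han : AnalyticAt ℂ f z := hf.analyticAt (hU.mem_nhds hz)
  refine han.eventually_constant_or_nhds_le_map_nhds.resolve_left fun h => ?_
  have h2 : ∀ᶠ w in 𝓝 z, w = z := by
    filter_upwards [h, hU.mem_nhds hz] with w hw hwU using hinj hwU hz hw
  have h3 : ∀ᶠ w in 𝓝[≠] z, w = z := h2.filter_mono nhdsWithin_le_nhds
  obtain ⟨w, hw, hne⟩ := (h3.and self_mem_nhdsWithin).exists
  exact hne hw

lemma isOpen_image_of_injOn {U : Set ℂ} (hU : IsOpen U) {f : ℂ → ℂ}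
    (hf : DifferentiableOn ℂ f U) (hinj : InjOn f U) : IsOpen (f '' U) := by
  rw [isOpen_iff_mem_nhds]
  rintro _ ⟨z, hz, rfl⟩
  exact nhds_le_map_nhds_of_injOn hU hf hinj hz (image_mem_map (hU.mem_nhds hz))

/-- An injective holomorphic function on an open set has a holomorphic inverse. -/
lemma exists_holomorphic_leftInverse {U : Set ℂ} (hU : IsOpen U) {f : ℂ → ℂ}
    (hf : DifferentiableOn ℂ f U) (hinj : InjOn f U) :
    ∃ g : ℂ → ℂ, DifferentiableOn ℂ g (f '' U) ∧ ∀ z ∈ U, g (f z) = z := by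
  have hleft : ∀ z ∈ U, Function.invFunOn f U (f z) = z := fun z hz =>
    hinj.leftInvOn_invFunOn hz
  set g := Function.invFunOn f U
  refine ⟨g, ?_, hleft⟩
  have hcont : ∀ z ∈ U, ContinuousAt g (f z) := by
    intro z hz V hV
    rw [hleft z hz] at hV
    have hmem : f '' (V ∩ U) ∈ 𝓝 (f z) := nhds_le_map_nhds_of_injOn hU hf hinj hz
      (image_mem_map (inter_mem hV (hU.mem_nhds hz)))
    change g ⁻¹' V ∈ 𝓝 (f z)
    refine mem_of_superset hmem ?_
    rintro _ ⟨w, ⟨hwV, hwU⟩, rfl⟩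
    simpa [hleft w hwU] using hwV
  have hopen := isOpen_image_of_injOn hU hf hinj
  have hreg : ∀ z ∈ U, deriv f z ≠ 0 → DifferentiableAt ℂ g (f z) := by
    intro z hz hne
    have hd : HasDerivAt f (deriv f z) (g (f z)) := by
      rw [hleft z hz]; exact (hf.differentiableAt (hU.mem_nhds hz)).hasDerivAt
    refine (HasDerivAt.of_local_left_inverse (hcont z hz) hd hne ?_).differentiableAt
    filter_upwards [hopen.mem_nhds (mem_image_of_mem f hz)]
    rintro _ ⟨w, hw, rfl⟩
    rw [hleft w hw]
  rintro _ ⟨z, hz, rfl⟩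
  refine DifferentiableAt.differentiableWithinAt ?_
  by_cases hne : deriv f z ≠ 0
  · exact hreg z hz hne
  have han : AnalyticAt ℂ (deriv f) z :=
    (hf.analyticAt (hU.mem_nhds hz)).deriv
  have hev : ∀ᶠ w in 𝓝[≠] z, deriv f w ≠ 0 := by
    refine han.eventually_eq_zero_or_eventually_ne_zero.resolve_left fun h => ?_
    obtain ⟨ε, hε, hball⟩ := Metric.eventually_nhds_iff_ball.1 (h.and (hU.mem_nhds hz))
    have hz' : z ∈ ball z ε := mem_ball_self hε
    have hpt : z + (ε / 2 : ℝ) ∈ ball z ε := by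
      simp [abs_of_pos hε, hε]
    have hc : f (z + (ε / 2 : ℝ)) = f z := by
      refine isOpen_ball.is_const_of_deriv_eq_zero (convex_ball z ε).isPreconnected
        (hf.mono fun w hw => (hball w hw).2) (fun w hw => (hball w hw).1) hpt hz'
    have := hinj (hball _ hpt).2 hz hc
    simp [hε.ne'] at this
  have hev' : ∀ᶠ w in 𝓝[≠] (f z), DifferentiableAt ℂ g w := by
    rw [eventually_nhdsWithin_iff] at hev ⊢
    have : ∀ᶠ w in map f (𝓝 z), w ∈ ({f z}ᶜ : Set ℂ) → DifferentiableAt ℂ g w := by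
      rw [eventually_map]
      filter_upwards [hev, hU.mem_nhds hz] with w hw hwU hwne
      refine hreg w hwU (hw ?_)
      rintro rfl
      exact hwne rfl
    exact this.filter_mono (nhds_le_map_nhds_of_injOn hU hf hinj hz)
  exact (Complex.analyticAt_of_differentiable_on_punctured_nhds_of_continuousAt hev'
    (hcont z hz)).differentiableAt

/-- A quantitative form of Bloch's theorem. -/
lemma exists_ball_subset_image_of_deriv {f : ℂ → ℂ} {c : ℂ} {R : ℝ} (hR : 0 < R)
    (hf : DifferentiableOn ℂ f (ball c R)) :
    ∃ a ∈ ball c R, ball (f a) (R * ‖deriv f c‖ / 256) ⊆ f '' ball c R := by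
  rcases eq_or_ne (deriv f c) 0 with h0 | h0
  · exact ⟨c, mem_ball_self hR, by simp [h0]⟩
  have hdf : DifferentiableOn ℂ (deriv f) (ball c R) := hf.deriv isOpen_ball
  have hsub : closedBall c (R / 2) ⊆ ball c R := closedBall_subset_ball (by linarith)
  have hcontg : ContinuousOn (fun z => (R / 2 - dist z c) * ‖deriv f z‖) (closedBall c (R / 2)) :=
    (Continuous.continuousOn (by fun_prop)).mul (hdf.continuousOn.mono hsub).norm
  obtain ⟨a, ha, hmax⟩ := (isCompact_closedBall c (R / 2)).exists_isMaxOn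
    ⟨c, mem_closedBall_self (by linarith)⟩ hcontg
  have hM : R / 2 * ‖deriv f c‖ ≤ (R / 2 - dist a c) * ‖deriv f a‖ := by
    simpa using hmax (mem_closedBall_self (x := c) (by linarith : (0 : ℝ) ≤ R / 2))
  have hcpos : 0 < ‖deriv f c‖ := norm_pos_iff.2 h0
  have hMpos : 0 < (R / 2 - dist a c) * ‖deriv f a‖ := lt_of_lt_of_le (by positivity) hM
  have htpos : 0 < R / 2 - dist a c := pos_of_mul_pos_left hMpos (norm_nonneg _)
  set A := ‖deriv f a‖ with hA
  have hApos : 0 < A := pos_of_mul_pos_right hMpos htpos.le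
  set t := (R / 2 - dist a c) / 2 with ht
  have htp : 0 < t := by positivity
  have hbt : ∀ z ∈ ball a t, dist z c ≤ R / 2 - t := by
    intro z hz
    have := dist_triangle z a c
    have hz' : dist z a < t := hz
    linarith
  have hbtR : ball a t ⊆ ball c R := fun z hz => by
    have := hbt z hz
    rw [mem_ball]; linarith
  have hbound : ∀ z ∈ ball a t, ‖deriv f z‖ ≤ 2 * A := by
    intro z hz
    have h1 := hbt z hz
    have h2 : (R / 2 - dist z c) * ‖deriv f z‖ ≤ (R / 2 - dist a c) * A :=
      hmax (show z ∈ closedBall c (R / 2) by rw [mem_closedBall]; linarith)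
    have h3 : t * ‖deriv f z‖ ≤ t * (2 * A) := by
      calc t * ‖deriv f z‖ ≤ (R / 2 - dist z c) * ‖deriv f z‖ := by
            gcongr; linarith
        _ ≤ _ := h2
        _ = t * (2 * A) := by rw [ht]; ring
    exact le_of_mul_le_mul_left h3 htp
  have hschwarz : ∀ z ∈ ball a t, dist (deriv f z) (deriv f a) ≤ 4 * A / t * dist z a := by
    intro z hz
    refine Complex.dist_le_div_mul_dist_of_mapsTo_ball (hdf.mono hbtR) (fun w hw => ?_) hz
    rw [mem_closedBall, dist_eq_norm]
    refine (norm_sub_le _ _).trans ?_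
    have := hbound w hw
    linarith
  set ρ := t / 8 with hρ
  have hρp : 0 < ρ := by positivity
  have hρt : closedBall a ρ ⊆ ball a t := closedBall_subset_ball (by linarith)
  have hclose : ∀ z ∈ closedBall a ρ, ‖deriv f z - deriv f a‖ ≤ A / 2 := by
    intro z hz
    rw [← dist_eq_norm]
    refine (hschwarz z (hρt hz)).trans ?_
    have : dist z a ≤ ρ := hz
    calc 4 * A / t * dist z a ≤ 4 * A / t * (t / 8) := by gcongr
      _ = A / 2 := by field_simp; norm_num
  have hlin : ∀ z ∈ closedBall a ρ, ‖f z - f a - deriv f a * (z - a)‖ ≤ A / 2 * ‖z - a‖ := by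
    intro z hz
    have key := (convex_closedBall a ρ).norm_image_sub_le_of_norm_hasDerivWithin_le
      (f := fun w => f w - deriv f a * w) (f' := fun w => deriv f w - deriv f a) (C := A / 2)
      (fun w hw => (((hf.differentiableAt (isOpen_ball.mem_nhds
        (hbtR (hρt hw)))).hasDerivAt.sub (by
          simpa using (hasDerivAt_id w).const_mul (deriv f a)))).hasDerivWithinAt)
      hclose (mem_closedBall_self hρp.le) hz
    refine le_of_eq_of_le ?_ key
    congr 1; ring
  have hsphere : ∀ z ∈ sphere a ρ, A / 2 * ρ ≤ ‖f z - f a‖ := by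
    intro z hz
    have hz' : ‖z - a‖ = ρ := by rw [← dist_eq_norm]; exact hz
    have h1 := hlin z (sphere_subset_closedBall hz)
    have h2 : ‖deriv f a * (z - a)‖ = A * ρ := by rw [norm_mul, hz']
    have h3 : ‖deriv f a * (z - a)‖ ≤ ‖f z - f a‖ + ‖f z - f a - deriv f a * (z - a)‖ := by
      have := norm_sub_le (f z - f a) (f z - f a - deriv f a * (z - a))
      simpa using this
    rw [hz'] at h1
    nlinarith
  have hdiff : DiffContOnCl ℂ f (ball a ρ) := by
    apply DifferentiableOn.diffContOnCl
    rw [closure_ball a hρp.ne']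
    exact hf.mono (hρt.trans hbtR)
  have hnc : ∃ᶠ z in 𝓝 a, f z ≠ f a := by
    intro hev
    simp only [not_not] at hev
    have : deriv f a = 0 := by
      rw [EventuallyEq.deriv_eq (f := fun _ => f a) hev]; simp
    rw [hA, this, norm_zero] at hApos
    exact lt_irrefl _ hApos
  have hfin := hdiff.ball_subset_image_closedBall hρp hsphere hnc
  refine ⟨a, hbtR (mem_ball_self htp), ?_⟩
  refine (ball_subset_ball ?_).trans (hfin.trans (image_mono (hρt.trans hbtR)))
  have : t * A = (R / 2 - dist a c) * A / 2 := by rw [ht]; ring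
  rw [hρ]
  nlinarith

/-- A distortion estimate: a univalent function on a disk omitting the value `y`. -/
lemma norm_deriv_le_of_injOn_of_notMem {f : ℂ → ℂ} {c y : ℂ} {R : ℝ} (hR : 0 < R)
    (hf : DifferentiableOn ℂ f (ball c R)) (hinj : InjOn f (ball c R))
    (hy : y ∉ f '' ball c R) :
    R * ‖deriv f c‖ ≤ 1024 * ‖f c - y‖ := by
  have hne : ∀ z ∈ ball c R, f z - y ≠ 0 := fun z hz h =>
    hy ⟨z, hz, sub_eq_zero.1 h⟩
  have hfd : ∀ z ∈ ball c R, HasDerivAt f (deriv f z) z := fun z hz =>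
    (hf.differentiableAt (isOpen_ball.mem_nhds hz)).hasDerivAt
  have hq : DifferentiableOn ℂ (fun z => deriv f z / (f z - y)) (ball c R) :=
    (hf.deriv isOpen_ball).div (hf.sub_const y) hne
  obtain ⟨L, hL⟩ := hq.isExactOn_ball
  have hconst : ∀ z ∈ ball c R, Complex.exp (-L z) * (f z - y) =
      Complex.exp (-L c) * (f c - y) := by
    intro z hz
    have hder : ∀ w ∈ ball c R,
        HasDerivAt (fun z => Complex.exp (-L z) * (f z - y)) 0 w := by
      intro w hw
      have h1 := ((hL w hw).neg.cexp).mul ((hfd w hw).sub_const y)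
      refine h1.congr_deriv ?_
      have := hne w hw
      simp only [mul_assoc, neg_mul, div_mul_cancel₀ _ this]
      ring
    exact isOpen_ball.is_const_of_deriv_eq_zero (convex_ball c R).isPreconnected
      (fun w hw => (hder w hw).differentiableAt.differentiableWithinAt)
      (fun w hw => (hder w hw).deriv) hz (mem_ball_self hR)
  have hLd : DifferentiableOn ℂ L (ball c R) := fun w hw =>
    (hL w hw).differentiableAt.differentiableWithinAt
  obtain ⟨a, ha, hsub⟩ := exists_ball_subset_image_of_deriv hR hLd
  have hderc : deriv L c = deriv f c / (f c - y) := (hL c (mem_ball_self hR)).deriv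
  have hcy : 0 < ‖f c - y‖ := norm_pos_iff.2 (hne c (mem_ball_self hR))
  have hle : R * ‖deriv L c‖ / 256 ≤ 4 := by
    by_contra! hlt
    have hin : ∀ s : ℝ, |s| ≤ Real.pi → L a + s * Complex.I ∈ L '' ball c R := by
      intro s hs
      apply hsub
      rw [mem_ball, dist_eq_norm]
      simp only [add_sub_cancel_left, norm_mul, Complex.norm_real, Complex.norm_I, mul_one,
        Real.norm_eq_abs]
      linarith [Real.pi_lt_four]
    obtain ⟨p, hp, hpe⟩ := hin Real.pi (by simp [abs_of_pos Real.pi_pos])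
    obtain ⟨q, hq, hqe⟩ := hin (-Real.pi) (by simp [abs_of_pos Real.pi_pos])
    have hpq : L p = L q + 2 * Real.pi * Complex.I := by
      rw [hpe, hqe]; push_cast; ring
    have hexp : Complex.exp (-L p) = Complex.exp (-L q) := by
      rw [hpq, neg_add, Complex.exp_add, Complex.exp_neg (2 * Real.pi * Complex.I),
        Complex.exp_two_pi_mul_I]
      simp
    have h1 := (hconst p hp).trans (hconst q hq).symm
    rw [hexp] at h1
    have h2 : f p = f q := by
      have := mul_left_cancel₀ (Complex.exp_ne_zero _) h1
      simpa using this
    have h3 := hinj hp hq h2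
    rw [h3] at hpq
    have : (2 * Real.pi * Complex.I : ℂ) = 0 := by
      linear_combination -hpq
    simp [Real.pi_ne_zero] at this
  rw [hderc, norm_div] at hle
  have : R * (‖deriv f c‖ / ‖f c - y‖) ≤ 1024 := by linarith
  rw [← mul_div_assoc, div_le_iff₀ hcy] at this
  exact this

/-- A simply connected domain contains no circle around a point of its complement. -/
lemma not_sphere_subset_image {f : ℂ → ℂ} (hf : DifferentiableOn ℂ f (ball 0 1))
    (hinj : InjOn f (ball 0 1)) {y : ℂ} (hy : y ∉ f '' ball 0 1) {ρ : ℝ} (hρ : 0 < ρ) :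
    ¬ sphere y ρ ⊆ f '' ball 0 1 := by
  intro hsub
  obtain ⟨g, hg, hgf⟩ := exists_holomorphic_leftInverse isOpen_ball hf hinj
  have hopen := isOpen_image_of_injOn isOpen_ball hf hinj
  have hne : ∀ z ∈ ball (0 : ℂ) 1, f z - y ≠ 0 := fun z hz h =>
    hy ⟨z, hz, sub_eq_zero.1 h⟩
  have hq : DifferentiableOn ℂ (fun z => deriv f z / (f z - y)) (ball 0 1) :=
    (hf.deriv isOpen_ball).div (hf.sub_const y) hne
  obtain ⟨L, hL⟩ := hq.isExactOn_ball
  have hder : ∀ w ∈ f '' ball 0 1, HasDerivAt (L ∘ g) (w - y)⁻¹ w := by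
    rintro _ ⟨z, hz, rfl⟩
    have hgd : HasDerivAt g (deriv g (f z)) (f z) :=
      (hg.differentiableAt (hopen.mem_nhds ⟨z, hz, rfl⟩)).hasDerivAt
    have hfd : HasDerivAt f (deriv f z) z :=
      (hf.differentiableAt (isOpen_ball.mem_nhds hz)).hasDerivAt
    have hcomp : deriv g (f z) * deriv f z = 1 := by
      have h1 := hgd.comp z hfd
      have h2 : HasDerivAt (g ∘ f) 1 z := by
        refine (hasDerivAt_id z).congr_of_eventuallyEq ?_
        filter_upwards [isOpen_ball.mem_nhds hz] with w hw using hgf w hw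
      exact h1.unique h2
    have hLz := hL z hz
    rw [← hgf z hz] at hLz
    refine (hLz.comp (f z) hgd).congr_deriv ?_
    have := hne z hz
    simp only [hgf z hz]
    rw [div_mul_eq_mul_div, mul_comm, hcomp, one_div]
  have hzero : (∮ w in C(y, ρ), (w - y)⁻¹) = 0 :=
    circleIntegral.integral_eq_zero_of_hasDerivWithinAt hρ.le
      (fun w hw => (hder w (hsub hw)).hasDerivWithinAt)
  rw [circleIntegral.integral_sub_center_inv y hρ.ne'] at hzero
  simp [Real.pi_ne_zero] at hzero

lemma isPreconnected_inter_frontier_nonempty {X : Type*} [TopologicalSpace X] {t u : Set X}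
    (ht : IsPreconnected t) (h1 : (t ∩ u).Nonempty) (h2 : (t ∩ uᶜ).Nonempty) :
    (t ∩ frontier u).Nonempty := by
  by_contra hemp
  rw [not_nonempty_iff_eq_empty, frontier_eq_closure_inter_closure] at hemp
  obtain ⟨x, hx⟩ := isPreconnected_closed_iff.1 ht (closure u) (closure uᶜ) isClosed_closure
    isClosed_closure (fun x _ => (em (x ∈ u)).imp (fun h => subset_closure h)
      (fun h => subset_closure h))
    (h1.mono (inter_subset_inter_right _ subset_closure))
    (h2.mono (inter_subset_inter_right _ subset_closure))
  rw [hemp] at hx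
  exact hx

/-- Lower regularity of the boundary of a planar domain no complementary point of which is
encircled by the domain. -/
lemma ofReal_le_hausdorffMeasure_frontier_inter_ball {Ω : Set ℂ} (hΩ : IsOpen Ω)
    (hconn : IsConnected Ω)
    (hcirc : ∀ y ∉ Ω, ∀ ρ : ℝ, 0 < ρ → ¬ sphere y ρ ⊆ Ω)
    {y : ℂ} (hy : y ∈ frontier Ω) {s : ℝ} (hs : ¬ Ω ⊆ ball y s) :
    ENNReal.ofReal s ≤ μH[1] (frontier Ω ∩ ball y s) := by
  have hyΩ : y ∉ Ω := by
    rw [hΩ.frontier_eq] at hy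
    exact hy.2
  have himage : Ioo 0 s ⊆ (fun w => dist w y) '' (frontier Ω ∩ ball y s) := by
    rintro ρ ⟨hρ, hρs⟩
    have h1 : (Ω ∩ ball y ρ).Nonempty := by
      rw [inter_comm]
      exact mem_closure_iff_nhds.1 (frontier_subset_closure hy) _ (ball_mem_nhds y hρ)
    have h2 : (Ω ∩ (ball y ρ)ᶜ).Nonempty := by
      obtain ⟨w, hw, hws⟩ := not_subset.1 hs
      exact ⟨w, hw, fun h => hws (ball_subset_ball hρs.le h)⟩
    have h3 : (Ω ∩ frontier (ball y ρ)).Nonempty :=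
      isPreconnected_inter_frontier_nonempty hconn.isPreconnected h1 h2
    rw [frontier_ball y hρ.ne'] at h3
    have hpre : IsPreconnected (sphere y ρ) :=
      (isConnected_sphere (by simp) y hρ.le).isPreconnected
    have h4 : (sphere y ρ ∩ Ωᶜ).Nonempty := by
      obtain ⟨w, hw, hwΩ⟩ := not_subset.1 (hcirc y hyΩ ρ hρ)
      exact ⟨w, hw, hwΩ⟩
    obtain ⟨w, hw, hwf⟩ := isPreconnected_inter_frontier_nonempty hpre (by rwa [inter_comm]) h4
    exact ⟨w, ⟨hwf, by rw [mem_ball, mem_sphere.1 hw]; exact hρs⟩, hw⟩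
  have hlip : LipschitzWith 1 (fun w => dist w y) := LipschitzWith.dist_left y
  calc ENNReal.ofReal s = volume (Ioo 0 s) := by simp
    _ = μH[1] (Ioo 0 s) := by rw [hausdorffMeasure_real]
    _ ≤ μH[1] ((fun w => dist w y) '' (frontier Ω ∩ ball y s)) := measure_mono himage
    _ ≤ _ := by simpa using hlip.hausdorffMeasure_image_le zero_le_one (frontier Ω ∩ ball y s)

/-- A point realizing the distance to the complement of an open set is a frontier point. -/
lemma exists_mem_frontier_infDist_compl_eq {Ω : Set ℂ} (hΩ : IsOpen Ω) (hne : Ω ≠ univ) {w : ℂ}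
    (hw : w ∈ Ω) : ∃ y ∈ frontier Ω, infDist w Ωᶜ = dist w y := by
  have hcne : (Ωᶜ).Nonempty := nonempty_compl.2 hne
  obtain ⟨y, hy, hd⟩ := hΩ.isClosed_compl.exists_infDist_eq_dist hcne w
  refine ⟨y, ?_, hd⟩
  rw [hΩ.frontier_eq]
  refine ⟨?_, hy⟩
  have hpos : dist w y ≠ 0 := dist_ne_zero.2 (fun h => hy (h ▸ hw))
  have hball : ball w (dist w y) ⊆ Ω := by
    rw [← hd]
    intro v hv
    by_contra hvΩ
    have := infDist_le_dist_of_mem (x := w) (show v ∈ Ωᶜ from hvΩ)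
    rw [mem_ball, dist_comm] at hv
    linarith
  refine closure_mono hball ?_
  rw [closure_ball w hpos, mem_closedBall, dist_comm]

/-- The area of a thin neighbourhood of the boundary. -/
lemma volume_setOf_infDist_le {Ω : Set ℂ} (hΩ : IsOpen Ω) (hne : Ω ≠ univ)
    {C s R : ℝ} (hC : 0 < C) (hs : 0 < s) (hsR : s ≤ R)
    (hlow : ∀ y ∈ frontier Ω, ENNReal.ofReal s ≤ μH[1] (frontier Ω ∩ ball y s)) {z : ℂ}
    (hreg : ∀ r : ℝ, 0 < r → μH[1] (frontier Ω ∩ ball z r) ≤ ENNReal.ofReal (C * r)) :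
    volume {w | w ∈ Ω ∩ ball z R ∧ infDist w Ωᶜ ≤ 3 * s} ≤
      ENNReal.ofReal (80 * Real.pi * C * s * R) := by
  set N := {w | w ∈ Ω ∩ ball z R ∧ infDist w Ωᶜ ≤ 3 * s} with hN
  set H : Measure ℂ := μH[1].restrict (frontier Ω ∩ ball z (5 * R)) with hH
  have hHfin : H univ ≤ ENNReal.ofReal (C * (5 * R)) := by
    rw [hH, Measure.restrict_apply_univ]
    exact hreg _ (by linarith)
  have : IsFiniteMeasure H := ⟨hHfin.trans_lt ENNReal.ofReal_lt_top⟩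
  have hNm : MeasurableSet N := by
    refine (hΩ.measurableSet.inter measurableSet_ball).inter ?_
    exact measurableSet_le (continuous_infDist_pt _).measurable measurable_const
  have hpt : ∀ w ∈ N, ENNReal.ofReal s ≤ H (ball w (4 * s)) := by
    rintro w ⟨⟨hwΩ, hwz⟩, hwd⟩
    obtain ⟨y, hy, hyd⟩ := exists_mem_frontier_infDist_compl_eq hΩ hne hwΩ
    rw [hyd] at hwd
    refine (hlow y hy).trans ?_
    rw [hH, Measure.restrict_apply measurableSet_ball]
    refine measure_mono ?_
    rintro v ⟨hv, hvy⟩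
    rw [mem_ball] at hvy hwz
    have h1 := dist_triangle v y w
    rw [dist_comm y w] at h1
    have h2 := dist_triangle v w z
    refine ⟨?_, hv, ?_⟩ <;> rw [mem_ball] <;> linarith
  set S : Set (ℂ × ℂ) := {p | dist p.2 p.1 < 4 * s} with hS
  have hSm : MeasurableSet S :=
    (isOpen_lt (by fun_prop) continuous_const).measurableSet
  have hswap := lintegral_lintegral_swap (μ := volume.restrict N) (ν := H)
    (f := fun w y => S.indicator (fun _ => (1 : ℝ≥0∞)) (w, y))
    ((measurable_const.indicator hSm).aemeasurable)
  have hleft : ∀ w, ∫⁻ y, S.indicator (fun _ => (1 : ℝ≥0∞)) (w, y) ∂H = H (ball w (4 * s)) := by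
    intro w
    rw [← lintegral_indicator_one measurableSet_ball]
    rfl
  have hright : ∀ y, ∫⁻ w in N, S.indicator (fun _ => (1 : ℝ≥0∞)) (w, y) ≤
      ENNReal.ofReal (16 * Real.pi * s ^ 2) := by
    intro y
    have h1 : ∀ w, S.indicator (fun _ => (1 : ℝ≥0∞)) (w, y) =
        (ball y (4 * s)).indicator 1 w := by
      intro w
      simp only [indicator, hS, mem_ofPred_eq, mem_ball, dist_comm y w, Pi.one_apply]
    simp_rw [h1]
    rw [lintegral_indicator_one measurableSet_ball]
    refine (Measure.restrict_apply_le _ _).trans ?_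
    rw [Complex.volume_ball, ← ENNReal.ofReal_pow (by positivity), ← ENNReal.ofReal_coe_nnreal,
      ← ENNReal.ofReal_mul (by positivity)]
    apply ENNReal.ofReal_le_ofReal
    rw [NNReal.coe_real_pi]
    linarith
  simp_rw [hleft] at hswap
  have hmain : volume N * ENNReal.ofReal s ≤
      ENNReal.ofReal (80 * Real.pi * C * s * R) * ENNReal.ofReal s := by
    calc volume N * ENNReal.ofReal s = ∫⁻ _ in N, ENNReal.ofReal s := by
          rw [setLIntegral_const, mul_comm]
      _ ≤ ∫⁻ w in N, H (ball w (4 * s)) := setLIntegral_mono' hNm hpt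
      _ = _ := hswap
      _ ≤ ∫⁻ _, ENNReal.ofReal (16 * Real.pi * s ^ 2) ∂H := lintegral_mono hright
      _ = ENNReal.ofReal (16 * Real.pi * s ^ 2) * H univ := lintegral_const _
      _ ≤ ENNReal.ofReal (16 * Real.pi * s ^ 2) * ENNReal.ofReal (C * (5 * R)) := by gcongr
      _ = _ := by
        rw [← ENNReal.ofReal_mul (by positivity),
          ← ENNReal.ofReal_mul (by have := hs.le.trans hsR; positivity)]
        congr 1; ring
  exact (ENNReal.mul_le_mul_iff_left (by simpa using hs) ENNReal.ofReal_ne_top).1 hmain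

lemma norm_convolution_le_integral_norm {G : Type*} [NormedAddCommGroup G] [NormedSpace ℝ G]
    (L : ℝ →L[ℝ] G →L[ℝ] G) (hL : ‖L‖ ≤ 1) {f : ℂ → ℝ} (hf : ∀ v, |f v| ≤ 1) {g : ℂ → G}
    (hg : Continuous g) (hgc : HasCompactSupport g) (w : ℂ) :
    ‖(f ⋆[L, volume] g) w‖ ≤ ∫ v, ‖g v‖ := by
  have hintegr : Integrable g := hg.integrable_of_hasCompactSupport hgc
  rw [convolution_def, ← integral_sub_left_eq_self (fun v => ‖g v‖) volume w]
  refine norm_integral_le_of_norm_le (hintegr.norm.comp_sub_left w) (ae_of_all _ fun v => ?_)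
  calc ‖L (f v) (g (w - v))‖ ≤ ‖L‖ * ‖f v‖ * ‖g (w - v)‖ := L.le_opNorm₂ _ _
    _ ≤ 1 * 1 * ‖g (w - v)‖ := by
      gcongr
      exact hf v
    _ = _ := by ring

lemma exists_cutoff_one : ∃ K : ℝ, 0 < K ∧ ∀ E : Set ℂ, E.Nonempty →
    ∃ η : ℂ → ℝ, ContDiff ℝ 2 η ∧ (∀ w, 0 ≤ η w) ∧ (∀ w, η w ≤ 1) ∧
      (∀ w, ∀ y ∈ E, dist w y ≤ 1 → η w = 0) ∧
      (∀ w, (∀ y ∈ E, 3 ≤ dist w y) → η w = 1) ∧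
      (∀ w, ‖fderiv ℝ η w‖ ≤ K) ∧ ∀ w, ‖fderiv ℝ (fderiv ℝ η) w‖ ≤ K := by
  let b : ContDiffBump (0 : ℂ) := ⟨1 / 2, 1, by norm_num, by norm_num⟩
  set β : ℂ → ℝ := b.normed volume with hβ
  have hβs : ContDiff ℝ 2 β := b.contDiff_normed
  have hβc : HasCompactSupport β := b.hasCompactSupport_normed
  have hβ0 : ∀ w, 0 ≤ β w := b.nonneg_normed
  have hβint : ∫ w, β w = 1 := b.integral_normed
  have hβi : Integrable β := b.integrable_normed
  have hβsupp : ∀ w, 1 ≤ ‖w‖ → β w = 0 := by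
    intro w hw
    by_contra h
    have : w ∈ Function.support β := h
    rw [hβ, b.support_normed_eq] at this
    simp [b] at this
    linarith
  have hd1 : ContDiff ℝ 1 (fderiv ℝ β) := hβs.fderiv_right (by norm_num)
  have hd1c : HasCompactSupport (fderiv ℝ β) := hβc.fderiv ℝ
  have hd2 : Continuous (fderiv ℝ (fderiv ℝ β)) := hd1.continuous_fderiv (by norm_num)
  have hd2c : HasCompactSupport (fderiv ℝ (fderiv ℝ β)) := hd1c.fderiv ℝ
  set K1 := ∫ v, ‖fderiv ℝ β v‖
  set K2 := ∫ v, ‖fderiv ℝ (fderiv ℝ β) v‖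
  have hK1 : 0 ≤ K1 := integral_nonneg fun _ => norm_nonneg _
  have hK2 : 0 ≤ K2 := integral_nonneg fun _ => norm_nonneg _
  refine ⟨K1 + K2 + 1, by positivity, fun E hE => ?_⟩
  set A : Set ℂ := {w | 2 < infDist w E} with hA
  have hAm : MeasurableSet A :=
    measurableSet_lt measurable_const (continuous_infDist_pt _).measurable
  set f : ℂ → ℝ := A.indicator 1 with hf
  have hf0 : ∀ v, 0 ≤ f v := fun v => indicator_nonneg (fun _ _ => zero_le_one) v
  have hf1 : ∀ v, f v ≤ 1 := fun v => indicator_le_self' (fun _ _ => zero_le_one) v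
  have hfabs : ∀ v, |f v| ≤ 1 := fun v => abs_le.2 ⟨by linarith [hf0 v], hf1 v⟩
  have hfl : LocallyIntegrable f volume :=
    (locallyIntegrable_const (1 : ℝ)).indicator hAm
  set L : ℝ →L[ℝ] ℝ →L[ℝ] ℝ := ContinuousLinearMap.lsmul ℝ ℝ with hL
  have hLn : ‖L‖ ≤ 1 := ContinuousLinearMap.opNorm_lsmul_le
  set η : ℂ → ℝ := f ⋆[L, volume] β with hη
  have hηdef : ∀ w, η w = ∫ v, f v * β (w - v) := fun w => by
    rw [hη, convolution_def]; rfl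
  have hprod_int : ∀ w, Integrable (fun v => f v * β (w - v)) := by
    intro w
    refine (hβi.comp_sub_left w).bdd_mul (c := 1) ?_ (ae_of_all _ fun v => hfabs v)
    exact (measurable_const.indicator hAm).aestronglyMeasurable
  have hder : ∀ w, HasFDerivAt η ((f ⋆[L.precompR ℂ, volume] fderiv ℝ β) w) w := fun w =>
    hβc.hasFDerivAt_convolution_right L hfl (hβs.of_le (by norm_num)) w
  have hfd : fderiv ℝ η = f ⋆[L.precompR ℂ, volume] fderiv ℝ β := by
    ext1 w; exact (hder w).fderiv
  have hder2 : ∀ w, HasFDerivAt (fderiv ℝ η)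
      ((f ⋆[(L.precompR ℂ).precompR ℂ, volume] fderiv ℝ (fderiv ℝ β)) w) w := fun w => by
    rw [hfd]
    exact hd1c.hasFDerivAt_convolution_right (L.precompR ℂ) hfl hd1 w
  have hLn1 : ‖L.precompR ℂ‖ ≤ 1 := (ContinuousLinearMap.norm_precompR_le _ _).trans hLn
  have hLn2 : ‖(L.precompR ℂ).precompR ℂ‖ ≤ 1 :=
    (ContinuousLinearMap.norm_precompR_le _ _).trans hLn1
  have hle1 : ∀ w, η w ≤ 1 := by
    intro w
    rw [hηdef, ← hβint, ← integral_sub_left_eq_self β volume w]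
    refine integral_mono (hprod_int w) (hβi.comp_sub_left w) fun v => ?_
    exact mul_le_of_le_one_left (hβ0 _) (hf1 v)
  refine ⟨η, hβc.contDiff_convolution_right L hfl hβs, fun w => ?_, hle1, ?_, ?_, ?_, ?_⟩
  · rw [hηdef]
    exact integral_nonneg fun v => mul_nonneg (hf0 v) (hβ0 _)
  · intro w y hy hwy
    rw [hηdef, ← integral_zero ℂ ℝ]
    congr 1
    ext v
    rcases le_or_gt 1 ‖w - v‖ with h | h
    · rw [hβsupp _ h, mul_zero]
    · have hv : v ∉ A := by
        intro hv
        have h1 : 2 < infDist v E := hv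
        have h2 := infDist_le_dist_of_mem (x := v) hy
        have h3 := dist_triangle v w y
        rw [dist_comm v w, dist_eq_norm w v] at h3
        linarith
      rw [hf, indicator_of_notMem hv, zero_mul]
  · intro w hw
    rw [hηdef, ← hβint, ← integral_sub_left_eq_self β volume w]
    congr 1
    ext v
    rcases le_or_gt 1 ‖w - v‖ with h | h
    · rw [hβsupp _ h, mul_zero]
    · have hv : v ∈ A := by
        have h1 : 3 ≤ infDist w E := (le_infDist hE).2 fun y hy => hw y hy
        have h2 := infDist_le_infDist_add_dist (s := E) (x := w) (y := v)
        rw [dist_eq_norm] at h2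
        change 2 < infDist v E
        linarith
      rw [hf, indicator_of_mem hv, Pi.one_apply, one_mul]
  · intro w
    rw [hfd]
    have := norm_convolution_le_integral_norm (L.precompR ℂ) hLn1 hfabs hd1.continuous hd1c w
    linarith
  · intro w
    rw [(hder2 w).fderiv]
    have := norm_convolution_le_integral_norm ((L.precompR ℂ).precompR ℂ) hLn2 hfabs hd2 hd2c w
    linarith

/-- Smooth cutoff functions vanishing near a set, with derivative bounds at the given scale. -/
lemma exists_cutoff : ∃ K : ℝ, 0 < K ∧ ∀ E : Set ℂ, E.Nonempty → ∀ s : ℝ, 0 < s →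
    ∃ η : ℂ → ℝ, ContDiff ℝ 2 η ∧ (∀ w, 0 ≤ η w) ∧ (∀ w, η w ≤ 1) ∧
      (∀ w, ∀ y ∈ E, dist w y ≤ s → η w = 0) ∧
      (∀ w, (∀ y ∈ E, 3 * s ≤ dist w y) → η w = 1) ∧
      (∀ w, ‖fderiv ℝ η w‖ ≤ K / s) ∧ ∀ w, ‖fderiv ℝ (fderiv ℝ η) w‖ ≤ K / s ^ 2 := by
  obtain ⟨K, hK, h⟩ := exists_cutoff_one
  refine ⟨K, hK, fun E hE s hs => ?_⟩
  obtain ⟨y₀, hy₀⟩ := hE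
  have hsmul : ∀ w y : ℂ, dist (s⁻¹ • w) (s⁻¹ • y) = s⁻¹ * dist w y := fun w y => by
    rw [dist_smul₀, Real.norm_of_nonneg (inv_nonneg.2 hs.le)]
  obtain ⟨η, hηs, h0, h1, hz, ho, hd, hdd⟩ :=
    h ((fun y => s⁻¹ • y) '' E) ⟨_, mem_image_of_mem _ hy₀⟩
  have hfd : fderiv ℝ (fun w => η (s⁻¹ • w)) = fun w => s⁻¹ • fderiv ℝ η (s⁻¹ • w) := by
    ext1 w
    exact fderiv_comp_smul (𝕜 := ℝ) s⁻¹
  have hfdd : ∀ w, fderiv ℝ (fderiv ℝ (fun w => η (s⁻¹ • w))) w =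
      s⁻¹ • s⁻¹ • fderiv ℝ (fderiv ℝ η) (s⁻¹ • w) := by
    intro w
    rw [hfd]
    have hdiff : Differentiable ℝ (fderiv ℝ η) :=
      (hηs.fderiv_right (m := 1) (by norm_num)).differentiable (by norm_num)
    rw [fderiv_fun_const_smul]
    · congr 1
      exact fderiv_comp_smul (𝕜 := ℝ) (f := fderiv ℝ η) s⁻¹
    · exact (hdiff _).comp w (differentiableAt_id.const_smul s⁻¹)
  refine ⟨fun w => η (s⁻¹ • w), hηs.comp (contDiff_id.const_smul s⁻¹), fun w => h0 _,
    fun w => h1 _, ?_, ?_, ?_, ?_⟩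
  · intro w y hy hwy
    refine hz _ _ (mem_image_of_mem _ hy) ?_
    simp only [hsmul]
    rw [inv_mul_le_iff₀ hs]; linarith
  · intro w hw
    refine ho _ ?_
    rintro _ ⟨y, hy, rfl⟩
    rw [hsmul, le_inv_mul_iff₀ hs, mul_comm]
    exact hw y hy
  · intro w
    rw [hfd, norm_smul, Real.norm_of_nonneg (inv_nonneg.2 hs.le), inv_mul_eq_div]
    gcongr
    exact hd _
  · intro w
    rw [hfdd, norm_smul, norm_smul, Real.norm_of_nonneg (inv_nonneg.2 hs.le), ← mul_assoc,
      ← mul_inv, ← sq, inv_mul_eq_div]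
    gcongr
    exact hdd _

end

section

set_option maxSynthPendingDepth 3

open Filter Topology Function InnerProductSpace
open scoped Laplacian ComplexConjugate

lemma laplacian_complex_eq (f : ℂ → ℝ) (w : ℂ) :
    (Δ f) w = fderiv ℝ (fderiv ℝ f) w 1 1 +
      fderiv ℝ (fderiv ℝ f) w Complex.I Complex.I := by
  rw [laplacian_eq_iteratedFDeriv_complexPlane]
  simp [iteratedFDeriv_two_apply]

lemma ContDiffAt.eventually_differentiableAt_two {f : ℂ → ℝ} {w : ℂ} (hf : ContDiffAt ℝ 2 f w) :
    ∀ᶠ x in 𝓝 w, DifferentiableAt ℝ f x :=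
  (hf.eventually (by simp)).mono fun _ h => h.differentiableAt (by norm_num)

lemma ContDiffAt.differentiableAt_fderiv_two {f : ℂ → ℝ} {w : ℂ} (hf : ContDiffAt ℝ 2 f w) :
    DifferentiableAt ℝ (fderiv ℝ f) w :=
  (hf.fderiv_right (m := 1) (by norm_num)).differentiableAt (by norm_num)

lemma laplacian_mul_eq {f g : ℂ → ℝ} {w : ℂ} (hf : ContDiffAt ℝ 2 f w)
    (hg : ContDiffAt ℝ 2 g w) :
    (Δ fun x => f x * g x) w = f w * (Δ g) w + g w * (Δ f) w +
      2 * (fderiv ℝ f w 1 * fderiv ℝ g w 1 +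
        fderiv ℝ f w Complex.I * fderiv ℝ g w Complex.I) := by
  have h1 : fderiv ℝ (fun x => f x * g x) =ᶠ[𝓝 w]
      fun x => f x • fderiv ℝ g x + g x • fderiv ℝ f x := by
    filter_upwards [hf.eventually_differentiableAt_two, hg.eventually_differentiableAt_two]
      with x hfx hgx
    exact fderiv_fun_mul hfx hgx
  have hfd := (hf.differentiableAt (by norm_num)).hasFDerivAt
  have hgd := (hg.differentiableAt (by norm_num)).hasFDerivAt
  have h2 := ((hfd.smul hg.differentiableAt_fderiv_two.hasFDerivAt).add
    (hgd.smul hf.differentiableAt_fderiv_two.hasFDerivAt)).congr_of_eventuallyEq h1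
  simp only [laplacian_complex_eq, h2.fderiv]
  simp
  ring

lemma laplacian_exp_ge {h : ℂ → ℝ} {w : ℂ} (hh : ContDiffAt ℝ 2 h w) :
    Real.exp (h w) * (Δ h) w ≤ (Δ fun x => Real.exp (h x)) w := by
  have h1 : fderiv ℝ (fun x => Real.exp (h x)) =ᶠ[𝓝 w]
      fun x => Real.exp (h x) • fderiv ℝ h x := by
    filter_upwards [hh.eventually_differentiableAt_two] with x hx
    exact fderiv_exp hx
  have hd := (hh.differentiableAt (by norm_num)).hasFDerivAt
  have h2 := (hd.exp.smul hh.differentiableAt_fderiv_two.hasFDerivAt).congr_of_eventuallyEq h1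
  simp only [laplacian_complex_eq, h2.fderiv]
  simp
  have := Real.exp_pos (h w)
  nlinarith [mul_nonneg this.le (mul_self_nonneg (fderiv ℝ h w 1)),
    mul_nonneg this.le (mul_self_nonneg (fderiv ℝ h w Complex.I))]

lemma abs_laplacian_le (f : ℂ → ℝ) (w : ℂ) :
    |(Δ f) w| ≤ 2 * ‖fderiv ℝ (fderiv ℝ f) w‖ := by
  rw [laplacian_complex_eq]
  have h1 := (fderiv ℝ (fderiv ℝ f) w).le_opNorm₂ 1 1
  have h2 := (fderiv ℝ (fderiv ℝ f) w).le_opNorm₂ Complex.I Complex.I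
  simp only [norm_one, Complex.norm_I, mul_one, Real.norm_eq_abs] at h1 h2
  exact (abs_add_le _ _).trans (by linarith)

/-- The Laplacian of the squared modulus of a holomorphic function. -/
lemma laplacian_norm_sq {f : ℂ → ℂ} {w : ℂ} (hf : AnalyticAt ℂ f w) :
    ContDiffAt ℝ 2 (fun x => ‖f x‖ ^ 2) w ∧
    (Δ fun x => ‖f x‖ ^ 2) w = 4 * ‖deriv f w‖ ^ 2 := by
  have hre := hf.harmonicAt_re
  have him := hf.harmonicAt_im
  have hfd := hf.differentiableAt.hasDerivAt.hasFDerivAt.restrictScalars ℝ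
  have hdre := (Complex.reCLM.hasFDerivAt.comp w hfd).fderiv
  have hdim := (Complex.imCLM.hasFDerivAt.comp w hfd).fderiv
  change fderiv ℝ (fun x => (f x).re) w = _ at hdre
  change fderiv ℝ (fun x => (f x).im) w = _ at hdim
  have e : (fun x => ‖f x‖ ^ 2) =
      (fun x => (f x).re * (f x).re) + fun x => (f x).im * (f x).im := by
    ext x
    simp [Complex.sq_norm, Complex.normSq_apply]
  have c1 : ContDiffAt ℝ 2 (fun x => (f x).re * (f x).re) w := hre.1.mul hre.1
  have c2 : ContDiffAt ℝ 2 (fun x => (f x).im * (f x).im) w := him.1.mul him.1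
  rw [e]
  refine ⟨c1.add c2, ?_⟩
  rw [c1.laplacian_add c2, laplacian_mul_eq hre.1 hre.1, laplacian_mul_eq him.1 him.1,
    hre.2.self_of_nhds, him.2.self_of_nhds, hdre, hdim, Complex.sq_norm, Complex.normSq_apply]
  simp
  ring

lemma norm_fderiv_norm_sq_le {f : ℂ → ℂ} {w : ℂ} (hf : DifferentiableAt ℂ f w) :
    ‖fderiv ℝ (fun x => ‖f x‖ ^ 2) w‖ ≤ 2 * ‖f w‖ * ‖deriv f w‖ := by
  have hfd := hf.hasDerivAt.hasFDerivAt.restrictScalars ℝ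
  rw [hfd.norm_sq.fderiv]
  refine ContinuousLinearMap.opNorm_le_bound _ (by positivity) fun v => ?_
  have h1 : ‖inner ℝ (f w) (v * deriv f w)‖ ≤ ‖f w‖ * ‖v * deriv f w‖ :=
    norm_inner_le_norm _ _
  rw [norm_mul, Real.norm_eq_abs] at h1
  have e : (2 • (innerSL ℝ (f w)).comp (ContinuousLinearMap.restrictScalars ℝ
      (ContinuousLinearMap.toSpanSingleton ℂ (deriv f w)))) v =
      2 * inner ℝ (f w) (v * deriv f w) := by
    simp [two_mul, two_smul]
  rw [e, Real.norm_eq_abs, abs_mul, abs_two]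
  linarith

lemma integrable_mul_of_tsupport_subset {U : Set ℂ} {p q g : ℂ → ℝ} (hU : IsOpen U)
    (hgc : HasCompactSupport g) (hgU : tsupport g ⊆ U) (hp : ContinuousOn p U)
    (hq : Continuous q) (hqg : tsupport q ⊆ tsupport g) :
    Integrable (fun w => q w * p w) := by
  have hqc : HasCompactSupport q := hgc.mono' ((subset_tsupport q).trans hqg)
  have hc : Continuous (fun w => q w * p w) := by
    refine continuous_of_tsupport fun w hw => ?_
    have hw' : w ∈ U := hgU (hqg (tsupport_mul_subset_left hw))
    exact hq.continuousAt.mul (hp.continuousAt (hU.mem_nhds hw'))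
  exact hc.integrable_of_hasCompactSupport hqc.mul_right

lemma continuousOn_fderiv_apply {U : Set ℂ} {f : ℂ → ℝ} (hU : IsOpen U)
    (hf : ContDiffOn ℝ 2 f U) (v : ℂ) : ContinuousOn (fun w => fderiv ℝ f w v) U := fun _ hw =>
  ((hf.contDiffAt (hU.mem_nhds hw)).differentiableAt_fderiv_two.continuousAt.clm_apply
    continuousAt_const).continuousWithinAt

lemma continuousOn_fderiv_fderiv_apply {U : Set ℂ} {f : ℂ → ℝ} (hU : IsOpen U)
    (hf : ContDiffOn ℝ 2 f U) (v : ℂ) :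
    ContinuousOn (fun w => fderiv ℝ (fderiv ℝ f) w v v) U := fun _ hw =>
  (((((hf.contDiffAt (hU.mem_nhds hw)).fderiv_right (m := 1) (by norm_num)).fderiv_right (m := 0)
    (by norm_num)).continuousAt.clm_apply continuousAt_const).clm_apply
    continuousAt_const).continuousWithinAt

lemma fderiv_fderiv_apply_const {f : ℂ → ℝ} {w : ℂ} (hf : ContDiffAt ℝ 2 f w) (v : ℂ) :
    fderiv ℝ (fun x => fderiv ℝ f x v) w v = fderiv ℝ (fderiv ℝ f) w v v := by
  rw [(hf.differentiableAt_fderiv_two.hasFDerivAt.clm_apply (hasFDerivAt_const v w)).fderiv]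
  simp

lemma tsupport_fderiv_fderiv_apply_subset (g : ℂ → ℝ) (v : ℂ) :
    tsupport (fun w => fderiv ℝ (fderiv ℝ g) w v v) ⊆ tsupport g := by
  have h : support (fun w => fderiv ℝ (fderiv ℝ g) w v v) ⊆ support (fderiv ℝ (fderiv ℝ g)) := by
    intro w hw h
    apply hw
    simp only [h]
    rfl
  exact (closure_mono h).trans
    ((tsupport_fderiv_subset ℝ (f := fderiv ℝ g)).trans (tsupport_fderiv_subset ℝ))

lemma integral_mul_fderiv_fderiv_apply_eq {U : Set ℂ} {f g : ℂ → ℝ} (hU : IsOpen U)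
    (hf : ContDiffOn ℝ 2 f U) (hg : ContDiff ℝ 2 g) (hgc : HasCompactSupport g)
    (hgU : tsupport g ⊆ U) (v : ℂ) :
    ∫ w, g w * fderiv ℝ (fderiv ℝ f) w v v = ∫ w, f w * fderiv ℝ (fderiv ℝ g) w v v := by
  have key := fun (p q : ℂ → ℝ) => integrable_mul_of_tsupport_subset (p := p) (q := q) hU hgc hgU
  have hfat : ∀ w ∈ U, ContDiffAt ℝ 2 f w := fun w hw => hf.contDiffAt (hU.mem_nhds hw)
  have hgat : ∀ w, ContDiffAt ℝ 2 g w := fun w => hg.contDiffAt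
  have hg1d : ContDiff ℝ 1 (fderiv ℝ g) := hg.fderiv_right (by norm_num)
  have hg1 : Continuous (fun w => fderiv ℝ g w v) := hg1d.continuous.clm_apply continuous_const
  have hg2 : Continuous (fun w => fderiv ℝ (fderiv ℝ g) w v v) :=
    ((hg1d.continuous_fderiv (by norm_num)).clm_apply continuous_const).clm_apply
      continuous_const
  have eqf : (fun w => g w * fderiv ℝ (fun x => fderiv ℝ f x v) w v) =
      fun w => g w * fderiv ℝ (fderiv ℝ f) w v v := by
    ext w
    by_cases hw : w ∈ tsupport g
    · rw [fderiv_fderiv_apply_const (hfat w (hgU hw))]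
    · rw [image_eq_zero_of_notMem_tsupport hw, zero_mul, zero_mul]
  have eqg : (fun w => fderiv ℝ (fun x => fderiv ℝ g x v) w v * f w) =
      fun w => fderiv ℝ (fderiv ℝ g) w v v * f w := by
    ext w
    rw [fderiv_fderiv_apply_const (hgat w)]
  have hi : Integrable (fun w => fderiv ℝ g w v * fderiv ℝ f w v) :=
    key _ _ (continuousOn_fderiv_apply hU hf v) hg1 (tsupport_fderiv_apply_subset ℝ v)
  have s1 : ∫ w, g w * fderiv ℝ (fun x => fderiv ℝ f x v) w v =
      -∫ w, fderiv ℝ g w v * fderiv ℝ f w v := by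
    refine integral_mul_fderiv_eq_neg_fderiv_mul_of_integrable (μ := (volume : Measure ℂ))
      hi ?_ ?_ ?_ ?_
    · rw [eqf]
      exact key _ _ (continuousOn_fderiv_fderiv_apply hU hf v) hg.continuous subset_rfl
    · exact key _ _ (continuousOn_fderiv_apply hU hf v) hg.continuous subset_rfl
    · exact fun w _ => (hgat w).differentiableAt (by norm_num)
    · exact fun w hw => (hfat w (hgU hw)).differentiableAt_fderiv_two.clm_apply
        (differentiableAt_const v)
  have s2 : ∫ w, fderiv ℝ g w v * fderiv ℝ f w v =
      -∫ w, fderiv ℝ (fun x => fderiv ℝ g x v) w v * f w := by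
    refine integral_mul_fderiv_eq_neg_fderiv_mul_of_integrable (μ := (volume : Measure ℂ))
      ?_ hi ?_ ?_ ?_
    · rw [eqg]
      exact key _ _ hf.continuousOn hg2 (tsupport_fderiv_fderiv_apply_subset g v)
    · exact key _ _ hf.continuousOn hg1 (tsupport_fderiv_apply_subset ℝ v)
    · exact fun w _ => (hgat w).differentiableAt_fderiv_two.clm_apply (differentiableAt_const v)
    · exact fun w hw => (hfat w (hgU (tsupport_fderiv_apply_subset ℝ v hw))).differentiableAt
        (by norm_num)
  rw [eqf] at s1
  rw [eqg] at s2
  rw [s1, s2, neg_neg]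
  exact integral_congr_ae (ae_of_all _ fun w => mul_comm _ _)

/-- Green's identity against a compactly supported function. -/
lemma integral_mul_laplacian_eq {U : Set ℂ} {f g : ℂ → ℝ} (hU : IsOpen U)
    (hf : ContDiffOn ℝ 2 f U) (hg : ContDiff ℝ 2 g) (hgc : HasCompactSupport g)
    (hgU : tsupport g ⊆ U) :
    ∫ w, g w * (Δ f) w = ∫ w, f w * (Δ g) w := by
  have hg1d : ContDiff ℝ 1 (fderiv ℝ g) := hg.fderiv_right (by norm_num)
  have i1 : ∀ v, Integrable (fun w => g w * fderiv ℝ (fderiv ℝ f) w v v) := fun v =>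
    integrable_mul_of_tsupport_subset hU hgc hgU (continuousOn_fderiv_fderiv_apply hU hf v)
      hg.continuous subset_rfl
  have i2 : ∀ v, Integrable (fun w => f w * fderiv ℝ (fderiv ℝ g) w v v) := fun v => by
    have hg2 : Continuous (fun w => fderiv ℝ (fderiv ℝ g) w v v) :=
      ((hg1d.continuous_fderiv (by norm_num)).clm_apply continuous_const).clm_apply
        continuous_const
    refine (integrable_mul_of_tsupport_subset hU hgc hgU hf.continuousOn hg2
      (tsupport_fderiv_fderiv_apply_subset g v)).congr (ae_of_all _ fun w => mul_comm _ _)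
  simp only [laplacian_complex_eq, mul_add]
  rw [integral_add (i1 1) (i1 Complex.I), integral_add (i2 1) (i2 Complex.I),
    integral_mul_fderiv_fderiv_apply_eq hU hf hg hgc hgU,
    integral_mul_fderiv_fderiv_apply_eq hU hf hg hgc hgU]

lemma continuousOn_laplacian {U : Set ℂ} {f : ℂ → ℝ} (hU : IsOpen U)
    (hf : ContDiffOn ℝ 2 f U) : ContinuousOn (Δ f) U := by
  refine ((continuousOn_fderiv_fderiv_apply hU hf 1).add
    (continuousOn_fderiv_fderiv_apply hU hf Complex.I)).congr fun w _ => ?_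
  exact laplacian_complex_eq f w

lemma tsupport_laplacian_subset (g : ℂ → ℝ) : tsupport (Δ g) ⊆ tsupport g := by
  refine closure_minimal (fun w hw => ?_) (isClosed_tsupport g)
  by_contra h
  apply hw
  rw [(laplacian_congr_nhds (notMem_tsupport_iff_eventuallyEq.1 h)).self_of_nhds]
  change (Δ fun _ : ℂ => (0 : ℝ)) w = 0
  simp [laplacian_complex_eq]

lemma contDiff_mul_of_tsupport_subset {U : Set ℂ} {η W : ℂ → ℝ} (hU : IsOpen U)
    (hη : ContDiff ℝ 2 η) (hηU : tsupport η ⊆ U) (hW : ContDiffOn ℝ 2 W U) :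
    ContDiff ℝ 2 (fun w => η w * W w) := by
  refine contDiff_iff_contDiffAt.2 fun w => ?_
  by_cases hw : w ∈ tsupport η
  · exact hη.contDiffAt.mul (hW.contDiffAt (hU.mem_nhds (hηU hw)))
  · have : (fun w => η w * W w) =ᶠ[𝓝 w] fun _ => 0 := by
      filter_upwards [notMem_tsupport_iff_eventuallyEq.1 hw] with x hx
      simp [hx]
    exact contDiffAt_const.congr_of_eventuallyEq this

lemma laplacian_const_sub (c : ℝ) (f : ℂ → ℝ) (w : ℂ) :
    Laplacian.laplacian (fun x : ℂ => c - f x : ℂ → ℝ) w = -Laplacian.laplacian f w := by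
  have h : fderiv ℝ (fun x => c - f x) = fun x => -fderiv ℝ f x := by
    ext1 x
    exact fderiv_const_sub c
  rw [laplacian_complex_eq, laplacian_complex_eq, h, fderiv_fun_neg]
  simp only [neg_apply]
  ring

/-- Bound for the Laplacian of `η (1 - |ψ|²)` divided by `|ψ'|`. -/
lemma laplacian_mul_one_sub_norm_sq_le {ψ : ℂ → ℂ} {w : ℂ} {η : ℂ → ℝ} {D : ℝ}
    (hψ : AnalyticAt ℂ ψ w) (hψ1 : ‖ψ w‖ < 1) (hd : 1 - ‖ψ w‖ ≤ ‖deriv ψ w‖ * D)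
    (hη : ContDiff ℝ 2 η) (hη0 : 0 ≤ η w) :
    Laplacian.laplacian (fun x : ℂ => η x * (1 - ‖ψ x‖ ^ 2) : ℂ → ℝ) w ≤
      ‖deriv ψ w‖ * (8 * ‖fderiv ℝ η w‖ + 4 * D * ‖fderiv ℝ (fderiv ℝ η) w‖) := by
  obtain ⟨hc, hL⟩ := laplacian_norm_sq hψ
  have hW : ContDiffAt ℝ 2 (fun x => 1 - ‖ψ x‖ ^ 2) w := contDiffAt_const.sub hc
  have hLW : Laplacian.laplacian (fun x : ℂ => 1 - ‖ψ x‖ ^ 2 : ℂ → ℝ) w =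
      -(4 * ‖deriv ψ w‖ ^ 2) := by
    rw [laplacian_const_sub, hL]
  have hDW : ‖fderiv ℝ (fun x => 1 - ‖ψ x‖ ^ 2) w‖ ≤ 2 * ‖deriv ψ w‖ := by
    rw [fderiv_const_sub, norm_neg]
    refine (norm_fderiv_norm_sq_le hψ.differentiableAt).trans ?_
    gcongr
    linarith
  rw [laplacian_mul_eq hη.contDiffAt hW, hLW]
  set p := ‖deriv ψ w‖
  have hp : 0 ≤ p := norm_nonneg _
  set A := fderiv ℝ η w
  set B := fderiv ℝ (fun x => 1 - ‖ψ x‖ ^ 2) w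
  have hAB : ∀ v : ℂ, ‖v‖ = 1 → A v * B v ≤ ‖A‖ * (2 * p) := by
    intro v hv
    have h1 := A.le_opNorm v
    have h2 := B.le_opNorm v
    rw [hv, mul_one, Real.norm_eq_abs] at h1 h2
    calc A v * B v ≤ |A v| * |B v| := by rw [← abs_mul]; exact le_abs_self _
      _ ≤ ‖A‖ * (2 * p) := by gcongr; exact h2.trans hDW
  have hA1 := hAB 1 (by simp)
  have hAI := hAB Complex.I (by simp)
  have hLη := (le_abs_self _).trans (abs_laplacian_le η w)
  have hn : 0 ≤ ‖ψ w‖ := norm_nonneg _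
  have hWle : 1 - ‖ψ w‖ ^ 2 ≤ 2 * (p * D) := by nlinarith
  have hW0 : 0 ≤ 1 - ‖ψ w‖ ^ 2 := by nlinarith
  have h3 : (1 - ‖ψ w‖ ^ 2) * (Δ η) w ≤ 2 * (p * D) * (2 * ‖fderiv ℝ (fderiv ℝ η) w‖) :=
    (mul_le_mul_of_nonneg_left hLη hW0).trans
      (mul_le_mul_of_nonneg_right hWle (by positivity))
  have h4 : η w * -(4 * p ^ 2) ≤ 0 := by nlinarith [mul_nonneg hη0 (sq_nonneg p)]
  nlinarith

/-- Weighted integral estimate for the Laplacian of a bounded subharmonic function. -/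
lemma integral_mul_laplacian_le {U : Set ℂ} {ψ : ℂ → ℂ} {η u D : ℂ → ℝ} (hU : IsOpen U)
    (hψ : DifferentiableOn ℂ ψ U) (hψ1 : ∀ w ∈ U, ‖ψ w‖ < 1) (hψ' : ∀ w ∈ U, deriv ψ w ≠ 0)
    (hD : Continuous D) (hD0 : ∀ w, 0 ≤ D w)
    (hd : ∀ w ∈ U, 1 - ‖ψ w‖ ≤ ‖deriv ψ w‖ * D w)
    (hη : ContDiff ℝ 2 η) (hηc : HasCompactSupport η) (hηU : tsupport η ⊆ U)
    (hη0 : ∀ w, 0 ≤ η w) (hu : ContDiffOn ℝ 2 u U) (hu1 : ∀ w ∈ U, -1 ≤ u w)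
    (hu0 : ∀ w ∈ U, u w ≤ 0) (huL : ∀ w ∈ U, 0 ≤ (Δ u) w) :
    ∫ w, η w * ((1 - ‖ψ w‖ ^ 2) / ‖deriv ψ w‖ * (Δ u) w) ≤
      3 * ∫ w, (8 * ‖fderiv ℝ η w‖ + 4 * D w * ‖fderiv ℝ (fderiv ℝ η) w‖) := by
  have hψa : ∀ w ∈ U, AnalyticAt ℂ ψ w := fun w hw => hψ.analyticAt (hU.mem_nhds hw)
  have hψ'a : ∀ w ∈ U, AnalyticAt ℂ (deriv ψ) w := fun w hw => (hψa w hw).deriv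
  have hWc : ContDiffOn ℝ 2 (fun w => 1 - ‖ψ w‖ ^ 2) U := fun w hw =>
    (contDiffAt_const.sub (laplacian_norm_sq (hψa w hw)).1).contDiffWithinAt
  set g : ℂ → ℝ := fun w => η w * (1 - ‖ψ w‖ ^ 2) with hg
  have hgs : ContDiff ℝ 2 g := contDiff_mul_of_tsupport_subset hU hη hηU hWc
  have hgη : tsupport g ⊆ tsupport η := tsupport_mul_subset_left
  have hgc : HasCompactSupport g := hηc.mul_right
  have hlog : ∀ w ∈ U, HarmonicAt (fun x => Real.log ‖deriv ψ x‖) w := fun w hw =>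
    (hψ'a w hw).harmonicAt_log_norm (hψ' w hw)
  set h : ℂ → ℝ := u - fun w => Real.log ‖deriv ψ w‖ with hh
  have hhc : ContDiffOn ℝ 2 h U := fun w hw =>
    ((hu.contDiffAt (hU.mem_nhds hw)).sub (hlog w hw).1).contDiffWithinAt
  have hhL : ∀ w ∈ U, (Δ h) w = (Δ u) w := fun w hw => by
    rw [hh, (hu.contDiffAt (hU.mem_nhds hw)).laplacian_sub (hlog w hw).1,
      (hlog w hw).2.self_of_nhds]
    simp
  have hp : ∀ w ∈ U, 0 < ‖deriv ψ w‖ := fun w hw => norm_pos_iff.2 (hψ' w hw)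
  have hexp : ∀ w ∈ U, Real.exp (h w) = Real.exp (u w) / ‖deriv ψ w‖ := fun w hw => by
    simp only [hh, Pi.sub_apply, Real.exp_sub, Real.exp_log (hp w hw)]
  have hW0 : ∀ w ∈ U, 0 ≤ 1 - ‖ψ w‖ ^ 2 := fun w hw => by
    nlinarith [hψ1 w hw, norm_nonneg (ψ w)]
  have hec : ContDiffOn ℝ 2 (fun w => Real.exp (h w)) U := hhc.exp
  have hLc := continuousOn_laplacian hU hec
  have hgLc : Continuous (Δ g) := by
    have := continuousOn_laplacian isOpen_univ hgs.contDiffOn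
    rwa [continuousOn_univ] at this
  have green := integral_mul_laplacian_eq hU hec hgs hgc (hgη.trans hηU)
  have hηz : ∀ w, w ∉ U → η w = 0 := fun w hw =>
    image_eq_zero_of_notMem_tsupport fun h => hw (hηU h)
  have lower : ∫ w, η w * ((1 - ‖ψ w‖ ^ 2) / ‖deriv ψ w‖ * (Δ u) w) ≤
      3 * ∫ w, g w * (Δ fun x => Real.exp (h x)) w := by
    rw [← integral_const_mul]
    refine integral_mono ?_ ?_ fun w => ?_
    · refine integrable_mul_of_tsupport_subset hU hηc hηU ?_ hη.continuous subset_rfl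
      refine (hWc.continuousOn.div ?_ fun w hw => (hp w hw).ne').mul (continuousOn_laplacian hU hu)
      exact fun w hw => (hψ'a w hw).continuousAt.norm.continuousWithinAt
    · exact (integrable_mul_of_tsupport_subset hU hηc hηU hLc hgs.continuous hgη).const_mul 3
    · simp only [hg]
      by_cases hw : w ∈ U
      · have h1 := laplacian_exp_ge (hhc.contDiffAt (hU.mem_nhds hw))
        rw [hhL w hw, hexp w hw] at h1
        have h2 : (1 : ℝ) ≤ 3 * Real.exp (u w) := by
          have h3 := Real.exp_le_exp.2 (hu1 w hw)
          have h4 : (1 : ℝ) ≤ 3 * Real.exp (-1) := by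
            have := Real.exp_one_lt_d9
            rw [Real.exp_neg, ← div_eq_mul_inv, le_div_iff₀ (Real.exp_pos 1)]
            linarith
          linarith
        have h5 : 0 ≤ η w * (1 - ‖ψ w‖ ^ 2) := mul_nonneg (hη0 w) (hW0 w hw)
        calc η w * ((1 - ‖ψ w‖ ^ 2) / ‖deriv ψ w‖ * (Δ u) w)
            = η w * (1 - ‖ψ w‖ ^ 2) * (1 * (1 / ‖deriv ψ w‖ * (Δ u) w)) := by ring
          _ ≤ η w * (1 - ‖ψ w‖ ^ 2) * (3 * Real.exp (u w) * (1 / ‖deriv ψ w‖ * (Δ u) w)) := by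
              have := mul_nonneg (one_div_nonneg.2 (hp w hw).le) (huL w hw)
              gcongr
          _ = 3 * (η w * (1 - ‖ψ w‖ ^ 2) * (Real.exp (u w) / ‖deriv ψ w‖ * (Δ u) w)) := by ring
          _ ≤ _ := by gcongr
      · simp [hηz w hw]
  have upper : ∫ w, Real.exp (h w) * (Δ g) w ≤
      ∫ w, (8 * ‖fderiv ℝ η w‖ + 4 * D w * ‖fderiv ℝ (fderiv ℝ η) w‖) := by
    have hη1 : ContDiff ℝ 1 (fderiv ℝ η) := hη.fderiv_right (by norm_num)
    refine integral_mono ?_ ?_ fun w => ?_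
    · refine (integrable_mul_of_tsupport_subset hU hηc hηU hec.continuousOn hgLc
        ((tsupport_laplacian_subset g).trans hgη)).congr (ae_of_all _ fun w => mul_comm _ _)
    · have c1 : Integrable (fun w => ‖fderiv ℝ η w‖) :=
        (hη1.continuous.integrable_of_hasCompactSupport (hηc.fderiv ℝ)).norm
      have c2 : Integrable (fun w => D w * ‖fderiv ℝ (fderiv ℝ η) w‖) :=
        (hD.mul (hη1.continuous_fderiv (by norm_num)).norm).integrable_of_hasCompactSupport
          ((hηc.fderiv ℝ).fderiv ℝ).norm.mul_left
      exact (c1.const_mul 8).add ((c2.const_mul 4).congr (ae_of_all _ fun w => by ring))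
    · by_cases hw : w ∈ U
      · have h1 := laplacian_mul_one_sub_norm_sq_le (hψa w hw) (hψ1 w hw) (hd w hw) hη (hη0 w)
        have hE : Real.exp (h w) ≤ 1 / ‖deriv ψ w‖ := by
          rw [hexp w hw]
          have := Real.exp_le_one_iff.2 (hu0 w hw)
          gcongr
        have hB : 0 ≤ 8 * ‖fderiv ℝ η w‖ + 4 * D w * ‖fderiv ℝ (fderiv ℝ η) w‖ := by
          have := hD0 w
          positivity
        calc Real.exp (h w) * (Δ g) w ≤ Real.exp (h w) * (‖deriv ψ w‖ *
              (8 * ‖fderiv ℝ η w‖ + 4 * D w * ‖fderiv ℝ (fderiv ℝ η) w‖)) := by gcongr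
          _ ≤ 1 / ‖deriv ψ w‖ * (‖deriv ψ w‖ *
              (8 * ‖fderiv ℝ η w‖ + 4 * D w * ‖fderiv ℝ (fderiv ℝ η) w‖)) := by gcongr
          _ = _ := by have := (hp w hw).ne'; field_simp
      · have : (Δ g) w = 0 := image_eq_zero_of_notMem_tsupport fun h =>
          hw (hηU (hgη (tsupport_laplacian_subset g h)))
        simp only [this, mul_zero]
        have := hD0 w
        positivity
  linarith

lemma norm_fderiv_mul_le {f g : ℂ → ℝ} {w : ℂ} (hf : ContDiffAt ℝ 2 f w)
    (hg : ContDiffAt ℝ 2 g w) :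
    ‖fderiv ℝ (fun x => f x * g x) w‖ ≤ |f w| * ‖fderiv ℝ g w‖ + |g w| * ‖fderiv ℝ f w‖ := by
  rw [fderiv_fun_mul (hf.differentiableAt (by norm_num)) (hg.differentiableAt (by norm_num))]
  refine (norm_add_le _ _).trans ?_
  rw [norm_smul, norm_smul, Real.norm_eq_abs, Real.norm_eq_abs]

lemma norm_fderiv_fderiv_mul_le {f g : ℂ → ℝ} {w : ℂ} (hf : ContDiffAt ℝ 2 f w)
    (hg : ContDiffAt ℝ 2 g w) :
    ‖fderiv ℝ (fderiv ℝ fun x => f x * g x) w‖ ≤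
      |f w| * ‖fderiv ℝ (fderiv ℝ g) w‖ + |g w| * ‖fderiv ℝ (fderiv ℝ f) w‖ +
        2 * ‖fderiv ℝ f w‖ * ‖fderiv ℝ g w‖ := by
  have h1 : fderiv ℝ (fun x => f x * g x) =ᶠ[𝓝 w]
      fun x => f x • fderiv ℝ g x + g x • fderiv ℝ f x := by
    filter_upwards [hf.eventually_differentiableAt_two, hg.eventually_differentiableAt_two]
      with x hfx hgx
    exact fderiv_fun_mul hfx hgx
  have hfd := (hf.differentiableAt (by norm_num)).hasFDerivAt
  have hgd := (hg.differentiableAt (by norm_num)).hasFDerivAt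
  have h2 := ((hfd.smul hg.differentiableAt_fderiv_two.hasFDerivAt).add
    (hgd.smul hf.differentiableAt_fderiv_two.hasFDerivAt)).congr_of_eventuallyEq h1
  rw [h2.fderiv]
  refine (norm_add_le _ _).trans ((add_le_add (norm_add_le _ _) (norm_add_le _ _)).trans ?_)
  rw [norm_smul, norm_smul, Real.norm_eq_abs, Real.norm_eq_abs,
    ContinuousLinearMap.norm_smulRight_apply, ContinuousLinearMap.norm_smulRight_apply]
  linarith

lemma fderiv_eq_zero_of_eventuallyEq_const {f : ℂ → ℝ} {c : ℝ} {w : ℂ}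
    (h : f =ᶠ[𝓝 w] fun _ => c) :
    fderiv ℝ f w = 0 ∧ fderiv ℝ (fderiv ℝ f) w = 0 := by
  have h1 : fderiv ℝ f =ᶠ[𝓝 w] fun _ => 0 := by
    filter_upwards [h.eventuallyEq_nhds] with x hx
    rw [hx.fderiv_eq]
    simp
  refine ⟨h1.self_of_nhds, ?_⟩
  rw [h1.fderiv_eq]
  simp

/-- A cutoff to a region away from an Ahlfors-regular boundary with controlled derivatives. -/
lemma exists_cutoff_integral_le {Ω : Set ℂ} {C s₀ c : ℝ} (hΩ : IsOpen Ω) (hne : Ω ≠ univ)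
    (hC : 0 < C) (hs₀ : 0 < s₀) (hc : 0 < c)
    (hlow : ∀ s, 0 < s → s ≤ s₀ → ∀ y ∈ frontier Ω,
      ENNReal.ofReal s ≤ μH[1] (frontier Ω ∩ ball y s))
    (hreg : ∀ z : ℂ, ∀ r, 0 < r → μH[1] (frontier Ω ∩ ball z r) ≤ ENNReal.ofReal (C * r)) :
    ∃ A, 0 < A ∧ ∀ z ∈ frontier Ω, ∀ r, 0 < r → ∀ ε, 0 < ε →
      ∃ η : ℂ → ℝ, ContDiff ℝ 2 η ∧ HasCompactSupport η ∧ tsupport η ⊆ Ω ∧ (∀ w, 0 ≤ η w) ∧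
        (∀ w, dist w z ≤ 2 * r → ε ≤ infDist w Ωᶜ → η w = 1) ∧
        ∫ w, (8 * ‖fderiv ℝ η w‖ + 4 * (c * infDist w Ωᶜ) * ‖fderiv ℝ (fderiv ℝ η) w‖) ≤
          A * r := by
  obtain ⟨K, hK, hcut⟩ := exists_cutoff
  have hπ := Real.pi_pos
  set A₁ : ℝ := 8 * K + 20 * c * K with hA₁
  set A₂ : ℝ := 8 * K + 12 * c * (K + 2 * K ^ 2) with hA₂
  have hA₁0 : 0 < A₁ := by positivity
  have hA₂0 : 0 < A₂ := by positivity
  refine ⟨A₁ * (25 * Real.pi) + A₂ * (480 * Real.pi * C), by positivity,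
    fun z hz r hr ε hε => ?_⟩
  have hcne : (Ωᶜ).Nonempty := nonempty_compl.2 hne
  have hzΩ : z ∈ Ωᶜ := by
    rw [frontier, hΩ.interior_eq] at hz
    exact hz.2
  set s := min s₀ (min r (ε / 3)) with hs
  have hs0 : 0 < s := by positivity
  have hss₀ : s ≤ s₀ := min_le_left _ _
  have hsr : s ≤ r := (min_le_right _ _).trans (min_le_left _ _)
  have hsε : 3 * s ≤ ε := by
    have : s ≤ ε / 3 := (min_le_right _ _).trans (min_le_right _ _)
    linarith
  obtain ⟨η₁, c1, p1, l1, z1, o1, d1, dd1⟩ := hcut Ωᶜ hcne s hs0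
  have hball : ((ball z (5 * r))ᶜ).Nonempty := ⟨z + (5 * r : ℝ), by simp [abs_of_pos hr]⟩
  obtain ⟨η₂, c2, p2, l2, z2, o2, d2, dd2⟩ := hcut (ball z (5 * r))ᶜ hball r hr
  have near0 : ∀ w, infDist w Ωᶜ < s → η₁ w = 0 := by
    intro w hw
    obtain ⟨y, hy, hyw⟩ := (infDist_lt_iff hcne).1 hw
    exact z1 w y hy hyw.le
  have far1 : ∀ w, 3 * s ≤ infDist w Ωᶜ → η₁ w = 1 := fun w hw =>
    o1 w fun y hy => hw.trans (infDist_le_dist_of_mem hy)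
  have out0 : ∀ w, 5 * r ≤ dist w z → η₂ w = 0 := fun w hw =>
    z2 w w (by simpa using hw) (by simpa using hr.le)
  have in1 : ∀ w, dist w z ≤ 2 * r → η₂ w = 1 := by
    refine fun w hw => o2 w fun y hy => ?_
    have h1 : 5 * r ≤ dist y z := by simpa using hy
    have h2 := dist_triangle y w z
    rw [dist_comm y w] at h2
    linarith
  set η : ℂ → ℝ := fun w => η₁ w * η₂ w with hη
  have hsupp : tsupport η ⊆ {w | s ≤ infDist w Ωᶜ} ∩ closedBall z (5 * r) := by
    refine closure_minimal (fun w hw => ?_)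
      ((isClosed_le continuous_const (continuous_infDist_pt _)).inter isClosed_closedBall)
    constructor
    · by_contra h
      exact hw (by simp [hη, near0 w (not_le.1 h)])
    · by_contra h
      exact hw (by simp [hη, out0 w (by simpa using (not_le.1 h).le)])
  have hcomp : HasCompactSupport η :=
    (isCompact_closedBall z (5 * r)).of_isClosed_subset (isClosed_tsupport η)
      (hsupp.trans inter_subset_right)
  have hsub : tsupport η ⊆ Ω := fun w hw => by
    by_contra h
    have := (hsupp hw).1
    rw [mem_ofPred_eq, infDist_zero_of_mem (show w ∈ Ωᶜ from h)] at this
    linarith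
  refine ⟨η, c1.mul c2, hcomp, hsub, fun w => mul_nonneg (p1 w) (p2 w), fun w hw hwε => ?_, ?_⟩
  · simp only [hη, far1 w (hsε.trans hwε), in1 w hw, mul_one]
  set N : Set ℂ := {w | w ∈ Ω ∩ ball z (6 * r) ∧ infDist w Ωᶜ ≤ 3 * s} with hN
  have hNm : MeasurableSet N := (hΩ.inter isOpen_ball).measurableSet.inter
    (isClosed_le (continuous_infDist_pt _) continuous_const).measurableSet
  have hNvol : volume N ≤ ENNReal.ofReal (80 * Real.pi * C * s * (6 * r)) :=
    volume_setOf_infDist_le hΩ hne hC hs0 (by linarith) (hlow s hs0 hss₀) (hreg z)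
  have hNfin : volume N ≠ ⊤ := ne_top_of_le_ne_top ENNReal.ofReal_ne_top hNvol
  have hBvol : volume (closedBall z (5 * r)) = ENNReal.ofReal (25 * Real.pi * r ^ 2) := by
    rw [Complex.volume_closedBall, ← ENNReal.ofReal_pow (by positivity),
      ← NNReal.coe_real_pi, ← ENNReal.ofReal_coe_nnreal, ← ENNReal.ofReal_mul (by positivity)]
    congr 1
    ring
  have hBfin : volume (closedBall z (5 * r)) ≠ ⊤ := by rw [hBvol]; exact ENNReal.ofReal_ne_top
  set G : ℂ → ℝ := fun w => (closedBall z (5 * r)).indicator (fun _ => A₁ / r) w +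
    N.indicator (fun _ => A₂ / s) w with hG
  have iB : Integrable ((closedBall z (5 * r)).indicator fun _ : ℂ => A₁ / r) :=
    (integrable_indicator_iff isClosed_closedBall.measurableSet).2
      (integrableOn_const hBfin)
  have iN : Integrable (N.indicator fun _ : ℂ => A₂ / s) :=
    (integrable_indicator_iff hNm).2 (integrableOn_const hNfin)
  have hpt : ∀ w, 8 * ‖fderiv ℝ η w‖ +
      4 * (c * infDist w Ωᶜ) * ‖fderiv ℝ (fderiv ℝ η) w‖ ≤ G w := by
    intro w
    by_cases hwB : w ∈ closedBall z (5 * r)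
    swap
    · have h0 : η =ᶠ[𝓝 w] fun _ => 0 := by
        filter_upwards [isClosed_closedBall.isOpen_compl.mem_nhds hwB] with x hx
        have : 5 * r < dist x z := by simpa using hx
        simp [hη, out0 x this.le]
      obtain ⟨e1, e2⟩ := fderiv_eq_zero_of_eventuallyEq_const h0
      have hn : 0 ≤ N.indicator (fun _ : ℂ => A₂ / s) w :=
        indicator_nonneg (fun _ _ => by positivity) w
      simp only [hG, e1, e2, indicator_of_notMem hwB]
      simpa using hn
    have hdw : infDist w Ωᶜ ≤ 5 * r := (infDist_le_dist_of_mem hzΩ).trans (mem_closedBall.1 hwB)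
    have hd0 : 0 ≤ infDist w Ωᶜ := infDist_nonneg
    have b1 := norm_fderiv_mul_le (c1.contDiffAt (x := w)) (c2.contDiffAt (x := w))
    have b2 := norm_fderiv_fderiv_mul_le (c1.contDiffAt (x := w)) (c2.contDiffAt (x := w))
    rw [abs_of_nonneg (p1 w), abs_of_nonneg (p2 w)] at b1 b2
    have t1 : η₁ w * ‖fderiv ℝ η₂ w‖ ≤ K / r :=
      (mul_le_of_le_one_left (norm_nonneg _) (l1 w)).trans (d2 w)
    have t2 : η₁ w * ‖fderiv ℝ (fderiv ℝ η₂) w‖ ≤ K / r ^ 2 :=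
      (mul_le_of_le_one_left (norm_nonneg _) (l1 w)).trans (dd2 w)
    have t3 : η₂ w * ‖fderiv ℝ η₁ w‖ ≤ ‖fderiv ℝ η₁ w‖ :=
      mul_le_of_le_one_left (norm_nonneg _) (l2 w)
    have t4 : η₂ w * ‖fderiv ℝ (fderiv ℝ η₁) w‖ ≤ ‖fderiv ℝ (fderiv ℝ η₁) w‖ :=
      mul_le_of_le_one_left (norm_nonneg _) (l2 w)
    have base : 8 * (K / r) + 4 * (c * (5 * r)) * (K / r ^ 2) = A₁ / r := by
      rw [hA₁]; field_simp; ring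
    by_cases hwN : w ∈ N
    · have hd3 : infDist w Ωᶜ ≤ 3 * s := hwN.2
      simp only [hG, indicator_of_mem hwB, indicator_of_mem hwN]
      have e1 : ‖fderiv ℝ η w‖ ≤ K / r + K / s := by
        have := d1 w
        linarith
      have e2 : ‖fderiv ℝ (fderiv ℝ η) w‖ ≤ K / r ^ 2 + (K + 2 * K ^ 2) / s ^ 2 := by
        have h1 := dd1 w
        have h2 : ‖fderiv ℝ η₁ w‖ * ‖fderiv ℝ η₂ w‖ ≤ K / s * (K / s) := by
          have : K / r ≤ K / s := by gcongr
          exact mul_le_mul (d1 w) ((d2 w).trans this) (norm_nonneg _) (by positivity)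
        have h3 : K / s * (K / s) = K ^ 2 / s ^ 2 := by field_simp
        have h4 : (K + 2 * K ^ 2) / s ^ 2 = K / s ^ 2 + 2 * (K ^ 2 / s ^ 2) := by ring
        rw [h4]
        linarith
      have e3 : infDist w Ωᶜ * ‖fderiv ℝ (fderiv ℝ η) w‖ ≤
          5 * r * (K / r ^ 2) + 3 * s * ((K + 2 * K ^ 2) / s ^ 2) := by
        calc _ ≤ infDist w Ωᶜ * (K / r ^ 2 + (K + 2 * K ^ 2) / s ^ 2) := by gcongr
          _ = infDist w Ωᶜ * (K / r ^ 2) + infDist w Ωᶜ * ((K + 2 * K ^ 2) / s ^ 2) := by ring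
          _ ≤ _ := by gcongr
      have e4 : 8 * (K / s) + 4 * c * (3 * s * ((K + 2 * K ^ 2) / s ^ 2)) = A₂ / s := by
        rw [hA₂]; field_simp; ring
      have e5 := mul_le_mul_of_nonneg_left e3 (show 0 ≤ 4 * c by positivity)
      rw [← e4, ← base]
      linarith
    · have hconst : ∃ a, η₁ =ᶠ[𝓝 w] fun _ => a := by
        by_cases hwΩ : w ∈ Ω
        · refine ⟨1, ?_⟩
          have hwb : w ∈ ball z (6 * r) := by
            have := mem_closedBall.1 hwB
            rw [mem_ball]; linarith
          have h3 : 3 * s < infDist w Ωᶜ := by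
            by_contra h
            exact hwN ⟨⟨hwΩ, hwb⟩, not_lt.1 h⟩
          filter_upwards [(isOpen_lt continuous_const (continuous_infDist_pt Ωᶜ)).mem_nhds h3]
            with x hx
          exact far1 x (le_of_lt hx)
        · refine ⟨0, ?_⟩
          have h3 : infDist w Ωᶜ < s := by
            rwa [infDist_zero_of_mem (show w ∈ Ωᶜ from hwΩ)]
          filter_upwards [(isOpen_lt (continuous_infDist_pt Ωᶜ) continuous_const).mem_nhds h3]
            with x hx
          exact near0 x hx
      obtain ⟨a, ha⟩ := hconst
      obtain ⟨f1, f2⟩ := fderiv_eq_zero_of_eventuallyEq_const ha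
      rw [f1, norm_zero] at b1 b2
      rw [f2, norm_zero] at b2
      simp only [hG, indicator_of_mem hwB, indicator_of_notMem hwN, add_zero]
      have e1 : ‖fderiv ℝ η w‖ ≤ K / r := by linarith
      have e2 : ‖fderiv ℝ (fderiv ℝ η) w‖ ≤ K / r ^ 2 := by linarith
      rw [← base]
      gcongr
  calc _ ≤ ∫ w, G w := by
        refine integral_mono_of_nonneg (ae_of_all _ fun w => ?_) (iB.add iN) (ae_of_all _ hpt)
        have : 0 ≤ infDist w Ωᶜ := infDist_nonneg
        positivity
    _ = volume.real (closedBall z (5 * r)) * (A₁ / r) + volume.real N * (A₂ / s) := by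
        rw [hG, integral_add iB iN, integral_indicator_const _ isClosed_closedBall.measurableSet,
          integral_indicator_const _ hNm, smul_eq_mul, smul_eq_mul]
    _ ≤ (25 * Real.pi * r ^ 2) * (A₁ / r) + (80 * Real.pi * C * s * (6 * r)) * (A₂ / s) := by
        gcongr
        · rw [Measure.real, hBvol, ENNReal.toReal_ofReal (by positivity)]
        · exact ENNReal.toReal_le_of_le_ofReal (by positivity) hNvol
    _ = _ := by field_simp; ring

lemma norm_conj_mul_lt_one {w ξ : ℂ} (hw : ‖w‖ < 1) (hξ : ‖ξ‖ < 1) : ‖conj w * ξ‖ < 1 := by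
  rw [norm_mul, RCLike.norm_conj]
  nlinarith [norm_nonneg w, norm_nonneg ξ]

lemma one_sub_conj_mul_ne_zero {w ξ : ℂ} (hw : ‖w‖ < 1) (hξ : ‖ξ‖ < 1) : 1 - conj w * ξ ≠ 0 := by
  intro h
  have h1 := norm_conj_mul_lt_one hw hξ
  rw [← sub_eq_zero.1 h] at h1
  simp at h1

lemma norm_sub_le_norm_one_sub_conj_mul {w ξ : ℂ} (hw : ‖w‖ < 1) (hξ : ‖ξ‖ < 1) :
    ‖ξ - w‖ ≤ ‖1 - conj w * ξ‖ := by
  have h : ‖1 - conj w * ξ‖ ^ 2 - ‖ξ - w‖ ^ 2 = (1 - ‖w‖ ^ 2) * (1 - ‖ξ‖ ^ 2) := by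
    simp only [Complex.sq_norm, Complex.normSq_apply]
    simp
    ring
  have h1 : 0 ≤ (1 - ‖w‖ ^ 2) * (1 - ‖ξ‖ ^ 2) :=
    mul_nonneg (by nlinarith [norm_nonneg w]) (by nlinarith [norm_nonneg ξ])
  exact le_of_sq_le_sq (by linarith) (norm_nonneg _)

lemma norm_one_sub_conj_mul_le {w ξ : ℂ} (hw : ‖w‖ < 1) :
    ‖1 - conj w * ξ‖ ≤ 1 - ‖w‖ ^ 2 + ‖ξ - w‖ := by
  have e : 1 - conj w * ξ = ((1 - ‖w‖ ^ 2 : ℝ) : ℂ) - conj w * (ξ - w) := by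
    have : conj w * w = ((‖w‖ ^ 2 : ℝ) : ℂ) := by
      rw [Complex.conj_mul']; push_cast; rfl
    rw [mul_sub, this]; push_cast; ring
  rw [e]
  refine (norm_sub_le _ _).trans ?_
  rw [Complex.norm_real, norm_mul, RCLike.norm_conj, Real.norm_of_nonneg
    (by nlinarith [norm_nonneg w])]
  nlinarith [norm_nonneg (ξ - w)]

/-- Schwarz–Pick: a holomorphic self-map bound on a small disc. -/
lemma norm_sub_le_of_schwarz {ψ : ℂ → ℂ} {b x : ℂ} {d : ℝ}
    (hψ : DifferentiableOn ℂ ψ (ball b d)) (hm : ∀ w ∈ ball b d, ‖ψ w‖ < 1)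
    (hx : x ∈ ball b (d / 5)) :
    ‖ψ x - ψ b‖ ≤ (1 - ‖ψ b‖) / 2 := by
  have hd : 0 < d := by
    have := nonempty_ball.1 ⟨x, hx⟩
    linarith
  have hb : b ∈ ball b d := mem_ball_self hd
  have hxd : x ∈ ball b d := ball_subset_ball (by linarith) hx
  set p := ψ b with hp
  have hp1 := hm b hb
  have hx1 := hm x hxd
  set T : ℂ → ℂ := fun w => (ψ w - p) / (1 - conj p * ψ w) with hT
  have hTd : DifferentiableOn ℂ T (ball b d) :=
    (hψ.sub_const p).div ((hψ.const_mul _).const_sub 1)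
      fun w hw => one_sub_conj_mul_ne_zero hp1 (hm w hw)
  have hTb : T b = 0 := by simp [hT, hp]
  have hmaps : MapsTo T (ball b d) (closedBall (T b) 1) := by
    intro w hw
    rw [hTb, mem_closedBall_zero_iff, hT, norm_div]
    exact div_le_one_of_le₀ (norm_sub_le_norm_one_sub_conj_mul hp1 (hm w hw)) (norm_nonneg _)
  have h1 := Complex.dist_le_div_mul_dist_of_mapsTo_ball hTd hmaps hxd
  have h2 : ‖T x‖ ≤ 1 / 5 := by
    rw [hTb, dist_zero_right] at h1
    refine h1.trans ?_
    have := mem_ball.1 hx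
    rw [div_mul_eq_mul_div, one_mul, div_le_iff₀ hd]
    linarith
  have hne := one_sub_conj_mul_ne_zero hp1 hx1
  have h3 : ‖ψ x - p‖ = ‖T x‖ * ‖1 - conj p * ψ x‖ := by
    rw [← norm_mul, hT, div_mul_cancel₀ _ hne]
  have h4 := norm_one_sub_conj_mul_le (ξ := ψ x) hp1
  have h5 := mul_le_mul_of_nonneg_right h2 (norm_nonneg (1 - conj p * ψ x))
  nlinarith [norm_nonneg p]

/-- The Poisson-type kernel `(1 - |ξ|²) / |1 - w̄ ξ|²`. -/
noncomputable def diskKernel (w ξ : ℂ) : ℝ := (1 - ‖ξ‖ ^ 2) / ‖1 - conj w * ξ‖ ^ 2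

lemma laplacian_neg_diskKernel {ψ : ℂ → ℂ} {w x : ℂ} (hw : ‖w‖ < 1) (hψ : AnalyticAt ℂ ψ x)
    (hx : ‖ψ x‖ < 1) :
    ContDiffAt ℝ 2 (fun y => -diskKernel w (ψ y)) x ∧
      Laplacian.laplacian (fun y => -diskKernel w (ψ y) : ℂ → ℝ) x =
        4 * ‖deriv ψ x‖ ^ 2 * (1 - ‖w‖ ^ 2) / ‖1 - conj w * ψ x‖ ^ 4 := by
  have hne := one_sub_conj_mul_ne_zero hw hx
  have hden : AnalyticAt ℂ (fun y => 1 - conj w * ψ y) x :=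
    analyticAt_const.sub (analyticAt_const.mul hψ)
  have hF : AnalyticAt ℂ (fun y => ψ y / (1 - conj w * ψ y)) x := hψ.div hden hne
  have hG : AnalyticAt ℂ (fun y => 1 / (1 - conj w * ψ y)) x := analyticAt_const.div hden hne
  have hψd := hψ.differentiableAt.hasDerivAt
  have hdd := (hψd.const_mul (conj w)).const_sub 1
  have hF' : deriv (fun y => ψ y / (1 - conj w * ψ y)) x =
      deriv ψ x / (1 - conj w * ψ x) ^ 2 := by
    rw [(hψd.fun_div hdd hne).deriv]
    ring
  have hG' : deriv (fun y => 1 / (1 - conj w * ψ y)) x =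
      conj w * deriv ψ x / (1 - conj w * ψ x) ^ 2 := by
    rw [((hasDerivAt_const x (1 : ℂ)).fun_div hdd hne).deriv]
    ring
  obtain ⟨cF, LF⟩ := laplacian_norm_sq hF
  obtain ⟨cG, LG⟩ := laplacian_norm_sq hG
  have e : (fun y => -diskKernel w (ψ y)) =
      (fun y => ‖ψ y / (1 - conj w * ψ y)‖ ^ 2) - fun y => ‖1 / (1 - conj w * ψ y)‖ ^ 2 := by
    ext y
    simp only [diskKernel, Pi.sub_apply, norm_div, div_pow, norm_one]
    ring
  rw [e]
  refine ⟨cF.sub cG, ?_⟩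
  rw [cF.laplacian_sub cG, LF, LG, hF', hG']
  simp only [norm_div, norm_mul, norm_pow, RCLike.norm_conj]
  ring

lemma laplacian_sum {ι : Type*} (J : Finset ι) (m : ι → ℝ) {f : ι → ℂ → ℝ} {x : ℂ}
    (hf : ∀ i ∈ J, ContDiffAt ℝ 2 (f i) x) :
    Laplacian.laplacian (fun y => ∑ i ∈ J, m i * f i y : ℂ → ℝ) x =
      ∑ i ∈ J, m i * Laplacian.laplacian (f i) x := by
  classical
  induction J using Finset.induction_on with
  | empty => simp
  | insert a J ha ih =>
    have hfa := hf a (Finset.mem_insert_self a J)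
    have hfJ : ∀ i ∈ J, ContDiffAt ℝ 2 (f i) x := fun i hi => hf i (Finset.mem_insert_of_mem hi)
    have c1 : ContDiffAt ℝ 2 (m a • f a) x := hfa.const_smul (m a)
    have c2 : ContDiffAt ℝ 2 (fun y => ∑ i ∈ J, m i * f i y) x :=
      ContDiffAt.sum fun i hi => contDiffAt_const.mul (hfJ i hi)
    have e : (fun y => ∑ i ∈ insert a J, m i * f i y) =
        (m a • f a) + fun y => ∑ i ∈ J, m i * f i y := by
      ext y
      simp [Finset.sum_insert ha]
    rw [e, c1.laplacian_add c2, ih hfJ, laplacian_smul _ hfa, Finset.sum_insert ha, smul_eq_mul]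

lemma ball_infDist_compl_subset {Ω : Set ℂ} (b : ℂ) : ball b (infDist b Ωᶜ) ⊆ Ω := by
  intro x hx
  by_contra h
  have h1 := infDist_le_dist_of_mem (x := b) (show x ∈ Ωᶜ from h)
  rw [mem_ball, dist_comm] at hx
  linarith

/-- Lower bound for the weighted Laplacian of the kernel near its base point. -/
lemma weighted_kernel_ge {Ω : Set ℂ} {ψ : ℂ → ℂ} {b x : ℂ} {c : ℝ}
    (hc : 0 < c) (hψ : DifferentiableOn ℂ ψ Ω) (hψ1 : ∀ w ∈ Ω, ‖ψ w‖ < 1)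
    (hψ' : ∀ w ∈ Ω, deriv ψ w ≠ 0)
    (hd : ∀ w ∈ Ω, 1 - ‖ψ w‖ ≤ ‖deriv ψ w‖ * (c * infDist w Ωᶜ)) (hb : b ∈ Ω)
    (hx : x ∈ ball b (infDist b Ωᶜ / 5)) :
    1 / (50 * c * infDist b Ωᶜ * (1 - ‖ψ b‖)) ≤
      (1 - ‖ψ x‖ ^ 2) / ‖deriv ψ x‖ *
        (4 * ‖deriv ψ x‖ ^ 2 * (1 - ‖ψ b‖ ^ 2) / ‖1 - conj (ψ b) * ψ x‖ ^ 4) := by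
  set d := infDist b Ωᶜ with hd'
  have hd0 : 0 < d := by
    have := nonempty_ball.1 ⟨x, hx⟩
    linarith
  have hsub : ball b d ⊆ Ω := ball_infDist_compl_subset b
  have hxΩ : x ∈ Ω := hsub (ball_subset_ball (by linarith) hx)
  have hsch := norm_sub_le_of_schwarz (hψ.mono hsub) (fun w hw => hψ1 w (hsub hw)) hx
  set a := 1 - ‖ψ b‖ with ha
  have ha0 : 0 < a := by linarith [hψ1 b hb]
  have ha1 : a ≤ 1 := by linarith [norm_nonneg (ψ b)]
  have hx1 := hψ1 x hxΩ
  have h1 : a / 2 ≤ 1 - ‖ψ x‖ := by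
    have := norm_sub_norm_le (ψ x) (ψ b)
    linarith
  have hW : a / 2 ≤ 1 - ‖ψ x‖ ^ 2 := by nlinarith [norm_nonneg (ψ x)]
  have hp : 0 < ‖deriv ψ x‖ := norm_pos_iff.2 (hψ' x hxΩ)
  have hdx : infDist x Ωᶜ ≤ 6 / 5 * d := by
    have h2 := infDist_le_infDist_add_dist (s := Ωᶜ) (x := x) (y := b)
    have := mem_ball.1 hx
    linarith
  have hpl : a / 2 ≤ ‖deriv ψ x‖ * (c * (6 / 5 * d)) := by
    refine (h1.trans (hd x hxΩ)).trans ?_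
    gcongr
  have hk0 : 0 < ‖1 - conj (ψ b) * ψ x‖ :=
    norm_pos_iff.2 (one_sub_conj_mul_ne_zero (hψ1 b hb) hx1)
  have hb2 : 1 - ‖ψ b‖ ^ 2 = a * (2 - a) := by rw [ha]; ring
  have hk : ‖1 - conj (ψ b) * ψ x‖ ≤ 5 / 2 * a := by
    have := norm_one_sub_conj_mul_le (ξ := ψ x) (hψ1 b hb)
    rw [hb2] at this
    nlinarith
  have hk4 : ‖1 - conj (ψ b) * ψ x‖ ^ 4 ≤ (5 / 2 * a) ^ 4 := by gcongr
  set p := ‖deriv ψ x‖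
  set k := ‖1 - conj (ψ b) * ψ x‖
  have e : (1 - ‖ψ x‖ ^ 2) / p * (4 * p ^ 2 * (1 - ‖ψ b‖ ^ 2) / k ^ 4) =
      4 * (1 - ‖ψ x‖ ^ 2) * p * (1 - ‖ψ b‖ ^ 2) / k ^ 4 := by
    field_simp
  have hpl' : a / (12 / 5 * c * d) ≤ p := by
    rw [div_le_iff₀ (by positivity)]
    linarith
  have hb2' : a ≤ 1 - ‖ψ b‖ ^ 2 := by rw [hb2]; nlinarith
  have hW0 : 0 ≤ 1 - ‖ψ x‖ ^ 2 := by linarith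
  have hb0 : 0 ≤ 1 - ‖ψ b‖ ^ 2 := by linarith
  rw [e]
  calc 1 / (50 * c * d * a) ≤ 4 * (a / 2) * (a / (12 / 5 * c * d)) * a / (5 / 2 * a) ^ 4 := by
        have : 4 * (a / 2) * (a / (12 / 5 * c * d)) * a / (5 / 2 * a) ^ 4 =
          (32 / 1500 : ℝ) * (1 / (c * d * a)) := by field_simp; ring
        rw [this]
        have h3 : 1 / (50 * c * d * a) = (1 / 50 : ℝ) * (1 / (c * d * a)) := by field_simp
        rw [h3]
        exact mul_le_mul_of_nonneg_right (by norm_num) (by positivity)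
    _ ≤ _ := by gcongr

/-- The key estimate for finite sums of point masses. -/
lemma sum_mul_infDist_div_le {Ω : Set ℂ} {ψ : ℂ → ℂ} {C s₀ c : ℝ} (hΩ : IsOpen Ω)
    (hne : Ω ≠ univ) (hC : 0 < C) (hs₀ : 0 < s₀) (hc : 0 < c)
    (hlow : ∀ s, 0 < s → s ≤ s₀ → ∀ y ∈ frontier Ω,
      ENNReal.ofReal s ≤ μH[1] (frontier Ω ∩ ball y s))
    (hreg : ∀ z : ℂ, ∀ r, 0 < r → μH[1] (frontier Ω ∩ ball z r) ≤ ENNReal.ofReal (C * r))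
    (hψ : DifferentiableOn ℂ ψ Ω) (hψ1 : ∀ w ∈ Ω, ‖ψ w‖ < 1) (hψ' : ∀ w ∈ Ω, deriv ψ w ≠ 0)
    (hd : ∀ w ∈ Ω, 1 - ‖ψ w‖ ≤ ‖deriv ψ w‖ * (c * infDist w Ωᶜ)) :
    ∃ B, 0 < B ∧ ∀ z ∈ frontier Ω, ∀ r, 0 < r → ∀ (J : Finset ℂ) (m : ℂ → ℝ),
      (∀ b ∈ J, b ∈ Ω ∧ dist b z < r ∧ 0 ≤ m b) →
      (∀ ξ : ℂ, ‖ξ‖ < 1 → ∑ b ∈ J, m b * diskKernel (ψ b) ξ ≤ 1) →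
      ∑ b ∈ J, m b * (infDist b Ωᶜ / (1 - ‖ψ b‖)) ≤ B * r := by
  obtain ⟨A, hA, hcut⟩ := exists_cutoff_integral_le hΩ hne hC hs₀ hc hlow hreg
  have hcne : (Ωᶜ).Nonempty := nonempty_compl.2 hne
  refine ⟨1500 * c * A, by positivity, fun z hz r hr J m hJ hK => ?_⟩
  have hzΩ : z ∈ Ωᶜ := by
    rw [frontier, hΩ.interior_eq] at hz
    exact hz.2
  have hdpos : ∀ b ∈ Ω, 0 < infDist b Ωᶜ := fun b hb =>
    (hΩ.isClosed_compl.notMem_iff_infDist_pos hcne).1 (by simpa using hb)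
  obtain ⟨ε, hε, hεJ⟩ : ∃ ε, 0 < ε ∧ ∀ b ∈ J, ε ≤ infDist b Ωᶜ / 5 := by
    rcases J.eq_empty_or_nonempty with rfl | hJn
    · exact ⟨1, one_pos, by simp⟩
    · obtain ⟨b₀, hb₀, hmin⟩ := J.exists_min_image (fun b => infDist b Ωᶜ) hJn
      exact ⟨infDist b₀ Ωᶜ / 5, by linarith [hdpos b₀ (hJ b₀ hb₀).1], fun b hb => by
        linarith [hmin b hb]⟩
  obtain ⟨η, hη, hηc, hηΩ, hη0, hη1, hηint⟩ := hcut z hz r hr ε hε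
  have hψa : ∀ w ∈ Ω, AnalyticAt ℂ ψ w := fun w hw => hψ.analyticAt (hΩ.mem_nhds hw)
  have hker : ∀ b ∈ J, ∀ x ∈ Ω, _ := fun b hb x hx =>
    laplacian_neg_diskKernel (hψ1 b (hJ b hb).1) (hψa x hx) (hψ1 x hx)
  have hker0 : ∀ b x, ‖ψ x‖ < 1 → 0 ≤ diskKernel (ψ b) (ψ x) := fun b x hx => by
    have : 0 ≤ 1 - ‖ψ x‖ ^ 2 := by nlinarith [norm_nonneg (ψ x)]
    unfold diskKernel
    positivity
  set u : ℂ → ℝ := fun y => ∑ b ∈ J, m b * -diskKernel (ψ b) (ψ y) with hu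
  set L : ℂ → ℂ → ℝ := fun b x =>
    4 * ‖deriv ψ x‖ ^ 2 * (1 - ‖ψ b‖ ^ 2) / ‖1 - conj (ψ b) * ψ x‖ ^ 4 with hL
  have hL0 : ∀ b ∈ J, ∀ x, 0 ≤ L b x := fun b hb x => by
    have : 0 ≤ 1 - ‖ψ b‖ ^ 2 := by nlinarith [norm_nonneg (ψ b), hψ1 b (hJ b hb).1]
    simp only [hL]
    positivity
  have huΔ : ∀ x ∈ Ω, Laplacian.laplacian u x = ∑ b ∈ J, m b * L b x := fun x hx => by
    rw [hu, laplacian_sum J m fun b hb => (hker b hb x hx).1]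
    exact Finset.sum_congr rfl fun b hb => by rw [(hker b hb x hx).2]
  have hue : ∀ x, u x = -∑ b ∈ J, m b * diskKernel (ψ b) (ψ x) := fun x => by
    simp [hu]
  have main := integral_mul_laplacian_le (D := fun w => c * infDist w Ωᶜ) (u := u) hΩ hψ hψ1 hψ'
    (continuous_const.mul (continuous_infDist_pt _)) (fun w => mul_nonneg hc.le infDist_nonneg)
    hd hη hηc hηΩ hη0
    (fun x hx => (ContDiffAt.sum fun b hb =>
      contDiffAt_const.mul (hker b hb x hx).1).contDiffWithinAt)
    (fun x hx => by rw [hue]; linarith [hK (ψ x) (hψ1 x hx)])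
    (fun x hx => by
      rw [hue, neg_nonpos]
      exact Finset.sum_nonneg fun b hb => mul_nonneg (hJ b hb).2.2 (hker0 b x (hψ1 x hx)))
    (fun x hx => by
      rw [huΔ x hx]
      exact Finset.sum_nonneg fun b hb => mul_nonneg (hJ b hb).2.2 (hL0 b hb x))
  have hηz : ∀ w, w ∉ Ω → η w = 0 := fun w hw =>
    image_eq_zero_of_notMem_tsupport fun h => hw (hηΩ h)
  set P : ℂ → ℂ → ℝ := fun b x => (1 - ‖ψ x‖ ^ 2) / ‖deriv ψ x‖ * L b x with hP
  have hLHS : ∫ w, η w * ((1 - ‖ψ w‖ ^ 2) / ‖deriv ψ w‖ * Laplacian.laplacian u w) =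
      ∫ w, ∑ b ∈ J, m b * (η w * P b w) := by
    refine integral_congr_ae (ae_of_all _ fun w => ?_)
    by_cases hw : w ∈ Ω
    · simp only [huΔ w hw, hP, Finset.mul_sum]
      exact Finset.sum_congr rfl fun b _ => by ring
    · simp [hηz w hw]
  have hψc : ContinuousOn ψ Ω := hψ.continuousOn
  have hψ'c : ContinuousOn (deriv ψ) Ω := (hψ.deriv hΩ).continuousOn
  have hintegr : ∀ b ∈ J, Integrable fun w => η w * P b w := by
    intro b hb
    refine integrable_mul_of_tsupport_subset hΩ hηc hηΩ ?_ hη.continuous subset_rfl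
    refine ((continuousOn_const.sub (hψc.norm.pow 2)).div hψ'c.norm
      fun w hw => norm_ne_zero_iff.2 (hψ' w hw)).mul ?_
    refine ((continuousOn_const.mul (hψ'c.norm.pow 2)).mul continuousOn_const).div
      ((continuousOn_const.sub (continuousOn_const.mul hψc)).norm.pow 4) fun w hw => ?_
    exact pow_ne_zero _
      (norm_ne_zero_iff.2 (one_sub_conj_mul_ne_zero (hψ1 b (hJ b hb).1) (hψ1 w hw)))
  have hP0 : ∀ b ∈ J, ∀ w, 0 ≤ η w * P b w := by
    intro b hb w
    by_cases hw : w ∈ Ω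
    · have : 0 ≤ 1 - ‖ψ w‖ ^ 2 := by nlinarith [norm_nonneg (ψ w), hψ1 w hw]
      exact mul_nonneg (hη0 w) (mul_nonneg (div_nonneg this (norm_nonneg _)) (hL0 b hb w))
    · simp [hηz w hw]
  have hone : ∀ b ∈ J, infDist b Ωᶜ / (1 - ‖ψ b‖) ≤ 500 * c * ∫ w, η w * P b w := by
    intro b hb
    obtain ⟨hbΩ, hbz, -⟩ := hJ b hb
    have hdb := hdpos b hbΩ
    have ha0 : 0 < 1 - ‖ψ b‖ := by linarith [hψ1 b hbΩ]
    set d := infDist b Ωᶜ with hd'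
    have hdr : d < r := (infDist_le_dist_of_mem hzΩ).trans_lt hbz
    set q := 1 / (50 * c * d * (1 - ‖ψ b‖)) with hq
    have hvol : volume.real (ball b (d / 5)) = Real.pi * d ^ 2 / 25 := by
      rw [Measure.real, Complex.volume_ball, ENNReal.toReal_mul, ENNReal.toReal_pow,
        ENNReal.toReal_ofReal (by positivity)]
      simp
      ring
    have hle : ∫ w, (ball b (d / 5)).indicator (fun _ => q) w ≤ ∫ w, η w * P b w := by
      refine integral_mono ((integrable_indicator_iff measurableSet_ball).2
        (integrableOn_const measure_ball_lt_top.ne)) (hintegr b hb) fun w => ?_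
      by_cases hw : w ∈ ball b (d / 5)
      · have hwd := mem_ball.1 hw
        have e1 : η w = 1 := by
          refine hη1 w ?_ ?_
          · have := dist_triangle w b z
            linarith
          · have h2 := infDist_le_infDist_add_dist (s := Ωᶜ) (x := b) (y := w)
            rw [dist_comm] at h2
            have := hεJ b hb
            linarith
        simp only [indicator_of_mem hw, e1, one_mul]
        exact weighted_kernel_ge hc hψ hψ1 hψ' hd hbΩ hw
      · simp only [indicator_of_notMem hw]
        exact hP0 b hb w
    rw [integral_indicator_const _ measurableSet_ball, hvol, smul_eq_mul] at hle
    calc d / (1 - ‖ψ b‖) = 500 * c * (2.5 * d ^ 2 / 25 * q) := by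
          rw [hq]; field_simp; norm_num
      _ ≤ 500 * c * (Real.pi * d ^ 2 / 25 * q) := by
          have := Real.pi_gt_three
          gcongr
          linarith
      _ ≤ _ := by gcongr
  calc ∑ b ∈ J, m b * (infDist b Ωᶜ / (1 - ‖ψ b‖))
      ≤ ∑ b ∈ J, m b * (500 * c * ∫ w, η w * P b w) :=
        Finset.sum_le_sum fun b hb => mul_le_mul_of_nonneg_left (hone b hb) (hJ b hb).2.2
    _ = 500 * c * ∫ w, ∑ b ∈ J, m b * (η w * P b w) := by
        rw [integral_finsetSum _ fun b hb => (hintegr b hb).const_mul _, Finset.mul_sum]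
        refine Finset.sum_congr rfl fun b _ => ?_
        rw [integral_const_mul]
        ring
    _ ≤ 500 * c * (3 * (A * r)) := by
        rw [← hLHS]
        have := main.trans (mul_le_mul_of_nonneg_left hηint (by norm_num))
        gcongr
    _ = 1500 * c * A * r := by ring

/-- If `ν` gives mass at most `N r` to discs of radius `r` centred on the unit circle, then the
integrals of the kernels `diskKernel · ξ` against `ν` are bounded by a multiple of `N`. -/
lemma lintegral_diskKernel_le {ν : Measure ℂ} {N : ℝ} (hN : 0 ≤ N)
    (hν : ∀ x : ℂ, ‖x‖ = 1 → ∀ r, 0 < r → ν (ball 0 1 ∩ ball x r) ≤ ENNReal.ofReal (N * r))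
    {ξ : ℂ} (hξ : ‖ξ‖ < 1) :
    ∫⁻ w in ball 0 1, ENNReal.ofReal (diskKernel w ξ) ∂ν ≤ ENNReal.ofReal (32 * N) := by
  obtain ⟨e, he, hξe⟩ : ∃ e : ℂ, ‖e‖ = 1 ∧ ξ = ‖ξ‖ * e := by
    rcases eq_or_ne ξ 0 with rfl | h
    · exact ⟨1, by simp, by simp⟩
    · refine ⟨ξ / ‖ξ‖, by simp [h], ?_⟩
      field_simp [Complex.ofReal_ne_zero.2 (norm_ne_zero_iff.2 h)]
  set t := 1 - ‖ξ‖ with ht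
  have ht0 : 0 < t := by linarith
  set F : ℕ → ℂ → ℝ≥0∞ := fun k =>
    (ball e (2 ^ (k + 1) * t)).indicator fun _ => ENNReal.ofReal (8 * (1 / 4) ^ k / t) with hF
  have hpt : ∀ w ∈ ball (0 : ℂ) 1, ENNReal.ofReal (diskKernel w ξ) ≤ ∑' k, F k w := by
    intro w hw
    have hw1 : ‖w‖ < 1 := mem_ball_zero_iff.1 hw
    set D := ‖1 - conj w * ξ‖ with hD
    have hDt : t ≤ D := by
      have h1 := norm_sub_norm_le (1 : ℂ) (conj w * ξ)
      rw [norm_one, norm_mul, RCLike.norm_conj] at h1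
      nlinarith [norm_nonneg ξ, norm_nonneg w]
    have hD0 : 0 < D := ht0.trans_le hDt
    have hdist : dist w e ≤ 2 * D := by
      have h1 : ‖1 - conj w * e‖ = dist w e := by
        have : 1 - conj w * e = conj (e - w) * e := by
          have h2 : conj e * e = 1 := by rw [Complex.conj_mul', he]; simp
          rw [map_sub, sub_mul, h2]
        rw [this, norm_mul, RCLike.norm_conj, he, mul_one, dist_comm, dist_eq_norm]
      have h2 : 1 - conj w * e = (1 - conj w * ξ) - conj w * ((t : ℂ) * e) := by
        conv_rhs => rw [hξe]
        rw [ht]; push_cast; ring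
      rw [← h1, h2]
      refine (norm_sub_le _ _).trans ?_
      rw [norm_mul, norm_mul, RCLike.norm_conj, he, Complex.norm_real, Real.norm_of_nonneg ht0.le]
      nlinarith [norm_nonneg w]
    have hker : diskKernel w ξ ≤ 2 * t / D ^ 2 := by
      unfold diskKernel
      rw [← hD]
      gcongr
      rw [ht]
      nlinarith [norm_nonneg ξ]
    obtain ⟨k, hk, hle⟩ : ∃ k, w ∈ ball e (2 ^ (k + 1) * t) ∧
        2 * t / D ^ 2 ≤ 8 * (1 / 4) ^ k / t := by
      have hex : ∃ k : ℕ, dist w e < 2 ^ (k + 1) * t := by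
        obtain ⟨n, hn⟩ := pow_unbounded_of_one_lt (dist w e / t) one_lt_two
        refine ⟨n, ?_⟩
        rw [div_lt_iff₀ ht0] at hn
        refine hn.trans_le ?_
        gcongr
        · norm_num
        · omega
      classical
      refine ⟨Nat.find hex, mem_ball.2 (Nat.find_spec hex), ?_⟩
      rcases hk : Nat.find hex with _ | j
      · rw [pow_zero, mul_one, div_le_div_iff₀ (by positivity) ht0]
        nlinarith
      · have h1 := Nat.find_min hex (m := j) (by omega)
        rw [not_lt] at h1
        have h2 : 2 ^ j * t ≤ D := by
          rw [pow_succ] at h1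
          linarith
        have h3 : (2 ^ j * t) ^ 2 ≤ D ^ 2 := by gcongr
        have h4 : (4 : ℝ) ^ j = (2 ^ j) ^ 2 := by rw [← pow_mul, mul_comm, pow_mul]; norm_num
        calc 2 * t / D ^ 2 ≤ 2 * t / (2 ^ j * t) ^ 2 := by gcongr
          _ = 8 * (1 / 4) ^ (j + 1) / t := by
              rw [one_div_pow, pow_succ (4 : ℝ), h4]; field_simp; norm_num
    calc ENNReal.ofReal (diskKernel w ξ) ≤ F k w := by
          rw [hF]
          simp only [indicator_of_mem hk]
          exact ENNReal.ofReal_le_ofReal (hker.trans hle)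
      _ ≤ _ := ENNReal.le_tsum k
  calc ∫⁻ w in ball 0 1, ENNReal.ofReal (diskKernel w ξ) ∂ν
      ≤ ∫⁻ w in ball 0 1, ∑' k, F k w ∂ν := setLIntegral_mono' measurableSet_ball hpt
    _ = ∑' k, ∫⁻ w in ball 0 1, F k w ∂ν :=
        lintegral_tsum fun k => (measurable_const.indicator measurableSet_ball).aemeasurable
    _ ≤ ∑' k : ℕ, ENNReal.ofReal (16 * N * (1 / 2) ^ k) := by
        refine ENNReal.tsum_le_tsum fun k => ?_
        rw [hF, lintegral_indicator_const measurableSet_ball,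
          Measure.restrict_apply measurableSet_ball, inter_comm]
        refine (mul_le_mul_right (hν e he (2 ^ (k + 1) * t) (by positivity)) _).trans ?_
        rw [← ENNReal.ofReal_mul (by positivity)]
        refine le_of_eq ?_
        congr 1
        have h4 : (4 : ℝ) ^ k = (2 ^ k) ^ 2 := by rw [← pow_mul, mul_comm, pow_mul]; norm_num
        rw [one_div_pow, one_div_pow, h4, pow_succ]
        field_simp
        ring
    _ = ENNReal.ofReal (32 * N) := by
        rw [← ENNReal.ofReal_tsum_of_nonneg (fun k => by positivity)
          (summable_geometric_two.mul_left _), tsum_mul_left, tsum_geometric_two]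
        congr 1
        ring

/-- The kernel at nearby base points is comparable. -/
lemma diskKernel_le_four_mul {w b ξ : ℂ} (hw : ‖w‖ < 1) (hb : ‖b‖ < 1) (hξ : ‖ξ‖ < 1)
    (h : dist w b ≤ 1 - ‖b‖) : diskKernel b ξ ≤ 4 * diskKernel w ξ := by
  have h1 : 1 - ‖b‖ ≤ ‖1 - conj b * ξ‖ := by
    have h1 := norm_sub_norm_le (1 : ℂ) (conj b * ξ)
    rw [norm_one, norm_mul, RCLike.norm_conj] at h1
    nlinarith [norm_nonneg ξ, norm_nonneg b]
  have h2 : ‖1 - conj w * ξ‖ ≤ 2 * ‖1 - conj b * ξ‖ := by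
    have e : 1 - conj w * ξ = (1 - conj b * ξ) - conj (w - b) * ξ := by
      rw [map_sub]; ring
    rw [e]
    refine (norm_sub_le _ _).trans ?_
    rw [norm_mul, RCLike.norm_conj]
    rw [dist_eq_norm] at h
    nlinarith [norm_nonneg ξ, norm_nonneg (w - b)]
  have h3 := norm_pos_iff.2 (one_sub_conj_mul_ne_zero hw hξ)
  have h4 := norm_pos_iff.2 (one_sub_conj_mul_ne_zero hb hξ)
  have h5 : 0 ≤ 1 - ‖ξ‖ ^ 2 := by nlinarith [norm_nonneg ξ]
  unfold diskKernel
  calc (1 - ‖ξ‖ ^ 2) / ‖1 - conj b * ξ‖ ^ 2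
      = 4 * ((1 - ‖ξ‖ ^ 2) / (2 * ‖1 - conj b * ξ‖) ^ 2) := by field_simp; norm_num
    _ ≤ _ := by gcongr

lemma diskKernel_nonneg (w : ℂ) {ξ : ℂ} (hξ : ‖ξ‖ < 1) : 0 ≤ diskKernel w ξ :=
  div_nonneg (by nlinarith [norm_nonneg ξ]) (by positivity)

/-- The distortion estimate for finite sums of point masses in the disc. -/
lemma exists_sum_mul_norm_deriv_le {φ : ℂ → ℂ} {Ω : Set ℂ} {C : ℝ} (hC : 0 < C)
    (hΩ : IsOpen Ω) (hne : Ω ≠ univ) (hconn : IsConnected Ω)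
    (hφ : DifferentiableOn ℂ φ (ball 0 1)) (hinj : InjOn φ (ball 0 1)) (honto : φ '' ball 0 1 = Ω)
    (hreg : ∀ z : ℂ, ∀ r, 0 < r → μH[1] (frontier Ω ∩ ball z r) ≤ ENNReal.ofReal (C * r)) :
    ∃ B, 0 < B ∧ ∀ z ∈ frontier Ω, ∀ r, 0 < r → ∀ (J : Finset ℂ) (m : ℂ → ℝ),
      (∀ b ∈ J, ‖b‖ < 1 ∧ φ b ∈ ball z r ∧ 0 ≤ m b) →
      (∀ ξ : ℂ, ‖ξ‖ < 1 → ∑ b ∈ J, m b * diskKernel b ξ ≤ 1) →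
      ∑ b ∈ J, m b * ‖deriv φ b‖ ≤ B * r := by
  obtain ⟨ψ, hψ, hψφ⟩ := exists_holomorphic_leftInverse isOpen_ball hφ hinj
  rw [honto] at hψ
  have hcne : (Ωᶜ).Nonempty := nonempty_compl.2 hne
  have hφψ : ∀ w ∈ Ω, ‖ψ w‖ < 1 ∧ φ (ψ w) = w := by
    intro w hw
    rw [← honto] at hw
    obtain ⟨ζ, hζ, rfl⟩ := hw
    rw [hψφ ζ hζ]
    exact ⟨mem_ball_zero_iff.1 hζ, rfl⟩
  have hφΩ : ∀ ζ : ℂ, ‖ζ‖ < 1 → φ ζ ∈ Ω := fun ζ hζ => by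
    rw [← honto]; exact mem_image_of_mem _ (mem_ball_zero_iff.2 hζ)
  have hderiv : ∀ ζ : ℂ, ‖ζ‖ < 1 → deriv ψ (φ ζ) * deriv φ ζ = 1 := by
    intro ζ hζ
    have hζ' : ζ ∈ ball (0 : ℂ) 1 := mem_ball_zero_iff.2 hζ
    have h1 : HasDerivAt φ (deriv φ ζ) ζ :=
      (hφ.differentiableAt (isOpen_ball.mem_nhds hζ')).hasDerivAt
    have h2 : HasDerivAt ψ (deriv ψ (φ ζ)) (φ ζ) :=
      (hψ.differentiableAt (hΩ.mem_nhds (hφΩ ζ hζ))).hasDerivAt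
    have h3 : HasDerivAt (ψ ∘ φ) 1 ζ := (hasDerivAt_id ζ).congr_of_eventuallyEq <| by
      filter_upwards [isOpen_ball.mem_nhds hζ'] with x hx using hψφ x hx
    exact (h2.comp ζ h1).unique h3
  have hkoebe : ∀ ζ : ℂ, ‖ζ‖ < 1 → (1 - ‖ζ‖) * ‖deriv φ ζ‖ ≤ 1024 * infDist (φ ζ) Ωᶜ := by
    intro ζ hζ
    have hsub : ball ζ (1 - ‖ζ‖) ⊆ ball 0 1 := ball_subset_ball' (by simp)
    rw [← div_le_iff₀' (by norm_num)]
    refine (le_infDist hcne).2 fun y hy => ?_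
    rw [div_le_iff₀' (by norm_num), dist_eq_norm]
    refine norm_deriv_le_of_injOn_of_notMem (by linarith) (hφ.mono hsub) (hinj.mono hsub)
      fun h => hy ?_
    rw [← honto]
    exact image_mono hsub h
  have h0 : (0 : ℂ) ∈ ball (0 : ℂ) 1 := by simp
  have h2 : (1 / 2 : ℂ) ∈ ball (0 : ℂ) 1 := by simp; norm_num
  have hpq : 0 < dist (φ 0) (φ (1 / 2)) := dist_pos.2 fun h => by
    have := hinj h0 h2 h
    norm_num at this
  have hlow : ∀ s, 0 < s → s ≤ dist (φ 0) (φ (1 / 2)) / 2 → ∀ y ∈ frontier Ω,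
      ENNReal.ofReal s ≤ μH[1] (frontier Ω ∩ ball y s) := by
    intro s _ hs y hy
    refine ofReal_le_hausdorffMeasure_frontier_inter_ball hΩ hconn
      (fun y hy ρ hρ => ?_) hy fun h => ?_
    · rw [← honto] at hy ⊢
      exact not_sphere_subset_image hφ hinj hy hρ
    · have h3 := mem_ball.1 (h (hφΩ 0 (by simp)))
      have h4 := mem_ball'.1 (h (hφΩ (1 / 2) (by simp; norm_num)))
      have := dist_triangle (φ 0) y (φ (1 / 2))
      linarith
  have hψ' : ∀ w ∈ Ω, deriv ψ w ≠ 0 := by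
    intro w hw h
    have := hderiv (ψ w) (hφψ w hw).1
    rw [(hφψ w hw).2, h, zero_mul] at this
    exact zero_ne_one this
  have hd : ∀ w ∈ Ω, 1 - ‖ψ w‖ ≤ ‖deriv ψ w‖ * (1024 * infDist w Ωᶜ) := by
    intro w hw
    have h3 := hderiv (ψ w) (hφψ w hw).1
    have h4 := hkoebe (ψ w) (hφψ w hw).1
    rw [(hφψ w hw).2] at h3 h4
    have h5 := congrArg norm h3
    rw [norm_mul, norm_one] at h5
    calc 1 - ‖ψ w‖ = ‖deriv ψ w‖ * ((1 - ‖ψ w‖) * ‖deriv φ (ψ w)‖) := by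
          linear_combination -(1 - ‖ψ w‖) * h5
      _ ≤ _ := by gcongr
  obtain ⟨B, hB, hmain⟩ := sum_mul_infDist_div_le (c := 1024) hΩ hne hC (half_pos hpq)
    (by norm_num) hlow hreg hψ (fun w hw => (hφψ w hw).1) hψ' hd
  refine ⟨1024 * B, by positivity, fun z hz r hr J m hJ hK => ?_⟩
  classical
  have hJinj : InjOn φ J := hinj.mono fun b hb => mem_ball_zero_iff.2 (hJ b hb).1
  have hJψ : ∀ b ∈ J, ψ (φ b) = b := fun b hb => hψφ b (mem_ball_zero_iff.2 (hJ b hb).1)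
  have key := hmain z hz r hr (J.image φ) (fun w => m (ψ w)) (fun w hw => by
      obtain ⟨b, hb, rfl⟩ := Finset.mem_image.1 hw
      rw [hJψ b hb]
      exact ⟨hφΩ b (hJ b hb).1, (hJ b hb).2.1, (hJ b hb).2.2⟩) (fun ξ hξ => by
      rw [Finset.sum_image hJinj]
      refine le_of_eq_of_le (Finset.sum_congr rfl fun b hb => ?_) (hK ξ hξ)
      rw [hJψ b hb])
  rw [Finset.sum_image hJinj] at key
  calc ∑ b ∈ J, m b * ‖deriv φ b‖
      ≤ ∑ b ∈ J, 1024 * (m (ψ (φ b)) * (infDist (φ b) Ωᶜ / (1 - ‖ψ (φ b)‖))) := by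
        refine Finset.sum_le_sum fun b hb => ?_
        have hb1 : 0 < 1 - ‖b‖ := by linarith [(hJ b hb).1]
        rw [hJψ b hb, mul_left_comm]
        refine mul_le_mul_of_nonneg_left ?_ (hJ b hb).2.2
        rw [← mul_div_assoc, le_div_iff₀' hb1]
        exact hkoebe b (hJ b hb).1
    _ ≤ 1024 * B * r := by
        rw [← Finset.mul_sum, mul_assoc]
        gcongr

/-- A compact set is mapped to a finite subset of itself by a simple function close to the
identity. -/
lemma exists_simpleFunc_dist_lt {K : Set ℂ} (hK : IsCompact K) (hne : K.Nonempty) {δ : ℝ}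
    (hδ : 0 < δ) :
    ∃ q : SimpleFunc ℂ ℂ, (∀ w, q w ∈ K) ∧ ∀ w ∈ K, dist w (q w) < δ := by
  obtain ⟨t, htK, htfin, hcov⟩ := hK.finite_cover_balls hδ
  have htne : t.Nonempty := by
    obtain ⟨w, hw⟩ := hne
    obtain ⟨x, hx, -⟩ := mem_iUnion₂.1 (hcov hw)
    exact ⟨x, hx⟩
  obtain ⟨f, rfl⟩ := htfin.countable.exists_eq_range htne
  obtain ⟨s, hs⟩ := hK.elim_finite_subcover (fun i => ball (f i) δ) (fun _ => isOpen_ball)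
    (by simpa using hcov)
  refine ⟨SimpleFunc.nearestPt f (s.sup id), fun w => htK ?_, fun w hw => ?_⟩
  · simp [SimpleFunc.nearestPt]
  · obtain ⟨i, hi, hwi⟩ := mem_iUnion₂.1 (hs hw)
    have h1 := SimpleFunc.edist_nearestPt_le f w (Finset.le_sup (f := id) hi)
    rw [id, edist_dist, edist_dist, ENNReal.ofReal_le_ofReal_iff dist_nonneg] at h1
    rw [dist_comm]
    rw [mem_ball, dist_comm] at hwi
    exact h1.trans_lt hwi

section

variable {φ : ℂ → ℂ} {B N r : ℝ} {z : ℂ} {ν : Measure ℂ}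

lemma setLIntegral_norm_deriv_le_of_isCompact
    (hφ : DifferentiableOn ℂ φ (ball 0 1)) (hB : 0 < B) (hN : 0 < N) (hr : 0 < r)
    (hsum : ∀ (J : Finset ℂ) (m : ℂ → ℝ),
      (∀ b ∈ J, ‖b‖ < 1 ∧ φ b ∈ ball z r ∧ 0 ≤ m b) →
      (∀ ξ : ℂ, ‖ξ‖ < 1 → ∑ b ∈ J, m b * diskKernel b ξ ≤ 1) →
      ∑ b ∈ J, m b * ‖deriv φ b‖ ≤ B * r)
    (hν : ∀ x : ℂ, ‖x‖ = 1 → ∀ r, 0 < r → ν (ball 0 1 ∩ ball x r) ≤ ENNReal.ofReal (N * r))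
    {K : Set ℂ} (hK : IsCompact K) (hK1 : K ⊆ ball 0 1) (hKz : ∀ w ∈ K, φ w ∈ ball z r) :
    ∫⁻ w in K, (‖deriv φ w‖₊ : ℝ≥0∞) ∂ν ≤ ENNReal.ofReal (129 * B * N * r) := by
  rcases K.eq_empty_or_nonempty with rfl | hKne
  · simp
  have hνK : ν K ≠ ⊤ := by
    refine ne_top_of_le_ne_top ENNReal.ofReal_ne_top ((measure_mono (t := ball 0 1 ∩ ball 1 3)
      fun w hw => ⟨hK1 hw, ?_⟩).trans (hν 1 norm_one 3 (by norm_num)))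
    have h1 := mem_ball_zero_iff.1 (hK1 hw)
    rw [mem_ball, dist_eq_norm]
    have h2 := norm_sub_le w 1
    rw [norm_one] at h2
    linarith
  obtain ⟨R, hR1, hR⟩ : ∃ R < 1, ∀ w ∈ K, ‖w‖ ≤ R := by
    obtain ⟨w₀, hw₀, hmax⟩ := hK.exists_isMaxOn hKne continuous_norm.continuousOn
    exact ⟨‖w₀‖, mem_ball_zero_iff.1 (hK1 hw₀), fun w hw => hmax hw⟩
  set η := B * N * r / ((ν K).toReal + 1) with hη
  have hη0 : 0 < η := by positivity
  have huc := hK.uniformContinuousOn_of_continuous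
    ((hφ.deriv isOpen_ball).continuousOn.mono hK1)
  obtain ⟨δ, hδ, hδη⟩ := Metric.uniformContinuousOn_iff.1 huc η hη0
  obtain ⟨q, hqK, hqd⟩ := exists_simpleFunc_dist_lt hK hKne (lt_min hδ (sub_pos.2 hR1))
  set M : ℂ → ℝ := fun b => (ν.restrict K (q ⁻¹' {b})).toReal with hM
  have hfin : ∀ b, ν.restrict K (q ⁻¹' {b}) ≠ ⊤ := fun b =>
    ne_top_of_le_ne_top hνK
      ((measure_mono (subset_univ _)).trans_eq (Measure.restrict_apply_univ K))
  have hMsum : ∀ g : ℂ → ℝ, (∀ b, 0 ≤ g b) → ENNReal.ofReal (∑ b ∈ q.range, M b * g b) =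
      ∫⁻ w in K, ENNReal.ofReal (g (q w)) ∂ν := by
    intro g hg
    have h1 := SimpleFunc.map_lintegral (μ := ν.restrict K) (fun b => ENNReal.ofReal (g b)) q
    rw [← SimpleFunc.lintegral_eq_lintegral] at h1
    simp only [SimpleFunc.map_apply] at h1
    rw [h1, ENNReal.ofReal_sum_of_nonneg fun b _ => mul_nonneg ENNReal.toReal_nonneg (hg b)]
    refine Finset.sum_congr rfl fun b _ => ?_
    rw [ENNReal.ofReal_mul ENNReal.toReal_nonneg, ENNReal.ofReal_toReal (hfin b), mul_comm]
  have hker : ∀ ξ : ℂ, ‖ξ‖ < 1 → ∑ b ∈ q.range, M b * diskKernel b ξ ≤ 128 * N := by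
    intro ξ hξ
    rw [← ENNReal.ofReal_le_ofReal_iff (by positivity),
      hMsum _ fun b => diskKernel_nonneg b hξ]
    calc ∫⁻ w in K, ENNReal.ofReal (diskKernel (q w) ξ) ∂ν
        ≤ ∫⁻ w in K, 4 * ENNReal.ofReal (diskKernel w ξ) ∂ν := by
          refine setLIntegral_mono' hK.measurableSet fun w hw => ?_
          have h4 : (4 : ℝ≥0∞) = ENNReal.ofReal 4 := by simp
          rw [h4, ← ENNReal.ofReal_mul (by norm_num)]
          refine ENNReal.ofReal_le_ofReal (diskKernel_le_four_mul (mem_ball_zero_iff.1 (hK1 hw))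
            (mem_ball_zero_iff.1 (hK1 (hqK w))) hξ ?_)
          have := (hqd w hw).trans_le (min_le_right _ _)
          linarith [hR _ (hqK w)]
      _ = 4 * ∫⁻ w in K, ENNReal.ofReal (diskKernel w ξ) ∂ν :=
          lintegral_const_mul' _ _ (by simp)
      _ ≤ 4 * ENNReal.ofReal (32 * N) := by
          gcongr
          exact (lintegral_mono_set hK1).trans (lintegral_diskKernel_le hN.le hν hξ)
      _ = ENNReal.ofReal (128 * N) := by
          have h4 : (4 : ℝ≥0∞) = ENNReal.ofReal 4 := by simp
          rw [h4, ← ENNReal.ofReal_mul (by norm_num)]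
          congr 1
          ring
  have hderiv : ∑ b ∈ q.range, M b * ‖deriv φ b‖ ≤ 128 * N * (B * r) := by
    have h1 := hsum q.range (fun b => M b / (128 * N)) (fun b hb => by
        obtain ⟨w, rfl⟩ := SimpleFunc.mem_range.1 hb
        exact ⟨mem_ball_zero_iff.1 (hK1 (hqK w)), hKz _ (hqK w),
          div_nonneg ENNReal.toReal_nonneg (by positivity)⟩) (fun ξ hξ => by
        simp only [div_mul_eq_mul_div]
        rw [← Finset.sum_div]
        exact div_le_one_of_le₀ (hker ξ hξ) (by positivity))
    simp only [div_mul_eq_mul_div] at h1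
    rwa [← Finset.sum_div, div_le_iff₀' (by positivity)] at h1
  calc ∫⁻ w in K, (‖deriv φ w‖₊ : ℝ≥0∞) ∂ν
      ≤ ∫⁻ w in K, (ENNReal.ofReal ‖deriv φ (q w)‖ + ENNReal.ofReal η) ∂ν := by
        refine setLIntegral_mono' hK.measurableSet fun w hw => ?_
        rw [← ENNReal.ofReal_add (norm_nonneg _) hη0.le, ← enorm_eq_nnnorm, ← ofReal_norm]
        refine ENNReal.ofReal_le_ofReal ?_
        have h1 := hδη w hw (q w) (hqK w) ((hqd w hw).trans_le (min_le_left _ _))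
        rw [dist_eq_norm] at h1
        have h2 := norm_sub_norm_le (deriv φ w) (deriv φ (q w))
        linarith
    _ = ENNReal.ofReal (∑ b ∈ q.range, M b * ‖deriv φ b‖) + ENNReal.ofReal η * ν K := by
        rw [lintegral_add_right _ measurable_const, setLIntegral_const,
          hMsum (fun b => ‖deriv φ b‖) fun b => norm_nonneg _]
    _ ≤ ENNReal.ofReal (128 * N * (B * r)) + ENNReal.ofReal (B * N * r) := by
        gcongr
        rw [← ENNReal.ofReal_toReal hνK, ← ENNReal.ofReal_mul hη0.le]
        refine ENNReal.ofReal_le_ofReal ?_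
        rw [hη, div_mul_eq_mul_div, div_le_iff₀ (by positivity)]
        gcongr
        linarith
    _ = ENNReal.ofReal (129 * B * N * r) := by
        rw [← ENNReal.ofReal_add (by positivity) (by positivity)]
        congr 1
        ring

lemma setLIntegral_norm_deriv_le
    (hφ : DifferentiableOn ℂ φ (ball 0 1)) (hB : 0 < B) (hN : 0 < N) (hr : 0 < r)
    (hsum : ∀ (J : Finset ℂ) (m : ℂ → ℝ),
      (∀ b ∈ J, ‖b‖ < 1 ∧ φ b ∈ ball z r ∧ 0 ≤ m b) →
      (∀ ξ : ℂ, ‖ξ‖ < 1 → ∑ b ∈ J, m b * diskKernel b ξ ≤ 1) →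
      ∑ b ∈ J, m b * ‖deriv φ b‖ ≤ B * r)
    (hν : ∀ x : ℂ, ‖x‖ = 1 → ∀ r, 0 < r → ν (ball 0 1 ∩ ball x r) ≤ ENNReal.ofReal (N * r)) :
    ∫⁻ w in ball 0 1 ∩ φ ⁻¹' ball z r, (‖deriv φ w‖₊ : ℝ≥0∞) ∂ν ≤
      ENNReal.ofReal (129 * B * N * r) := by
  have hopen : IsOpen (ball 0 1 ∩ φ ⁻¹' ball z r) :=
    hφ.continuousOn.isOpen_inter_preimage isOpen_ball isOpen_ball
  obtain ⟨F, hFc, hFs, hFU, hFm⟩ := hopen.exists_iUnion_isClosed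
  rw [← hFU, setLIntegral_iUnion_of_directed _ hFm.directed_le]
  refine iSup_le fun n => setLIntegral_norm_deriv_le_of_isCompact hφ hB hN hr hsum hν
    ((isCompact_closedBall (0 : ℂ) 1).of_isClosed_subset (hFc n) ?_)
    ((hFs n).trans inter_subset_left) fun w hw => (hFs n hw).2
  exact ((hFs n).trans inter_subset_left).trans ball_subset_closedBall

end

/-- A Carleson measure on the unit disc has linearly growing mass at all scales. -/
lemma exists_measure_inter_ball_le_of_isCarleson {ν : Measure ℂ} (hν : IsCarleson unitDisk ν) :
    ∃ N, 0 < N ∧ ∀ x : ℂ, ‖x‖ = 1 → ∀ r, 0 < r →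
      ν (ball 0 1 ∩ ball x r) ≤ ENNReal.ofReal (N * r) := by
  have hfr : frontier unitDisk = sphere (0 : ℂ) 1 := frontier_ball 0 one_ne_zero
  set N₀ := (carlesonNorm unitDisk ν).toReal with hN₀
  have hN₀0 : 0 ≤ N₀ := ENNReal.toReal_nonneg
  have hdiam : ENNReal.ofReal 2 ≤ ediam (frontier unitDisk) := by
    have h1 : (1 : ℂ) ∈ frontier unitDisk := by rw [hfr]; simp
    have h2 : (-1 : ℂ) ∈ frontier unitDisk := by rw [hfr]; simp
    refine le_trans (le_of_eq ?_) (edist_le_ediam_of_mem h1 h2)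
    rw [edist_dist, dist_eq_norm]
    norm_num
  have hsmall : ∀ x : ℂ, ‖x‖ = 1 → ∀ r, 0 < r → r < 2 →
      ν (ball 0 1 ∩ ball x r) ≤ ENNReal.ofReal (N₀ * r) := by
    intro x hx r hr hr2
    have hxf : x ∈ frontier unitDisk := by rw [hfr]; simpa using hx
    have h1 : ν (unitDisk ∩ ball x r) / ENNReal.ofReal r ≤ carlesonNorm unitDisk ν :=
      le_iSup₂_of_le x hxf <| le_iSup₂_of_le r
        ⟨hr, ((ENNReal.ofReal_lt_ofReal_iff two_pos).2 hr2).trans_le hdiam⟩ le_rfl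
    rw [ENNReal.div_le_iff (by simpa using hr) ENNReal.ofReal_ne_top] at h1
    rwa [ENNReal.ofReal_mul hN₀0, hN₀, ENNReal.ofReal_toReal hν.ne]
  have hcover : ball (0 : ℂ) 1 ⊆
      (ball 0 1 ∩ ball 1 (19 / 10)) ∪ (ball 0 1 ∩ ball (-1) (19 / 10)) := by
    intro w hw
    have hw1 : ‖w‖ ^ 2 < 1 := by
      have := mem_ball_zero_iff.1 hw
      nlinarith [norm_nonneg w]
    rw [Complex.sq_norm, Complex.normSq_apply] at hw1
    rw [← inter_union_distrib_left]
    refine ⟨hw, ?_⟩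
    rcases le_total 0 w.re with h | h
    · left
      rw [mem_ball, dist_eq_norm]
      refine lt_of_pow_lt_pow_left₀ 2 (by norm_num) ?_
      rw [Complex.sq_norm, Complex.normSq_apply]
      simp
      nlinarith
    · right
      rw [mem_ball, dist_eq_norm]
      refine lt_of_pow_lt_pow_left₀ 2 (by norm_num) ?_
      rw [Complex.sq_norm, Complex.normSq_apply]
      simp
      nlinarith
  refine ⟨2 * N₀ + 1, by positivity, fun x hx r hr => ?_⟩
  rcases lt_or_ge r 2 with h | h
  · exact (hsmall x hx r hr h).trans (ENNReal.ofReal_le_ofReal (by nlinarith))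
  · calc ν (ball 0 1 ∩ ball x r) ≤ ν (ball 0 1) := measure_mono inter_subset_left
      _ ≤ ν (ball 0 1 ∩ ball 1 (19 / 10)) + ν (ball 0 1 ∩ ball (-1) (19 / 10)) :=
          (measure_mono hcover).trans (measure_union_le _ _)
      _ ≤ ENNReal.ofReal (N₀ * (19 / 10)) + ENNReal.ofReal (N₀ * (19 / 10)) :=
          add_le_add (hsmall _ (by simp) _ (by norm_num) (by norm_num))
            (hsmall _ (by simp) _ (by norm_num) (by norm_num))
      _ ≤ _ := by
          rw [← ENNReal.ofReal_add (by positivity) (by positivity)]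
          exact ENNReal.ofReal_le_ofReal (by nlinarith)

lemma pushForward_apply_le {D A : Set ℂ} {φ : ℂ → ℂ} {ν : Measure ℂ} (hD : MeasurableSet D)
    (hν : ν D ≠ ⊤) (hA : MeasurableSet A) :
    pushForward D φ ν A ≤ ∫⁻ w in D ∩ φ ⁻¹' A, (‖deriv φ w‖₊ : ℝ≥0∞) ∂ν := by
  unfold pushForward
  have : IsFiniteMeasure (ν.restrict D) := ⟨by
    rw [Measure.restrict_apply_univ]; exact hν.lt_top⟩
  by_cases hφ : AEMeasurable φ ((ν.restrict D).withDensity fun z => (‖deriv φ z‖₊ : ℝ≥0∞))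
  · rw [Measure.map_apply_of_aemeasurable hφ hA, withDensity_apply',
      Measure.restrict_restrict' hD, inter_comm]
  · rw [Measure.map_of_not_aemeasurable hφ]
    simp

/-- A vanishing Carleson measure on the disc becomes small after removing a compact disc. -/
lemma exists_restrict_measure_inter_ball_le {ν : Measure ℂ}
    (hfin : ν (ball 0 1) ≠ ⊤) {ε δ : ℝ} (hε : 0 < ε) (hδ : 0 < δ)
    (hν : ∀ x : ℂ, ‖x‖ = 1 → ∀ r, 0 < r → r < δ →
      ν (ball 0 1 ∩ ball x r) ≤ ENNReal.ofReal (ε * r)) :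
    ∃ ρ < 1, ∀ x : ℂ, ‖x‖ = 1 → ∀ r, 0 < r →
      ν.restrict {w | ρ < ‖w‖} (ball 0 1 ∩ ball x r) ≤ ENNReal.ofReal (ε * r) := by
  set S : ℕ → Set ℂ := fun n => ball 0 1 ∩ {w | 1 - 1 / ((n : ℝ) + 1) < ‖w‖} with hS
  have hmeas : ∀ n, MeasurableSet (S n) := fun n =>
    measurableSet_ball.inter (isOpen_lt continuous_const continuous_norm).measurableSet
  have hanti : Antitone S := by
    intro n m hnm w hw
    have h1 := Nat.one_div_le_one_div (α := ℝ) hnm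
    have h2 : 1 - 1 / ((m : ℝ) + 1) < ‖w‖ := hw.2
    exact ⟨hw.1, show 1 - 1 / ((n : ℝ) + 1) < ‖w‖ by linarith⟩
  have hempty : ⋂ n, S n = ∅ := by
    refine eq_empty_of_forall_notMem fun w hw => ?_
    have hw1 := mem_ball_zero_iff.1 (mem_iInter.1 hw 0).1
    obtain ⟨n, hn⟩ := exists_nat_one_div_lt (sub_pos.2 hw1)
    have : 1 - 1 / ((n : ℝ) + 1) < ‖w‖ := (mem_iInter.1 hw n).2
    linarith
  have htend := tendsto_measure_iInter_atTop (μ := ν) (fun n => (hmeas n).nullMeasurableSet) hanti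
    ⟨0, ne_top_of_le_ne_top hfin (measure_mono inter_subset_left)⟩
  rw [hempty, measure_empty] at htend
  have hpos : 0 < ENNReal.ofReal (ε * δ) := ENNReal.ofReal_pos.2 (by positivity)
  obtain ⟨n, hn⟩ := (htend.eventually_lt_const hpos).exists
  refine ⟨1 - 1 / ((n : ℝ) + 1), by have := Nat.one_div_pos_of_nat (α := ℝ) (n := n); linarith,
    fun x hx r hr => ?_⟩
  rcases lt_or_ge r δ with h | h
  · exact (Measure.restrict_apply_le _ _).trans (hν x hx r hr h)
  · rw [Measure.restrict_apply (measurableSet_ball.inter measurableSet_ball)]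
    refine (measure_mono ?_).trans (hn.le.trans (ENNReal.ofReal_le_ofReal (by gcongr)))
    exact fun w hw => ⟨hw.1.1, hw.2⟩

end

/-- If `∂Ω` is Ahlfors-regular then the push-forward operator `(φ⁻¹)*`
is well-defined from `CM₀(Δ)` to `CM₀(Ω)`. -/
theorem stmt_3 (φ : ℂ → ℂ) (Ω : Set ℂ)
    (hΩopen : IsOpen Ω) (hΩne : Ω.Nonempty) (hΩproper : Ω ≠ Set.univ)
    (hΩconn : IsConnected Ω) (hΩsc : SimplyConnectedSpace Ω)
    (hdiff : DifferentiableOn ℂ φ unitDisk)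
    (hinj : Set.InjOn φ unitDisk)
    (honto : φ '' unitDisk = Ω)
    (hreg : ∃ C : ℝ, 0 < C ∧ ∀ z : ℂ, ∀ r : ℝ, 0 < r →
      μH[1] (frontier Ω ∩ Metric.ball z r) ≤ ENNReal.ofReal (C * r)) :
    ∀ ν : Measure ℂ, IsVanishingCarleson unitDisk ν →
      IsVanishingCarleson Ω (pushForward unitDisk φ ν) := by
  rintro ν ⟨hcarl, hvan⟩
  obtain ⟨C, hC, hreg⟩ := hreg
  obtain ⟨B, hB, hsum⟩ := exists_sum_mul_norm_deriv_le hC hΩopen hΩproper hΩconn hdiff hinj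
    honto hreg
  obtain ⟨N, hN, hνN⟩ := exists_measure_inter_ball_le_of_isCarleson hcarl
  have hfin : ν (ball 0 1) ≠ ⊤ := by
    refine ne_top_of_le_ne_top ENNReal.ofReal_ne_top ((measure_mono (t := ball 0 1 ∩ ball 1 3)
      fun w hw => ⟨hw, ?_⟩).trans (hνN 1 norm_one 3 (by norm_num)))
    have h1 := mem_ball_zero_iff.1 hw
    rw [mem_ball, dist_eq_norm]
    have h2 := norm_sub_le w 1
    rw [norm_one] at h2
    linarith
  have hpush : ∀ z r, pushForward unitDisk φ ν (Ω ∩ ball z r) ≤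
      ∫⁻ w in ball 0 1 ∩ φ ⁻¹' ball z r, (‖deriv φ w‖₊ : ℝ≥0∞) ∂ν := fun z r =>
    (pushForward_apply_le measurableSet_ball hfin
      (hΩopen.measurableSet.inter measurableSet_ball)).trans
      (lintegral_mono_set fun _ hw => ⟨hw.1, hw.2.2⟩)
  refine ⟨?_, fun ε hε => ?_⟩
  · refine lt_of_le_of_lt (b := ENNReal.ofReal (129 * B * N)) ?_ ENNReal.ofReal_lt_top
    refine iSup₂_le fun z hz => iSup₂_le fun r hr => ?_
    rw [ENNReal.div_le_iff (by simpa using hr.1) ENNReal.ofReal_ne_top,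
      ← ENNReal.ofReal_mul (by positivity)]
    exact (hpush z r).trans
      (setLIntegral_norm_deriv_le hdiff hB hN hr.1 (hsum z hz r hr.1) hνN)
  · set ε' := ε / (129 * B) with hε'
    have hε'0 : 0 < ε' := by positivity
    obtain ⟨δ, hδ, hνδ⟩ := hvan ε' hε'0
    have hfr : frontier unitDisk = sphere (0 : ℂ) 1 := frontier_ball 0 one_ne_zero
    obtain ⟨ρ, hρ, hνρ⟩ := exists_restrict_measure_inter_ball_le hfin hε'0 hδ
      fun x hx r hr hrδ => hνδ x (by rw [hfr]; simpa using hx) r hr hrδ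
    have hsub : closedBall (0 : ℂ) ρ ⊆ ball 0 1 := closedBall_subset_ball hρ
    have hcpt : IsCompact (φ '' closedBall 0 ρ) :=
      (isCompact_closedBall _ _).image_of_continuousOn (hdiff.continuousOn.mono hsub)
    obtain ⟨d, hd, hdΩ⟩ := hcpt.exists_thickening_subset_open hΩopen
      ((image_mono hsub).trans_eq honto)
    refine ⟨d, hd, fun z hz r hr hrd => (hpush z r).trans ?_⟩
    have hE : ball 0 1 ∩ φ ⁻¹' ball z r ⊆ {w | ρ < ‖w‖} := by
      intro w hw
      by_contra h
      have hzΩ : z ∈ Ω := hdΩ (mem_thickening_iff.2 ⟨φ w, mem_image_of_mem φ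
        (mem_closedBall_zero_iff.2 (not_lt.1 h)), (mem_ball'.1 hw.2).trans hrd⟩)
      rw [hΩopen.frontier_eq] at hz
      exact hz.2 hzΩ
    rw [← Measure.restrict_restrict_of_subset hE]
    refine (setLIntegral_norm_deriv_le hdiff hB hε'0 hr (hsum z hz r hr) hνρ).trans_eq ?_
    congr 1
    rw [hε']
    field_simp
end

section
/- Let φ be a conformal mapping from the unit disk Δ onto a simply connected domain Ω ⊊ ℂ, and let Γ ⊂ Ω be a curve such that γ = φ⁻¹(Γ) is Ahlfors-regular with constant C. Then for every w₀ ∈ Γ and every r with 0 < r < dist(w₀, ∂Ω)/2, one has Λ¹(D(w₀, r) ∩ Γ) ≤ 27Cr. -/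
open MeasureTheory Metric Set
open scoped ENNReal NNReal

/-- For `G z = 1/z + m z` with `m` holomorphic on a disc, a value `w` not taken by `G` in the disc
cannot be strictly separated by a line from the image of the boundary circle. -/
lemma exists_norm_eq_re_nonneg {m : ℂ → ℂ} {r : ℝ} (hr : 0 < r)
    (hm : DifferentiableOn ℂ m (closedBall 0 r)) (a w : ℂ)
    (hne : ∀ z ∈ closedBall (0 : ℂ) r, 1 + z * m z - z * w ≠ 0) :
    ∃ z : ℂ, ‖z‖ = r ∧ 0 ≤ (a * (1 / z + m z - w)).re := by
  by_contra! hcon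
  have ha : a ≠ 0 := by
    rintro rfl
    simpa using hcon r (by simp [abs_of_pos hr])
  set F : ℂ → ℂ := fun z ↦ Complex.exp (z / (a * (1 + z * m z - z * w))) with hF
  have hFd : DifferentiableOn ℂ F (closedBall 0 r) := by
    refine DifferentiableOn.cexp (DifferentiableOn.div (by fun_prop) (by fun_prop) ?_)
    exact fun z hz ↦ mul_ne_zero ha (hne z hz)
  have hFc : DiffContOnCl ℂ F (ball 0 r) :=
    hFd.diffContOnCl_ball (subset_refl _)
  obtain ⟨z, hz, hmax⟩ := Complex.exists_mem_frontier_isMaxOn_norm isBounded_ball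
    (nonempty_ball.2 hr) hFc
  rw [frontier_ball _ hr.ne', mem_sphere_zero_iff_norm] at hz
  have h0 : ‖F 0‖ ≤ ‖F z‖ := hmax (subset_closure (mem_ball_self hr))
  have hz0 : z ≠ 0 := by rintro rfl; simp at hz; exact hr.ne hz
  have hlt := hcon z hz
  set q := a * (1 / z + m z - w) with hq
  have hFz : F z = Complex.exp (q⁻¹) := by
    simp only [hF, hq]
    congr 1
    rw [div_eq_mul_inv, ← inv_inv z, ← mul_inv, inv_inv]
    congr 1
    field_simp
  have h1 : ‖F 0‖ = 1 := by simp [hF]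
  rw [h1, hFz, Complex.norm_exp, Real.one_le_exp_iff, Complex.inv_re] at h0
  have hq0 : 0 < Complex.normSq q := Complex.normSq_pos.2 (by rintro h; simp [h] at hlt)
  exact absurd h0 (not_le.2 (div_neg_of_neg_of_pos hlt hq0))

/-- Mean square of the derivative of `1 / z + m z` over a circle, bounded below by two of its
Laurent coefficients. -/
lemma le_circleAverage_norm_sq {m : ℂ → ℂ} (hm : DifferentiableOn ℂ m (ball 0 1))
    {s : ℝ} (hs : 0 < s) (hs1 : s < 1) :
    1 / s ^ 4 + ‖deriv m 0‖ ^ 2 ≤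
      Real.circleAverage (fun z ↦ ‖deriv m z - 1 / z ^ 2‖ ^ 2) 0 s := by
  set b := deriv m 0 with hb
  have hsub : closedBall (0 : ℂ) s ⊆ ball 0 1 := closedBall_subset_ball hs1
  have hm' : DifferentiableOn ℂ (deriv m) (ball 0 1) := hm.deriv isOpen_ball
  set Q : ℂ → ℂ := fun z ↦ 2 * deriv m z * (starRingEnd ℂ) b - 2 * deriv m z * z ^ 2 / s ^ 4
    + 1 / s ^ 4 - (‖b‖ : ℂ) ^ 2 with hQ
  have hQd : DifferentiableOn ℂ Q (closedBall 0 s) := by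
    have := hm'.mono hsub
    fun_prop
  have hQc : DiffContOnCl ℂ Q (ball 0 |s|) := by
    rw [abs_of_pos hs]; exact hQd.diffContOnCl_ball (subset_refl _)
  have hsph : sphere (0 : ℂ) s ⊆ closedBall 0 s := sphere_subset_closedBall
  have hQi : CircleIntegrable Q 0 s :=
    (hQd.continuousOn.mono hsph).circleIntegrable hs.le
  have hav : Real.circleAverage (fun z ↦ (Q z).re) 0 s = 1 / s ^ 4 + ‖b‖ ^ 2 := by
    have h1 := Complex.reCLM.circleAverage_comp_comm hQi
    have h2 := hQc.circleAverage
    rw [h2] at h1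
    have h3 : Complex.reCLM ∘ Q = fun z ↦ (Q z).re := rfl
    rw [h3] at h1
    rw [h1]
    have : Q 0 = ((1 / s ^ 4 + ‖b‖ ^ 2 : ℝ) : ℂ) := by
      simp only [hQ, ← hb]
      have := Complex.mul_conj' b
      push_cast
      linear_combination 2 * this
    rw [this]; exact Complex.ofReal_re _
  rw [← hav]
  have hne : ∀ z ∈ sphere (0 : ℂ) s, z ≠ 0 := fun z hz ↦ ne_of_mem_sphere hz hs.ne'
  refine Real.circleAverage_mono ?_ ?_ ?_
  · exact ((Complex.continuous_re.comp_continuousOn hQd.continuousOn).mono hsph).circleIntegrable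
      hs.le
  · refine ContinuousOn.circleIntegrable hs.le ?_
    have := (hm'.continuousOn.mono hsub).mono hsph
    refine ContinuousOn.pow (ContinuousOn.norm (this.sub ?_)) 2
    exact ContinuousOn.div continuousOn_const (by fun_prop) fun z hz ↦ pow_ne_zero 2 (hne z hz)
  · intro z hz
    rw [abs_of_pos hs] at hz
    have hz0 := hne z hz
    have hzs : ‖z‖ = s := by simpa using hz
    set g := deriv m z - 1 / z ^ 2 with hg
    set P := b - 1 / z ^ 2 with hP
    have hconj : (starRingEnd ℂ) z = s ^ 2 / z := by
      rw [eq_div_iff hz0, mul_comm, Complex.mul_conj', hzs]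
    have key : (Q z).re = 2 * (g * (starRingEnd ℂ) P).re - ‖P‖ ^ 2 := by
      have e1 : ((2 * (g * (starRingEnd ℂ) P).re - ‖P‖ ^ 2 : ℝ) : ℂ)
          = (Q z) + (b * z ^ 2 / s ^ 4 - (starRingEnd ℂ) (b * z ^ 2 / s ^ 4)) 
            + (2 * ((((g * (starRingEnd ℂ) P).re : ℝ) : ℂ) - (g * (starRingEnd ℂ) P))) := by
        push_cast
        rw [← Complex.mul_conj' P]
        generalize ((g * (starRingEnd ℂ) P).re : ℂ) = y
        simp only [hP, hg, hQ, map_sub, map_div₀, map_one, map_pow, map_mul, hconj,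
          Complex.conj_ofReal]
        rw [← Complex.mul_conj' b]
        have : (s : ℂ) ≠ 0 := by exact_mod_cast hs.ne'
        field_simp
        ring
      have e2 := congrArg Complex.re e1
      rw [Complex.ofReal_re] at e2
      rw [e2]
      generalize b * z ^ 2 / s ^ 4 = x
      simp
    have h2 : 0 ≤ ‖g - P‖ ^ 2 := by positivity
    rw [← Complex.normSq_eq_norm_sq, Complex.normSq_sub, Complex.normSq_eq_norm_sq,
      Complex.normSq_eq_norm_sq] at h2
    change (Q z).re ≤ ‖g‖ ^ 2
    linarith

lemma le_volume_image_annulus {m : ℂ → ℂ} (hm : DifferentiableOn ℂ m (ball 0 1))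
    (hinj : InjOn (fun z ↦ 1 / z + m z) (ball 0 1 \ {0})) {r : ℝ} (hr : 0 < r) (hr1 : r < 1) :
    ENNReal.ofReal (Real.pi * (1 / r ^ 2 - 1 + ‖deriv m 0‖ ^ 2 * (1 - r ^ 2))) ≤
      volume ((fun z ↦ 1 / z + m z) '' (ball 0 1 \ closedBall 0 r)) := by
  set b := ‖deriv m 0‖
  set A : Set ℂ := ball 0 1 \ closedBall 0 r with hA
  have hAm : MeasurableSet A := measurableSet_ball.diff measurableSet_closedBall
  have hA0 : ∀ z ∈ A, z ≠ 0 := by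
    rintro z hz rfl
    exact hz.2 (mem_closedBall_self hr.le)
  have hAsub : A ⊆ ball 0 1 \ {0} := fun z hz ↦ ⟨hz.1, hA0 z hz⟩
  set g : ℂ → ℂ := fun z ↦ deriv m z - 1 / z ^ 2 with hg
  have hder : ∀ z ∈ A, HasDerivAt (fun z ↦ 1 / z + m z) (g z) z := by
    intro z hz
    have h1 := (hm.differentiableAt (isOpen_ball.mem_nhds hz.1)).hasDerivAt
    have h2 := (hasDerivAt_inv (hA0 z hz)).add h1
    refine (h2.congr_of_eventuallyEq (.of_forall fun y ↦ by simp)).congr_deriv ?_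
    simp only [hg]; ring
  have harea := lintegral_abs_det_fderiv_eq_addHaar_image volume hAm
    (fun z hz ↦ ((hder z hz).hasFDerivAt.restrictScalars ℝ).hasFDerivWithinAt) (hinj.mono hAsub)
  rw [← harea]
  have hdet : ∀ z, |(((ContinuousLinearMap.toSpanSingleton ℂ (g z)).restrictScalars ℝ :
      ℂ →L[ℝ] ℂ)).det| = ‖g z‖ ^ 2 := by
    intro z
    simp [ContinuousLinearMap.det, LinearMap.det_restrictScalars, Algebra.norm_complex_apply,
      Complex.normSq_eq_norm_sq]
  simp only [hdet]
  have hgm : Measurable fun z ↦ ENNReal.ofReal (‖g z‖ ^ 2) := by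
    have := measurable_deriv m
    exact ((this.sub (by fun_prop)).norm.pow_const 2).ennreal_ofReal
  rw [← lintegral_indicator hAm, ← Complex.lintegral_comp_polarCoord_symm, polarCoord_target,
    Measure.volume_eq_prod, ← Measure.prod_restrict, lintegral_prod]
  swap
  · refine Measurable.aemeasurable ?_
    refine (measurable_fst.ennreal_ofReal).smul ((hgm.indicator hAm).comp ?_)
    have : ⇑Complex.polarCoord.symm = fun p : ℝ × ℝ ↦
        (p.1 * (Real.cos p.2 + Real.sin p.2 * Complex.I) : ℂ) :=
      funext Complex.polarCoord_symm_apply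
    rw [this]
    fun_prop
  calc ENNReal.ofReal (Real.pi * (1 / r ^ 2 - 1 + b ^ 2 * (1 - r ^ 2)))
      = ENNReal.ofReal (∫ s in r..1, 2 * Real.pi * (s⁻¹ ^ 3 + b ^ 2 * s)) := by
        congr 1
        have hd : ∀ s ∈ uIcc r 1, HasDerivAt
            (fun s : ℝ ↦ Real.pi * (-s⁻¹ ^ 2 + b ^ 2 * s ^ 2))
            (2 * Real.pi * (s⁻¹ ^ 3 + b ^ 2 * s)) s := by
          intro s hs
          rw [uIcc_of_le hr1.le] at hs
          have hs0 : s ≠ 0 := (hr.trans_le hs.1).ne'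
          refine ((((hasDerivAt_inv hs0).pow 2).neg).add
            (((hasDerivAt_id s).pow 2).const_mul (b ^ 2))).const_mul Real.pi |>.congr_deriv ?_
          simp only [id]
          push_cast
          field_simp
        rw [intervalIntegral.integral_eq_sub_of_hasDerivAt hd]
        · simp; ring
        · refine ContinuousOn.intervalIntegrable ?_
          rw [uIcc_of_le hr1.le]
          have : ∀ s ∈ Icc r 1, s ≠ 0 := fun s hs ↦ (hr.trans_le hs.1).ne'
          fun_prop (disch := assumption)
    _ = ∫⁻ s in Ioc r 1, ENNReal.ofReal (2 * Real.pi * (s⁻¹ ^ 3 + b ^ 2 * s)) := by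
        rw [intervalIntegral.integral_of_le hr1.le, ofReal_integral_eq_lintegral_ofReal]
        · refine (ContinuousOn.integrableOn_Icc ?_).mono_set Ioc_subset_Icc_self
          have : ∀ s ∈ Icc r 1, s ≠ 0 := fun s hs ↦ (hr.trans_le hs.1).ne'
          fun_prop (disch := assumption)
        · filter_upwards [ae_restrict_mem measurableSet_Ioc] with s hs
          have := hr.trans hs.1
          have := Real.pi_pos
          simp only [Pi.zero_apply]
          positivity
    _ = ∫⁻ s in Ioo r 1, ENNReal.ofReal (2 * Real.pi * (s⁻¹ ^ 3 + b ^ 2 * s)) := by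
        rw [restrict_Ioo_eq_restrict_Ioc]
    _ ≤ ∫⁻ s in Ioo r 1, ∫⁻ θ in Ioo (-Real.pi) Real.pi, ENNReal.ofReal s •
          A.indicator (fun z ↦ ENNReal.ofReal (‖g z‖ ^ 2)) (Complex.polarCoord.symm (s, θ)) := by
        refine setLIntegral_mono' measurableSet_Ioo fun s hs ↦ ?_
        have hs0 : 0 < s := hr.trans hs.1
        have hmem : ∀ θ : ℝ, Complex.polarCoord.symm (s, θ) = circleMap 0 s θ := by
          intro θ
          simp [circleMap, Complex.exp_mul_I]
        have hmemA : ∀ θ : ℝ, circleMap 0 s θ ∈ A := by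
          intro θ
          simp [hA, circleMap, abs_of_pos hs0, hs.1, hs.2]
        simp only [hmem, smul_eq_mul, indicator_of_mem (hmemA _)]
        rw [lintegral_const_mul]
        swap
        · exact hgm.comp (measurable_circleMap ..)
        have hcont : Continuous fun θ ↦ ‖g (circleMap 0 s θ)‖ ^ 2 := by
          have h1 : ContinuousOn g A := by
            refine ContinuousOn.sub ((hm.deriv isOpen_ball).continuousOn.mono fun z hz ↦ hz.1) ?_
            exact continuousOn_const.div (by fun_prop) fun z hz ↦ pow_ne_zero 2 (hA0 z hz)
          exact (h1.comp_continuous (continuous_circleMap 0 s) hmemA).norm.pow 2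
        rw [← ofReal_integral_eq_lintegral_ofReal, ← ENNReal.ofReal_mul hs0.le]
        · refine ENNReal.ofReal_le_ofReal ?_
          have h1 := le_circleAverage_norm_sq hm hs0 hs.2
          rw [Real.circleAverage] at h1
          have h2 : ∫ θ in (0:ℝ)..2 * Real.pi, ‖g (circleMap 0 s θ)‖ ^ 2 =
              ∫ θ in Ioo (-Real.pi) Real.pi, ‖g (circleMap 0 s θ)‖ ^ 2 := by
            have hper : Function.Periodic (fun θ ↦ ‖g (circleMap 0 s θ)‖ ^ 2) (2 * Real.pi) :=
              fun θ ↦ by simp only [periodic_circleMap 0 s θ]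
            have := hper.intervalIntegral_add_eq 0 (-Real.pi)
            rw [zero_add] at this
            rw [this, intervalIntegral.integral_of_le (by linarith [Real.pi_pos]),
              integral_Ioc_eq_integral_Ioo]
            congr 3
            ring
          rw [← h2]
          have hpi := Real.pi_pos
          rw [smul_eq_mul, ← div_eq_inv_mul, le_div_iff₀ (by positivity)] at h1
          refine le_trans (le_of_eq ?_) (mul_le_mul_of_nonneg_left h1 hs0.le)
          simp only [b]
          field_simp
        · exact (hcont.integrableOn_Icc).mono_set Ioo_subset_Icc_self
        · exact .of_forall fun θ ↦ by positivity
    _ ≤ _ := lintegral_mono_set fun s hs ↦ hr.trans hs.1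

lemma det_id_sub_smul_conj (c : ℂ) :
    LinearMap.det ((LinearMap.id : ℂ →ₗ[ℝ] ℂ) -
      (LinearMap.mulLeft ℝ c).comp Complex.conjAe.toLinearMap) = 1 - ‖c‖ ^ 2 := by
  rw [← LinearMap.det_toMatrix Complex.basisOneI, Matrix.det_fin_two]
  simp [LinearMap.toMatrix_apply, ← Complex.normSq_eq_norm_sq, Complex.normSq_apply]
  ring

/-- If `G z = 1/z + m z` is injective, the image of an annulus with inner radius `r` is contained,
after an `ℝ`-linear change of variable, in any disc containing the image of the inner circle. -/
lemma norm_sub_mul_conj_le_of_injOn {m : ℂ → ℂ} (hm : DifferentiableOn ℂ m (ball 0 1))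
    (hinj : InjOn (fun z ↦ 1 / z + m z) (ball 0 1 \ {0})) {r : ℝ} (hr : 0 < r) (hr1 : r < 1)
    (c : ℂ) {R : ℝ}
    (hR : ∀ z : ℂ, ‖z‖ = r → ‖(1 / z + m z) - c * (starRingEnd ℂ) (1 / z + m z)‖ ≤ R)
    {x : ℂ} (hx : x ∈ ball (0 : ℂ) 1 \ closedBall 0 r) :
    ‖(1 / x + m x) - c * (starRingEnd ℂ) (1 / x + m x)‖ ≤ R := by
  set w := 1 / x + m x with hw
  set u := w - c * (starRingEnd ℂ) w with hu
  have hx0 : x ≠ 0 := by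
    rintro rfl
    exact hx.2 (mem_closedBall_self hr.le)
  have hsub : closedBall (0 : ℂ) r ⊆ ball 0 1 := closedBall_subset_ball hr1
  obtain ⟨z, hz, hre⟩ := exists_norm_eq_re_nonneg hr (hm.mono hsub)
    ((starRingEnd ℂ) u - u * (starRingEnd ℂ) c) w (by
      intro z hz h0
      rcases eq_or_ne z 0 with rfl | hz0
      · simp at h0
      · have : 1 / z + m z = w := by
          field_simp
          linear_combination h0
        have hzx := hinj ⟨hsub hz, hz0⟩ ⟨hx.1, hx0⟩ this
        exact hx.2 (hzx ▸ hz))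
  have hL := hR z hz
  set y := 1 / z + m z
  have e : (((starRingEnd ℂ) u - u * (starRingEnd ℂ) c) * (y - w)).re =
      ((starRingEnd ℂ) u * (y - c * (starRingEnd ℂ) y)).re - ‖u‖ ^ 2 := by
    rw [← Complex.normSq_eq_norm_sq]
    simp only [hu, Complex.normSq_apply, Complex.mul_re, Complex.sub_re, Complex.sub_im,
      Complex.conj_re, Complex.conj_im, Complex.mul_im]
    ring
  rw [e] at hre
  have h1 := Complex.re_le_norm ((starRingEnd ℂ) u * (y - c * (starRingEnd ℂ) y))
  rw [norm_mul, Complex.norm_conj] at h1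
  have h2 := mul_le_mul_of_nonneg_left hL (norm_nonneg u)
  have h3 : 0 ≤ R := (norm_nonneg _).trans hL
  by_contra! hlt
  nlinarith

lemma area_inequality_of_bound {m : ℂ → ℂ} (hm : DifferentiableOn ℂ m (ball 0 1))
    (hinj : InjOn (fun z ↦ 1 / z + m z) (ball 0 1 \ {0})) {r : ℝ} (hr : 0 < r) (hr1 : r < 1)
    (c : ℂ) (hc : ‖c‖ < 1) {R : ℝ}
    (hR : ∀ z : ℂ, ‖z‖ = r → ‖(1 / z + m z) - c * (starRingEnd ℂ) (1 / z + m z)‖ ≤ R) :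
    (1 - ‖c‖ ^ 2) * (1 / r ^ 2 - 1 + ‖deriv m 0‖ ^ 2 * (1 - r ^ 2)) ≤ R ^ 2 := by
  have hR0 : 0 ≤ R := (norm_nonneg _).trans (hR r (by simp [abs_of_pos hr]))
  set L : ℂ →ₗ[ℝ] ℂ := LinearMap.id - (LinearMap.mulLeft ℝ c).comp Complex.conjAe.toLinearMap
  have hsub : L '' ((fun z ↦ 1 / z + m z) '' (ball 0 1 \ closedBall 0 r)) ⊆ closedBall 0 R := by
    rintro _ ⟨_, ⟨x, hx, rfl⟩, rfl⟩
    rw [mem_closedBall_zero_iff]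
    exact norm_sub_mul_conj_le_of_injOn hm hinj hr hr1 c hR hx
  have h1 := measure_mono (μ := volume) hsub
  have hc2 : 0 ≤ 1 - ‖c‖ ^ 2 := by nlinarith [norm_nonneg c]
  rw [Measure.addHaar_image_linearMap, det_id_sub_smul_conj, abs_of_nonneg hc2,
    Complex.volume_closedBall] at h1
  have h2 := (mul_le_mul_right (le_volume_image_annulus hm hinj hr hr1) _).trans h1
  rw [← ENNReal.ofReal_mul hc2, ← ENNReal.ofReal_pow hR0, ← ENNReal.ofReal_coe_nnreal,
    ← ENNReal.ofReal_mul (by positivity), ENNReal.ofReal_le_ofReal_iff (by positivity)] at h2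
  rw [NNReal.coe_real_pi] at h2
  refine le_of_mul_le_mul_right ?_ Real.pi_pos
  linarith

/-- The first coefficient bound in the **area theorem** of Gronwall. -/
theorem norm_deriv_le_one_of_injOn_one_div_add {m : ℂ → ℂ}
    (hm : DifferentiableOn ℂ m (ball 0 1)) (hm0 : m 0 = 0)
    (hinj : InjOn (fun z ↦ 1 / z + m z) (ball 0 1 \ {0})) : ‖deriv m 0‖ ≤ 1 := by
  set b := ‖deriv m 0‖ with hb
  have hb0 : 0 ≤ b := norm_nonneg _
  suffices h : ∀ ε > 0, b ^ 2 - 1 ≤ 2 * ε by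
    have : b ^ 2 - 1 ≤ 0 := by
      refine le_of_forall_pos_le_add fun ε hε ↦ ?_
      have := h (ε / 2) (by positivity)
      linarith
    nlinarith
  intro ε hε
  have hd : HasDerivAt m (deriv m 0) 0 :=
    (hm.differentiableAt (isOpen_ball.mem_nhds (mem_ball_self one_pos))).hasDerivAt
  have hlittle := hd.isLittleO.def hε
  obtain ⟨δ, hδ, hball⟩ := Metric.eventually_nhds_iff.1 hlittle
  set E : ℝ → ℝ := fun r ↦ ε + b * (b + ε) * r ^ 2
  have key : ∀ᶠ r : ℝ in nhdsWithin 0 (Ioi 0),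
      -b ^ 2 * r ^ 2 + (1 - b ^ 2 * r ^ 4) * (-1 + b ^ 2 * (1 - r ^ 2)) ≤
        2 * E r + r ^ 2 * E r ^ 2 := by
    have hsmall : ∀ᶠ r : ℝ in nhds 0, b * r ^ 2 < 1 := by
      have : Filter.Tendsto (fun r : ℝ ↦ b * r ^ 2) (nhds 0) (nhds (b * 0 ^ 2)) :=
        Continuous.tendsto (by fun_prop) 0
      exact this.eventually_lt_const (by simp)
    filter_upwards [self_mem_nhdsWithin, hsmall.filter_mono nhdsWithin_le_nhds,
      (eventually_lt_nhds (b := (1 : ℝ)) one_pos).filter_mono nhdsWithin_le_nhds,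
      (eventually_lt_nhds hδ).filter_mono nhdsWithin_le_nhds] with r hr hbr hr1 hrδ
    have hr : 0 < r := hr
    have hcn : ‖deriv m 0 * r ^ 2‖ = b * r ^ 2 := by simp [hb]
    have := area_inequality_of_bound hm hinj hr hr1 (deriv m 0 * r ^ 2) (by rwa [hcn])
      (R := 1 / r + r * E r) (by
        intro z hz
        have hz0 : z ≠ 0 := by rintro rfl; simp at hz; exact hr.ne hz
        have h1 : ‖m z - deriv m 0 * z‖ ≤ ε * r := by
          have := hball (y := z) (by simpa [hz] using hrδ)
          simpa [hm0, hz, mul_comm] using this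
        have h2 : ‖m z‖ ≤ (b + ε) * r := by
          have h3 := norm_add_le (m z - deriv m 0 * z) (deriv m 0 * z)
          rw [sub_add_cancel, norm_mul, hz] at h3
          linarith
        have hconj : (starRingEnd ℂ) z = r ^ 2 / z := by
          rw [eq_div_iff hz0, mul_comm, Complex.mul_conj', hz]
        have e : 1 / z + m z - deriv m 0 * r ^ 2 * (starRingEnd ℂ) (1 / z + m z) =
            1 / z + (m z - deriv m 0 * z) - deriv m 0 * r ^ 2 * (starRingEnd ℂ) (m z) := by
          have : (r : ℂ) ≠ 0 := by exact_mod_cast hr.ne'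
          simp only [map_add, map_div₀, map_one, hconj]
          field_simp
          ring
        rw [e]
        calc _ ≤ ‖1 / z‖ + ‖m z - deriv m 0 * z‖ +
              ‖deriv m 0 * r ^ 2 * (starRingEnd ℂ) (m z)‖ :=
              (norm_sub_le _ _).trans (by gcongr; exact norm_add_le _ _)
          _ = 1 / r + ‖m z - deriv m 0 * z‖ + b * r ^ 2 * ‖m z‖ := by
              rw [norm_mul, hcn, Complex.norm_conj, norm_div, hz, norm_one]
          _ ≤ 1 / r + ε * r + b * r ^ 2 * ((b + ε) * r) := by gcongr
          _ = 1 / r + r * E r := by simp only [E]; ring)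
    rw [hcn] at this
    have e1 : (1 / r + r * E r) ^ 2 = 1 / r ^ 2 + (2 * E r + r ^ 2 * E r ^ 2) := by
      field_simp; ring
    have e2 : (1 - (b * r ^ 2) ^ 2) * (1 / r ^ 2 - 1 + b ^ 2 * (1 - r ^ 2)) = 1 / r ^ 2 +
        (-b ^ 2 * r ^ 2 + (1 - b ^ 2 * r ^ 4) * (-1 + b ^ 2 * (1 - r ^ 2))) := by
      field_simp; ring
    rw [e1, e2] at this
    linarith
  have hl : Filter.Tendsto
      (fun r : ℝ ↦ -b ^ 2 * r ^ 2 + (1 - b ^ 2 * r ^ 4) * (-1 + b ^ 2 * (1 - r ^ 2)))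
      (nhdsWithin 0 (Ioi 0))
      (nhds (-b ^ 2 * 0 ^ 2 + (1 - b ^ 2 * 0 ^ 4) * (-1 + b ^ 2 * (1 - 0 ^ 2)))) :=
    (Continuous.tendsto (by fun_prop) 0).mono_left nhdsWithin_le_nhds
  have hrr : Filter.Tendsto (fun r : ℝ ↦ 2 * E r + r ^ 2 * E r ^ 2) (nhdsWithin 0 (Ioi 0))
      (nhds (2 * E 0 + 0 ^ 2 * E 0 ^ 2)) :=
    (Continuous.tendsto (by fun_prop) 0).mono_left nhdsWithin_le_nhds
  have := le_of_tendsto_of_tendsto hl hrr key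
  simp only [E] at this
  linarith

lemma exists_inv_sqrt_of_ne_zero {p : ℂ → ℂ} (hp : DifferentiableOn ℂ p (ball 0 1))
    (hp0 : p 0 = 1) (hne : ∀ z ∈ ball (0 : ℂ) 1, p z ≠ 0) :
    ∃ k : ℂ → ℂ, DifferentiableOn ℂ k (ball 0 1) ∧ k 0 = 1 ∧
      ∀ z ∈ ball (0 : ℂ) 1, k z ^ 2 * p z = 1 := by
  have hd : DifferentiableOn ℂ (fun z ↦ -(deriv p z / p z) / 2) (ball 0 1) :=
    (((hp.deriv isOpen_ball).div hp hne).neg).div_const 2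
  obtain ⟨l, hl0, hl⟩ := hd.isExactOn_ball.with_val_at 0 0
  have hkd : ∀ z ∈ ball (0 : ℂ) 1, HasDerivAt (fun z ↦ Complex.exp (l z) ^ 2 * p z) 0 z := by
    intro z hz
    have h1 := (hp.differentiableAt (isOpen_ball.mem_nhds hz)).hasDerivAt
    refine (((hl z hz).cexp.pow 2).mul h1).congr_deriv ?_
    have := hne z hz
    simp only [Pi.pow_apply]
    push_cast
    field_simp
    ring
  refine ⟨fun z ↦ Complex.exp (l z), fun z hz ↦ ?_, by simp [hl0], fun z hz ↦ ?_⟩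
  · exact (hl z hz).cexp.differentiableAt.differentiableWithinAt
  · have := isOpen_ball.is_const_of_deriv_eq_zero (convex_ball (0 : ℂ) 1).isPreconnected
      (fun z hz ↦ (hkd z hz).differentiableAt.differentiableWithinAt)
      (fun z hz ↦ (hkd z hz).deriv) hz (mem_ball_self one_pos)
    simpa [hl0, hp0] using this

/-- **Bieberbach's inequality** for the second coefficient of a normalized univalent function
`z * p z`. -/
theorem norm_deriv_le_two_of_injOn_id_mul {p : ℂ → ℂ} (hp : DifferentiableOn ℂ p (ball 0 1))
    (hp0 : p 0 = 1) (hinj : InjOn (fun z ↦ z * p z) (ball 0 1)) : ‖deriv p 0‖ ≤ 2 := by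
  have h0 : (0 : ℂ) ∈ ball (0 : ℂ) 1 := mem_ball_self one_pos
  have hnhds : ball (0 : ℂ) 1 ∈ nhds 0 := isOpen_ball.mem_nhds h0
  have hne : ∀ z ∈ ball (0 : ℂ) 1, p z ≠ 0 := by
    intro z hz h
    have : z = 0 := hinj hz h0 (by simp [h])
    simp [this, hp0] at h
  obtain ⟨k, hk, hk0, hkp⟩ := exists_inv_sqrt_of_ne_zero hp hp0 hne
  have hsq : MapsTo (fun z : ℂ ↦ z ^ 2) (ball 0 1) (ball 0 1) := by
    intro z hz
    rw [mem_ball_zero_iff] at hz ⊢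
    rw [norm_pow]
    exact pow_lt_one₀ (norm_nonneg _) hz two_ne_zero
  have hk1 : DifferentiableOn ℂ (dslope k 0) (ball 0 1) :=
    (Complex.differentiableOn_dslope hnhds).2 hk
  have hslope : ∀ z, k z = 1 + z * dslope k 0 z := by
    intro z
    have := sub_smul_dslope k 0 z
    rw [smul_eq_mul, sub_zero, hk0] at this
    linear_combination -this
  set m : ℂ → ℂ := fun z ↦ z * dslope k 0 (z ^ 2) with hm
  have hmd : DifferentiableOn ℂ m (ball 0 1) :=
    differentiableOn_id.mul (hk1.comp (by fun_prop) hsq)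
  have hG : ∀ z : ℂ, z ≠ 0 → 1 / z + m z = k (z ^ 2) / z := by
    intro z hz
    rw [hslope (z ^ 2)]
    simp only [hm]
    field_simp
  have hkne : ∀ z ∈ ball (0 : ℂ) 1, k z ≠ 0 := by
    intro z hz h
    simpa [h] using hkp z hz
  have hGinj : InjOn (fun z ↦ 1 / z + m z) (ball 0 1 \ {0}) := by
    rintro z ⟨hz, hz0⟩ w ⟨hw, hw0⟩ h
    simp only at h
    have hz0 : z ≠ 0 := hz0
    have hw0 : w ≠ 0 := hw0
    rw [hG z hz0, hG w hw0] at h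
    have hz2 := hsq hz
    have hw2 := hsq hw
    have e : z ^ 2 * p (z ^ 2) = w ^ 2 * p (w ^ 2) := by
      have h1 := hkp _ hz2
      have h2 := hkp _ hw2
      have h3 : ∀ x : ℂ, x ≠ 0 → k (x ^ 2) ^ 2 * p (x ^ 2) = 1 →
          (k (x ^ 2) / x) ^ 2 * (x ^ 2 * p (x ^ 2)) = 1 := by
        intro x hx h
        rw [div_pow, ← mul_assoc, div_mul_cancel₀ _ (pow_ne_zero 2 hx), h]
      have h4 := h3 z hz0 h1
      have h5 := h3 w hw0 h2
      rw [h] at h4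
      refine mul_left_cancel₀ (pow_ne_zero 2 (div_ne_zero (hkne _ hw2) hw0)) (h4.trans h5.symm)
    have e2 : z ^ 2 = w ^ 2 := hinj hz2 hw2 e
    rcases sq_eq_sq_iff_eq_or_eq_neg.1 e2 with rfl | rfl
    · rfl
    · rw [neg_sq, div_neg, neg_eq_iff_add_eq_zero, ← two_mul] at h
      exact absurd h (mul_ne_zero two_ne_zero (div_ne_zero (hkne _ hw2) hw0))
  have hmain := norm_deriv_le_one_of_injOn_one_div_add hmd (by simp [hm]) hGinj
  have hm' : deriv m 0 = deriv k 0 := by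
    have h1 : HasDerivAt (fun z ↦ dslope k 0 (z ^ 2)) (deriv (fun z ↦ dslope k 0 (z ^ 2)) 0) 0 :=
      ((hk1.comp (by fun_prop) hsq).differentiableAt hnhds).hasDerivAt
    have h2 := ((hasDerivAt_id (0 : ℂ)).mul h1).deriv
    change deriv m 0 = _ at h2
    rw [h2]
    simp
  have hkp' : 2 * deriv k 0 + deriv p 0 = 0 := by
    have h1 := ((hk.differentiableAt hnhds).hasDerivAt.pow 2).mul
      (hp.differentiableAt hnhds).hasDerivAt
    have h2 : (fun z ↦ k z ^ 2 * p z) =ᶠ[nhds 0] fun _ ↦ 1 := by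
      filter_upwards [hnhds] with z hz using hkp z hz
    have h3 := h1.unique ((hasDerivAt_const (0 : ℂ) (1 : ℂ)).congr_of_eventuallyEq h2)
    simpa [hk0, hp0] using h3
  have : deriv p 0 = -2 * deriv m 0 := by rw [hm']; linear_combination hkp'
  rw [this, norm_mul, norm_neg, Complex.norm_ofNat]
  linarith

/-- The **Koebe one-quarter theorem** at the centre of the disc. -/
theorem norm_deriv_zero_le_four_mul_of_injOn {f : ℂ → ℂ} (hf : DifferentiableOn ℂ f (ball 0 1))
    (hinj : InjOn f (ball 0 1)) {v : ℂ} (hv : ∀ z ∈ ball (0 : ℂ) 1, f z ≠ v) :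
    ‖deriv f 0‖ ≤ 4 * ‖f 0 - v‖ := by
  have h0 : (0 : ℂ) ∈ ball (0 : ℂ) 1 := mem_ball_self one_pos
  have hnhds : ball (0 : ℂ) 1 ∈ nhds 0 := isOpen_ball.mem_nhds h0
  rcases eq_or_ne (deriv f 0) 0 with hd0 | hd0
  · rw [hd0, norm_zero]; positivity
  set q : ℂ → ℂ := fun z ↦ dslope f 0 z / deriv f 0 with hq
  have hqd : DifferentiableOn ℂ q (ball 0 1) :=
    ((Complex.differentiableOn_dslope hnhds).2 hf).div_const _
  have hq0 : q 0 = 1 := by simp [hq, hd0]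
  have hqf : ∀ z, f z = f 0 + deriv f 0 * (z * q z) := by
    intro z
    have := sub_smul_dslope f 0 z
    rw [smul_eq_mul, sub_zero] at this
    have e : deriv f 0 * (z * q z) = z * dslope f 0 z := by
      simp only [hq]; field_simp
    rw [e]
    linear_combination -this
  have hv0 : v - f 0 ≠ 0 := sub_ne_zero.2 (hv 0 h0).symm
  set c := deriv f 0 / (v - f 0) with hc
  have hden : ∀ z ∈ ball (0 : ℂ) 1, 1 - c * (z * q z) ≠ 0 := by
    intro z hz h
    refine hv z hz ?_
    rw [hqf z]
    rw [hc] at h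
    field_simp at h
    linear_combination -h
  have hqinj : InjOn (fun z ↦ z * q z) (ball 0 1) := by
    intro z hz w hw h
    simp only at h
    exact hinj hz hw (by rw [hqf z, hqf w, h])
  have hb1 := norm_deriv_le_two_of_injOn_id_mul hqd hq0 hqinj
  have hdend : DifferentiableOn ℂ (fun z ↦ 1 - c * (z * q z)) (ball 0 1) := by fun_prop
  have hb2 := norm_deriv_le_two_of_injOn_id_mul (p := fun z ↦ q z / (1 - c * (z * q z)))
    (hqd.div hdend hden) (by simp [hq0]) (by
      intro z hz w hw h
      have e1 := hden z hz
      have e2 := hden w hw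
      simp only at h
      rw [← mul_div_assoc z (q z), ← mul_div_assoc w (q w), div_eq_div_iff e1 e2] at h
      exact hqinj hz hw (by linear_combination h))
  have hder : deriv (fun z ↦ q z / (1 - c * (z * q z))) 0 = deriv q 0 + c := by
    have h1 := (hqd.differentiableAt hnhds).hasDerivAt
    have h2 := (((hasDerivAt_id (0 : ℂ)).mul h1).const_mul c).const_sub 1
    have h3 := (h1.div h2 (by simp)).deriv
    refine Eq.trans h3 ?_
    simp [hq0]
  rw [hder] at hb2
  have hcn : ‖c‖ ≤ 4 := by
    have := norm_sub_le (deriv q 0 + c) (deriv q 0)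
    rw [add_sub_cancel_left] at this
    linarith
  rw [hc, norm_div, div_le_iff₀ (norm_pos_iff.2 hv0), norm_sub_rev] at hcn
  exact hcn

lemma one_add_conj_mul_ne_zero {a z : ℂ} (ha : ‖a‖ < 1) (hz : ‖z‖ < 1) :
    1 + (starRingEnd ℂ) a * z ≠ 0 := by
  intro h
  have h1 : ‖(starRingEnd ℂ) a * z‖ < 1 := by
    rw [norm_mul, Complex.norm_conj]
    nlinarith [norm_nonneg a, norm_nonneg z]
  rw [← neg_eq_iff_add_eq_zero] at h
  rw [← h, norm_neg, norm_one] at h1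
  exact lt_irrefl _ h1

/-- Disc automorphisms map the unit disc to itself. -/
lemma norm_add_div_one_add_conj_mul_lt_one {a z : ℂ} (ha : ‖a‖ < 1) (hz : ‖z‖ < 1) :
    ‖(z + a) / (1 + (starRingEnd ℂ) a * z)‖ < 1 := by
  rw [norm_div, div_lt_one (norm_pos_iff.2 (one_add_conj_mul_ne_zero ha hz))]
  refine lt_of_pow_lt_pow_left₀ 2 (norm_nonneg _) ?_
  have e : ‖1 + (starRingEnd ℂ) a * z‖ ^ 2 - ‖z + a‖ ^ 2 = (1 - ‖a‖ ^ 2) * (1 - ‖z‖ ^ 2) := by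
    simp only [← Complex.normSq_eq_norm_sq, Complex.normSq_apply, Complex.add_re, Complex.add_im,
      Complex.mul_re, Complex.mul_im, Complex.conj_re, Complex.conj_im, Complex.one_re,
      Complex.one_im]
    ring
  have h1 : 0 < (1 - ‖a‖ ^ 2) * (1 - ‖z‖ ^ 2) :=
    mul_pos (by nlinarith [norm_nonneg a]) (by nlinarith [norm_nonneg z])
  linarith

/-- The **Koebe one-quarter theorem** at an arbitrary point of the disc. -/
theorem norm_deriv_mul_le_four_mul_of_injOn {f : ℂ → ℂ} (hf : DifferentiableOn ℂ f (ball 0 1))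
    (hinj : InjOn f (ball 0 1)) {v : ℂ} (hv : ∀ z ∈ ball (0 : ℂ) 1, f z ≠ v) {a : ℂ}
    (ha : a ∈ ball (0 : ℂ) 1) : ‖deriv f a‖ * (1 - ‖a‖ ^ 2) ≤ 4 * ‖f a - v‖ := by
  have ha1 : ‖a‖ < 1 := by simpa using ha
  set T : ℂ → ℂ := fun z ↦ (z + a) / (1 + (starRingEnd ℂ) a * z) with hT
  have hden : ∀ z ∈ ball (0 : ℂ) 1, 1 + (starRingEnd ℂ) a * z ≠ 0 := fun z hz ↦
    one_add_conj_mul_ne_zero ha1 (by simpa using hz)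
  have hTd : DifferentiableOn ℂ T (ball 0 1) :=
    DifferentiableOn.div (by fun_prop) (by fun_prop) hden
  have hTm : MapsTo T (ball 0 1) (ball 0 1) := fun z hz ↦
    mem_ball_zero_iff.2 (norm_add_div_one_add_conj_mul_lt_one ha1 (by simpa using hz))
  have hTinj : InjOn T (ball 0 1) := by
    intro z hz w hw h
    simp only [hT] at h
    rw [div_eq_div_iff (hden z hz) (hden w hw)] at h
    have h1 : (1 - (‖a‖ : ℂ) ^ 2) * (z - w) = 0 := by
      rw [← Complex.mul_conj']
      linear_combination h
    have h2 : (1 - (‖a‖ : ℂ) ^ 2) ≠ 0 := by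
      have : 1 - ‖a‖ ^ 2 ≠ 0 := by nlinarith [norm_nonneg a]
      exact_mod_cast this
    exact sub_eq_zero.1 ((mul_eq_zero.1 h1).resolve_left h2)
  have h0 : (0 : ℂ) ∈ ball (0 : ℂ) 1 := mem_ball_self one_pos
  have hT0 : T 0 = a := by simp [hT]
  have hTder : HasDerivAt T (1 - (‖a‖ : ℂ) ^ 2) 0 := by
    have h1 := ((hasDerivAt_id (0 : ℂ)).add_const a).div
      (((hasDerivAt_id (0 : ℂ)).const_mul ((starRingEnd ℂ) a)).const_add 1) (hden 0 h0)
    refine h1.congr_deriv ?_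
    rw [← Complex.mul_conj']
    simp
  have hcomp := (hf.differentiableAt (isOpen_ball.mem_nhds (hT0 ▸ ha))).hasDerivAt.comp 0 hTder
  have := norm_deriv_zero_le_four_mul_of_injOn (hf.comp hTd hTm) (hinj.comp hTinj hTm)
    (v := v) (fun z hz ↦ hv _ (hTm hz))
  rw [hcomp.deriv, norm_mul, Function.comp_apply, hT0] at this
  have e : ‖(1 - (‖a‖ : ℂ) ^ 2)‖ = 1 - ‖a‖ ^ 2 := by
    have : (1 - (‖a‖ : ℂ) ^ 2) = ((1 - ‖a‖ ^ 2 : ℝ) : ℂ) := by push_cast; rfl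
    rw [this, Complex.norm_real, Real.norm_of_nonneg (by nlinarith [norm_nonneg a])]
  rwa [e] at this

/-- The inverse of an injective holomorphic function is holomorphic. -/
theorem differentiableOn_image_of_leftInvOn {f g : ℂ → ℂ} {U : Set ℂ} (hU : IsOpen U)
    (hf : DifferentiableOn ℂ f U) (hg : LeftInvOn g f U) : DifferentiableOn ℂ g (f '' U) := by
  have hinj : InjOn f U := hg.injOn
  have han : AnalyticOnNhd ℂ f U := hf.analyticOnNhd hU
  have hnc : ∀ z ∈ U, ¬ ∀ᶠ w in nhds z, f w = f z := by
    intro z hz h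
    have h1 : ∀ᶠ w in nhds z, w = z := by
      filter_upwards [h, hU.mem_nhds hz] with w hw hwU using hinj hwU hz hw
    have h2 : ∀ᶠ w in nhdsWithin z {z}ᶜ, False := by
      filter_upwards [nhdsWithin_le_nhds h1, self_mem_nhdsWithin] with w hw hw' using hw' hw
    simpa using h2.exists
  have hopen : ∀ z ∈ U, nhds (f z) ≤ Filter.map f (nhds z) := fun z hz ↦
    (han z hz).eventually_constant_or_nhds_le_map_nhds.resolve_left (hnc z hz)
  have himg : IsOpen (f '' U) := by
    rw [isOpen_iff_mem_nhds]
    rintro _ ⟨z, hz, rfl⟩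
    exact hopen z hz (Filter.image_mem_map (hU.mem_nhds hz))
  have hcont : ∀ z ∈ U, ContinuousAt g (f z) := by
    intro z hz
    rw [ContinuousAt, hg hz]
    refine (Filter.map_mono (hopen z hz)).trans ?_
    rw [Filter.map_map]
    refine (Filter.tendsto_id (α := ℂ)).congr' ?_
    filter_upwards [hU.mem_nhds hz] with w hw using (hg hw).symm
  have hdiff : ∀ z ∈ U, deriv f z ≠ 0 → DifferentiableAt ℂ g (f z) := by
    intro z hz h0
    have h1 := ((hf.differentiableAt (hU.mem_nhds hz)).hasDerivAt)
    rw [← hg hz] at h1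
    refine (h1.of_local_left_inverse (hcont z hz) (by rwa [hg hz]) ?_).differentiableAt
    filter_upwards [himg.mem_nhds (mem_image_of_mem f hz)]
    rintro _ ⟨w, hw, rfl⟩
    rw [hg hw]
  rintro _ ⟨z, hz, rfl⟩
  refine (Complex.analyticAt_of_differentiable_on_punctured_nhds_of_continuousAt ?_
    (hcont z hz)).differentiableAt.differentiableWithinAt
  have hd : ∀ᶠ w in nhdsWithin z {z}ᶜ, deriv f w ≠ 0 := by
    refine (han z hz).deriv.eventually_eq_zero_or_eventually_ne_zero.resolve_left fun h ↦ ?_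
    obtain ⟨ε, hε, hb⟩ := Metric.eventually_nhds_iff_ball.1 (h.and (hU.mem_nhds hz))
    refine hnc z hz ?_
    filter_upwards [ball_mem_nhds z hε] with w hw
    exact isOpen_ball.is_const_of_deriv_eq_zero (convex_ball z ε).isPreconnected
      (hf.mono fun y hy ↦ (hb y hy).2) (fun y hy ↦ (hb y hy).1) hw (mem_ball_self hε)
  have hgt : Filter.Tendsto g (nhdsWithin (f z) {f z}ᶜ) (nhdsWithin z {z}ᶜ) := by
    refine tendsto_nhdsWithin_iff.2 ⟨?_, ?_⟩
    · have := (hcont z hz).tendsto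
      rw [hg hz] at this
      exact this.mono_left nhdsWithin_le_nhds
    · filter_upwards [nhdsWithin_le_nhds (himg.mem_nhds (mem_image_of_mem f hz)),
        self_mem_nhdsWithin]
      rintro _ ⟨w, hw, rfl⟩ hne h
      rw [hg hw] at h
      exact hne (congrArg f h)
  filter_upwards [hgt.eventually hd,
    nhdsWithin_le_nhds (himg.mem_nhds (mem_image_of_mem f hz))]
  rintro _ h ⟨w, hw, rfl⟩
  rw [hg hw] at h
  exact hdiff w hw h

/-- The **Schwarz-Pick lemma** on a disc with arbitrary centre and radius. -/
theorem norm_sub_le_mul_norm_one_sub_conj_mul {g : ℂ → ℂ} {w₀ w : ℂ} {d : ℝ}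
    (hg : DifferentiableOn ℂ g (ball w₀ d)) (hm : MapsTo g (ball w₀ d) (ball 0 1))
    (hw : w ∈ ball w₀ d) :
    ‖g w - g w₀‖ ≤ dist w w₀ / d * ‖1 - (starRingEnd ℂ) (g w₀) * g w‖ := by
  have hw₀ : w₀ ∈ ball w₀ d := mem_ball_self (dist_nonneg.trans_lt hw)
  have hn : ∀ y ∈ ball w₀ d, ‖g y‖ < 1 := fun y hy ↦ mem_ball_zero_iff.1 (hm hy)
  have ha : ‖-g w₀‖ < 1 := by rw [norm_neg]; exact hn _ hw₀
  have hden : ∀ y ∈ ball w₀ d, 1 + (starRingEnd ℂ) (-g w₀) * g y ≠ 0 := fun y hy ↦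
    one_add_conj_mul_ne_zero ha (hn y hy)
  set h : ℂ → ℂ := fun y ↦ (g y + -g w₀) / (1 + (starRingEnd ℂ) (-g w₀) * g y) with hh
  have h0 : h w₀ = 0 := by simp [hh]
  have hd : DifferentiableOn ℂ h (ball w₀ d) :=
    DifferentiableOn.div (by fun_prop) (by fun_prop) hden
  have hmh : MapsTo h (ball w₀ d) (closedBall (h w₀) 1) := by
    intro y hy
    rw [h0, mem_closedBall_zero_iff]
    exact (norm_add_div_one_add_conj_mul_lt_one ha (hn y hy)).le
  have key := Complex.dist_le_div_mul_dist_of_mapsTo_ball hd hmh hw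
  rw [h0, dist_zero_right, hh, norm_div, div_le_iff₀ (norm_pos_iff.2 (hden w hw))] at key
  simpa [sub_eq_add_neg, div_eq_inv_mul] using key

/-- A pseudo-hyperbolic disc of radius `ρ` about `a` is a Euclidean disc, and it stays away from
the unit circle. -/
theorem dist_lt_and_le_of_norm_sub_lt_mul_norm {a z : ℂ} {ρ : ℝ} (ha : ‖a‖ < 1) (hρ : 0 < ρ)
    (hρ1 : ρ < 1) (h : ‖z - a‖ < ρ * ‖1 - (starRingEnd ℂ) a * z‖) :
    dist z (((1 - ρ ^ 2) / (1 - ρ ^ 2 * ‖a‖ ^ 2) : ℝ) * a) <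
        ρ * (1 - ‖a‖ ^ 2) / (1 - ρ ^ 2 * ‖a‖ ^ 2) ∧
      (1 - ‖a‖ ^ 2) * (1 - ρ ^ 2) ≤ (1 - ‖z‖ ^ 2) * (1 + ρ * ‖a‖) ^ 2 := by
  have hx := norm_nonneg a
  set x := ‖a‖ with hxdef
  have hρx : ρ * x < 1 := by nlinarith
  have hρx0 : 0 ≤ ρ * x := by positivity
  have hD : 0 < 1 - ρ ^ 2 * x ^ 2 := by nlinarith
  have hx2 : 0 < 1 - x ^ 2 := by nlinarith
  have hρ2 : 0 < 1 - ρ ^ 2 := by nlinarith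
  set D := 1 - ρ ^ 2 * x ^ 2 with hDdef
  have hdist : dist z (((1 - ρ ^ 2) / D : ℝ) * a) < ρ * (1 - x ^ 2) / D := by
    have h2 : ‖z - a‖ ^ 2 < (ρ * ‖1 - (starRingEnd ℂ) a * z‖) ^ 2 :=
      pow_lt_pow_left₀ h (norm_nonneg _) two_ne_zero
    have e : (z - ((1 - ρ ^ 2) / D : ℝ) * a) * (D : ℂ) = D * z - (1 - ρ ^ 2 : ℝ) * a := by
      have : (D : ℂ) ≠ 0 := by exact_mod_cast hD.ne'
      push_cast
      field_simp
    have e2 : ‖(D * z - (1 - ρ ^ 2 : ℝ) * a : ℂ)‖ ^ 2 - (ρ * (1 - x ^ 2)) ^ 2 =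
        D * (‖z - a‖ ^ 2 - (ρ * ‖1 - (starRingEnd ℂ) a * z‖) ^ 2) := by
      simp only [mul_pow, hDdef, hxdef, ← Complex.normSq_eq_norm_sq, Complex.normSq_apply,
        Complex.sub_re, Complex.sub_im, Complex.mul_re, Complex.mul_im, Complex.conj_re,
        Complex.conj_im, Complex.one_re, Complex.one_im, Complex.ofReal_re, Complex.ofReal_im]
      ring
    have e3 : ‖z - ((1 - ρ ^ 2) / D : ℝ) * a‖ * D = ‖(D * z - (1 - ρ ^ 2 : ℝ) * a : ℂ)‖ := by
      rw [← e, norm_mul, Complex.norm_real, Real.norm_of_nonneg hD.le]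
    rw [lt_div_iff₀ hD, dist_eq_norm, e3]
    refine lt_of_pow_lt_pow_left₀ 2 (by positivity) ?_
    have := mul_neg_of_pos_of_neg hD (sub_neg.2 h2)
    linarith
  refine ⟨hdist, ?_⟩
  have h1 : ‖z‖ ≤ (x + ρ) / (1 + ρ * x) := by
    have h2 : ‖z‖ ≤ dist z (((1 - ρ ^ 2) / D : ℝ) * a) + (1 - ρ ^ 2) / D * x := by
      have := norm_le_norm_sub_add z (((1 - ρ ^ 2) / D : ℝ) * a)
      rwa [norm_mul, Complex.norm_real, Real.norm_of_nonneg (by positivity),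
        ← dist_eq_norm] at this
    have h3 : ρ * (1 - x ^ 2) / D + (1 - ρ ^ 2) / D * x = (x + ρ) / (1 + ρ * x) := by
      field_simp
      ring
    linarith
  rw [le_div_iff₀ (by positivity)] at h1
  have h4 := pow_le_pow_left₀ (by positivity) h1 2
  nlinarith

/-- A holomorphic function whose derivative is bounded by `K` increases lengths at most by the
factor `K`. -/
theorem hausdorffMeasure_image_le_of_norm_deriv_le {f : ℂ → ℂ} {O S : Set ℂ} (hO : IsOpen O)
    (hf : DifferentiableOn ℂ f O) {K : ℝ≥0} (hK : ∀ z ∈ O, ‖deriv f z‖₊ ≤ K) (hS : S ⊆ O) :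
    μH[1] (f '' S) ≤ K * μH[1] S := by
  have hnh : ∀ z ∈ O, ∃ ε > 0, ball z ε ⊆ O := fun z hz ↦ Metric.isOpen_iff.1 hO z hz
  choose! ε hε hball using hnh
  obtain ⟨t, htO, htc, hcov⟩ := TopologicalSpace.countable_cover_nhdsWithin
    (f := fun z ↦ ball z (ε z)) (s := O)
    (fun z hz ↦ nhdsWithin_le_nhds (ball_mem_nhds z (hε z hz)))
  rcases S.eq_empty_or_nonempty with rfl | hSne
  · simp
  have htne : t.Nonempty := by
    obtain ⟨s, hs⟩ := hSne
    obtain ⟨i, hi, -⟩ := mem_iUnion₂.1 (hcov (hS hs))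
    exact ⟨i, hi⟩
  obtain ⟨u, rfl⟩ := htc.exists_eq_range htne
  have hu : ∀ n, u n ∈ O := fun n ↦ htO (mem_range_self n)
  set A : ℕ → Set ℂ := disjointed fun n ↦ ball (u n) (ε (u n)) with hA
  have hAm : ∀ n, MeasurableSet (A n) := fun n ↦
    MeasurableSet.disjointed (fun _ ↦ measurableSet_ball) n
  have hSA : S = ⋃ n, S ∩ A n := by
    rw [← inter_iUnion, iUnion_disjointed, eq_comm, inter_eq_left]
    intro s hs
    simpa using hcov (hS hs)
  have hpiece : ∀ n, μH[1] (f '' (S ∩ A n)) ≤ K * μH[1] (S ∩ A n) := by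
    intro n
    have hlip : LipschitzOnWith K f (ball (u n) (ε (u n))) :=
      (convex_ball _ _).lipschitzOnWith_of_nnnorm_deriv_le
        (fun x hx ↦ hf.differentiableAt (hO.mem_nhds (hball _ (hu n) hx)))
        (fun x hx ↦ hK x (hball _ (hu n) hx))
    simpa using (hlip.mono
      (inter_subset_right.trans (disjointed_subset _ n))).hausdorffMeasure_image_le zero_le_one
  calc μH[1] (f '' S) = μH[1] (⋃ n, f '' (S ∩ A n)) := by rw [← image_iUnion, ← hSA]
    _ ≤ ∑' n, μH[1] (f '' (S ∩ A n)) := measure_iUnion_le _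
    _ ≤ ∑' n, K * μH[1] (S ∩ A n) := ENNReal.tsum_le_tsum hpiece
    _ = K * ∑' n, (μH[1] : Measure ℂ).restrict S (A n) := by
      rw [ENNReal.tsum_mul_left]
      simp only [Measure.restrict_apply (hAm _), inter_comm]
    _ = K * (μH[1] : Measure ℂ).restrict S (⋃ n, A n) := by
      rw [measure_iUnion (disjoint_disjointed _) hAm]
    _ ≤ K * μH[1] S := by
      refine mul_le_mul' le_rfl ?_
      exact (measure_mono (subset_univ _)).trans_eq (Measure.restrict_apply_univ S)

/-- If `Γ ⊆ Ω` is a curve whose preimage `γ = φ⁻¹(Γ)` under a conformal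
map `φ : Δ → Ω` is Ahlfors-regular with constant `C`, then for `w₀ ∈ Γ` and
`0 < r < dist(w₀, ∂Ω)/2` one has `Λ¹(D(w₀,r) ∩ Γ) ≤ 27 C r`. -/
theorem stmt_8 (φ : ℂ → ℂ) (Ω : Set ℂ)
    (hΩopen : IsOpen Ω) (hΩne : Ω.Nonempty) (hΩproper : Ω ≠ Set.univ)
    (hΩconn : IsConnected Ω) (hΩsc : SimplyConnectedSpace Ω)
    (hdiff : DifferentiableOn ℂ φ unitDisk)
    (hinj : Set.InjOn φ unitDisk)
    (honto : φ '' unitDisk = Ω)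
    (Γ : Set ℂ) (hΓ : Γ ⊆ Ω) (C : ℝ) (hC : 0 < C)
    (hreg : ∀ z : ℂ, ∀ r : ℝ, 0 < r →
      μH[1] ((unitDisk ∩ φ ⁻¹' Γ) ∩ Metric.ball z r) ≤ ENNReal.ofReal (C * r)) :
    ∀ w₀ ∈ Γ, ∀ r : ℝ, 0 < r → r < Metric.infDist w₀ (frontier Ω) / 2 →
      μH[1] (Metric.ball w₀ r ∩ Γ) ≤ ENNReal.ofReal (27 * C * r) := by
  intro w₀ hw₀ r hr hrd
  set d := infDist w₀ (frontier Ω) with hd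
  have hd0 : 0 < d := by linarith
  have hfne : (frontier Ω).Nonempty := by
    by_contra h
    rw [not_nonempty_iff_eq_empty.1 h, infDist_empty] at hd
    linarith
  obtain ⟨v, hvf, hvd⟩ := isClosed_frontier.exists_infDist_eq_dist hfne w₀
  have hvΩ : v ∉ Ω := fun h ↦ disjoint_left.1 (disjoint_frontier_iff_isOpen.2 hΩopen) hvf h
  have hballΩ : ball w₀ d ⊆ Ω := by
    refine (convex_ball w₀ d).isPreconnected.subset_left_of_subset_union hΩopen
      isClosed_closure.isOpen_compl (disjoint_compl_right.mono_left subset_closure) ?_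
      ⟨w₀, mem_ball_self hd0, hΓ hw₀⟩
    intro y hy
    by_contra h
    rw [mem_union, not_or, notMem_compl_iff] at h
    exact disjoint_left.1 disjoint_ball_infDist hy (hΩopen.frontier_eq ▸ ⟨h.2, h.1⟩)
  set ψ := Function.invFunOn φ unitDisk with hψ
  have hψl : LeftInvOn ψ φ unitDisk := hinj.leftInvOn_invFunOn
  have hUo : IsOpen unitDisk := isOpen_ball
  have hψd : DifferentiableOn ℂ ψ Ω := honto ▸ differentiableOn_image_of_leftInvOn hUo hdiff hψl
  have hψm : MapsTo ψ Ω unitDisk := by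
    rw [← honto]
    rintro _ ⟨z, hz, rfl⟩
    rwa [hψl hz]
  set a := ψ w₀ with ha
  have ha1 : ‖a‖ < 1 := mem_ball_zero_iff.1 (hψm (hΓ hw₀))
  set x := ‖a‖ with hx
  have hx0 : 0 ≤ x := norm_nonneg a
  set ρ := r / d with hρdef
  have hrρ : r = ρ * d := by rw [hρdef]; field_simp
  have hρ0 : 0 < ρ := div_pos hr hd0
  have hρ2 : ρ < 1 / 2 := by rw [hρdef, div_lt_iff₀ hd0]; linarith
  have hρx : ρ * x < 1 / 2 := by nlinarith
  have hρx0 : 0 ≤ ρ * x := by positivity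
  have hx2 : 0 < 1 - x ^ 2 := by nlinarith
  have hρ3 : 0 < 1 - ρ ^ 2 := by nlinarith
  have hD : 0 < 1 - ρ ^ 2 * x ^ 2 := by nlinarith
  set R := ρ * (1 - x ^ 2) / (1 - ρ ^ 2 * x ^ 2) with hR
  have hR0 : 0 < R := by positivity
  set c : ℂ := ((1 - ρ ^ 2) / (1 - ρ ^ 2 * x ^ 2) : ℝ) * a with hc
  set K := 4 * (d + r) * (1 + ρ * x) ^ 2 / ((1 - x ^ 2) * (1 - ρ ^ 2)) with hK
  have hK0 : 0 ≤ K := by positivity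
  set O := unitDisk ∩ φ ⁻¹' ball w₀ r with hO
  have hOo : IsOpen O := hdiff.continuousOn.isOpen_inter_preimage hUo isOpen_ball
  have hgeo : ∀ z ∈ O, dist z c < R ∧ (1 - x ^ 2) * (1 - ρ ^ 2) ≤
      (1 - ‖z‖ ^ 2) * (1 + ρ * x) ^ 2 := by
    rintro z ⟨hz, hzr⟩
    have hzr' : dist (φ z) w₀ < r := hzr
    refine dist_lt_and_le_of_norm_sub_lt_mul_norm ha1 hρ0 (by linarith) ?_
    have key := norm_sub_le_mul_norm_one_sub_conj_mul (hψd.mono hballΩ)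
      (hψm.mono_left hballΩ) (w := φ z) (mem_ball.2 (by linarith))
    rw [hψl hz] at key
    refine key.trans_lt ?_
    have hne : 0 < ‖1 - (starRingEnd ℂ) a * z‖ := by
      have := one_add_conj_mul_ne_zero (a := -a) (by rwa [norm_neg]) (mem_ball_zero_iff.1 hz)
      rw [norm_pos_iff]
      simpa [sub_eq_add_neg] using this
    have : dist (φ z) w₀ / d < ρ := div_lt_div_of_pos_right hzr' hd0
    gcongr
  have hder : ∀ z ∈ O, ‖deriv φ z‖₊ ≤ K.toNNReal := by
    intro z hz
    obtain ⟨-, hz2⟩ := hgeo z hz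
    have hz1 : ‖z‖ < 1 := mem_ball_zero_iff.1 hz.1
    have hz3 : 0 < 1 - ‖z‖ ^ 2 := by nlinarith [norm_nonneg z]
    have hkoebe := norm_deriv_mul_le_four_mul_of_injOn hdiff hinj (v := v)
      (fun y hy h ↦ hvΩ (h ▸ honto ▸ mem_image_of_mem φ hy)) hz.1
    have hdist : ‖φ z - v‖ ≤ d + r := by
      have h1 : dist (φ z) w₀ < r := hz.2
      have h2 := dist_triangle (φ z) w₀ v
      rw [← dist_eq_norm]
      linarith
    rw [← NNReal.coe_le_coe, coe_nnnorm, Real.coe_toNNReal _ hK0, hK, le_div_iff₀ (by positivity)]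
    calc ‖deriv φ z‖ * ((1 - x ^ 2) * (1 - ρ ^ 2))
        ≤ ‖deriv φ z‖ * ((1 - ‖z‖ ^ 2) * (1 + ρ * x) ^ 2) := by gcongr
      _ = ‖deriv φ z‖ * (1 - ‖z‖ ^ 2) * (1 + ρ * x) ^ 2 := by ring
      _ ≤ 4 * (d + r) * (1 + ρ * x) ^ 2 := by
        refine mul_le_mul_of_nonneg_right ?_ (by positivity)
        linarith
  have hKR : K * R ≤ 27 * r := by
    have e : K * R = 4 * r * ((1 + ρ * x) / ((1 - ρ) * (1 - ρ * x))) := by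
      have h1 : 1 - ρ ≠ 0 := by linarith
      have h2 : 1 - ρ * x ≠ 0 := by linarith
      have h3 : 1 + ρ ≠ 0 := by linarith
      have h4 : 1 + ρ * x ≠ 0 := by linarith
      have h5 : 1 - ρ ^ 2 = (1 - ρ) * (1 + ρ) := by ring
      have h6 : 1 - ρ ^ 2 * x ^ 2 = (1 - ρ * x) * (1 + ρ * x) := by ring
      rw [hK, hR, h5, h6, hrρ]
      field_simp
    have h7 : (1 + ρ * x) / ((1 - ρ) * (1 - ρ * x)) ≤ 6 := by
      rw [div_le_iff₀ (mul_pos (by linarith) (by linarith))]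
      nlinarith
    rw [e]
    nlinarith
  set S := ((unitDisk ∩ φ ⁻¹' Γ) ∩ ball c R) ∩ O with hS
  have hsub : ball w₀ r ∩ Γ ⊆ φ '' S := by
    rintro w ⟨hwr, hwΓ⟩
    obtain ⟨z, hz, rfl⟩ : w ∈ φ '' unitDisk := honto ▸ hΓ hwΓ
    exact ⟨z, ⟨⟨⟨hz, hwΓ⟩, (hgeo z ⟨hz, hwr⟩).1⟩, hz, hwr⟩, rfl⟩
  calc μH[1] (ball w₀ r ∩ Γ) ≤ μH[1] (φ '' S) := measure_mono hsub
    _ ≤ K.toNNReal * μH[1] S := hausdorffMeasure_image_le_of_norm_deriv_le hOo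
      (hdiff.mono inter_subset_left) hder inter_subset_right
    _ ≤ ENNReal.ofReal K * ENNReal.ofReal (C * R) := by
      refine mul_le_mul' le_rfl ?_
      exact (measure_mono inter_subset_left).trans (hreg c R hR0)
    _ ≤ ENNReal.ofReal (27 * C * r) := by
      rw [← ENNReal.ofReal_mul hK0]
      refine ENNReal.ofReal_le_ofReal ?_
      nlinarith
end
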